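/- arXiv:1503.05069 — 10 statements merged into one kernel-verified Lean document; each statement's English description precedes it below -/
import Mathlib

section
/- Let (T,d) be a nonempty compact metric space satisfying the four-point condition and let ρ ∈ T. Set Γ := sup_{σ∈T} d(ρ,σ) and D := sup_{σ,σ'∈T} d(σ,σ'). If σ₀, σ₁ ∈ T satisfy d(σ₀,σ₁) = D, then max( d(ρ,σ₀), d(ρ,σ₁) ) = Γ. -/
/-- Let `(T,d)` be a nonempty compact metric space satisfying the
four-point condition and let `ρ ∈ T`.  Set `Γ := ⨆ σ, d ρ σ` and `D := ⨆ (σ,σ'), d σ σ'`.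
If `d σ₀ σ₁ = D`, then `max (d ρ σ₀) (d ρ σ₁) = Γ`. -/
theorem stmt1 {T : Type*} [MetricSpace T] [CompactSpace T] [Nonempty T]
    (four_point : ∀ a b c d : T,
      dist a b + dist c d ≤ max (dist a c + dist b d) (dist a d + dist b c))
    (ρ : T) (Γ D : ℝ)
    (hΓ : Γ = ⨆ σ : T, dist ρ σ)
    (hD : D = ⨆ p : T × T, dist p.1 p.2)
    (σ₀ σ₁ : T) (h : dist σ₀ σ₁ = D) :
    max (dist ρ σ₀) (dist ρ σ₁) = Γ := by
  have bdd_dist : BddAbove (Set.range fun p : T × T => dist p.1 p.2) :=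
    (isCompact_range continuous_dist).bddAbove
  have bdd_height : BddAbove (Set.range fun σ : T => dist ρ σ) :=
    (isCompact_range (continuous_const.dist continuous_id)).bddAbove
  have dist_le (x y : T) : dist x y ≤ dist σ₀ σ₁ := by
    rw [h, hD]
    exact le_ciSup bdd_dist (x, y)
  rw [hΓ]
  apply le_antisymm
  · exact max_le (le_ciSup bdd_height σ₀) (le_ciSup bdd_height σ₁)
  · refine ciSup_le fun σ => ?_
    rcases le_max_iff.mp (four_point ρ σ σ₀ σ₁) with hσ | hσ
    · exact le_max_of_le_left (by linarith [dist_le σ σ₁])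
    · exact le_max_of_le_right (by linarith [dist_le σ σ₀])
end

section
/- Define θ(x) := (γ−1) x^{−1} s_γ(x) − ((γ−1)/γ) x^{−1−1/γ} ∫_0^x y^{1/γ−1} s_γ(y) dy for x > 0. Then θ is well-defined and continuous on (0,∞), ∫_0^∞ |θ(x)| dx < ∞, and ∫_0^∞ e^{−λx} θ(x) dx = λ^{1/γ} exp(−γ λ^{(γ−1)/γ}) for every λ ≥ 0. -/
open MeasureTheory

theorem integrableOn_exp_neg_mul_rpow_Ioi {p b : ℝ} (hp : 0 < p) (hb : 0 < b) :
    IntegrableOn (fun x : ℝ => Real.exp (-(b * x ^ p))) (Set.Ioi 0) := by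
  by_contra h
  have h1 := integral_exp_neg_mul_rpow hp hb
  have h2 : ∫ x in Set.Ioi (0:ℝ), Real.exp (-(b * x ^ p)) = 0 := integral_undef h
  simp only [← neg_mul] at h2
  have h3 : 0 < b ^ (-1 / p) * Real.Gamma (1 / p + 1) :=
    mul_pos (Real.rpow_pos_of_pos hb _) (Real.Gamma_pos_of_pos (by positivity))
  linarith

theorem integrableOn_exp_neg_mul_mul {s : ℝ → ℝ} (hs : IntegrableOn s (Set.Ioi 0)) {lam : ℝ}
    (hlam : 0 ≤ lam) :
    IntegrableOn (fun x => Real.exp (-(lam * x)) * s x) (Set.Ioi 0) := by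
  refine Integrable.bdd_mul (c := 1) hs (by fun_prop) ?_
  filter_upwards [ae_restrict_mem measurableSet_Ioi] with x hx
  rw [Real.norm_eq_abs, abs_of_pos (Real.exp_pos _), Real.exp_le_one_iff]
  have : (0:ℝ) < x := hx
  have := mul_nonneg hlam this.le
  linarith

/-- If the Laplace transform of a nonnegative `s` is integrable on `(0, ∞)`,
then so is `x⁻¹ s(x)`. -/
theorem integrableOn_inv_mul_of_laplace {s : ℝ → ℝ} (hs : IntegrableOn s (Set.Ioi 0))
    (hs0 : ∀ x ∈ Set.Ioi (0:ℝ), 0 ≤ s x)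
    (hL : IntegrableOn (fun lam => ∫ x in Set.Ioi (0:ℝ), Real.exp (-(lam * x)) * s x)
      (Set.Ioi 0)) :
    IntegrableOn (fun x => x⁻¹ * s x) (Set.Ioi 0) := by
  have hF : Integrable (fun p : ℝ × ℝ => Real.exp (-(p.1 * p.2)) * s p.2)
      ((volume.restrict (Set.Ioi 0)).prod (volume.restrict (Set.Ioi 0))) := by
    rw [integrable_prod_iff]
    · constructor
      · filter_upwards [ae_restrict_mem measurableSet_Ioi] with lam hlam
        exact integrableOn_exp_neg_mul_mul hs (le_of_lt hlam)
      · refine hL.congr ?_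
        filter_upwards with lam
        refine setIntegral_congr_fun measurableSet_Ioi fun x hx => ?_
        rw [Real.norm_of_nonneg (mul_nonneg (Real.exp_pos _).le (hs0 x hx))]
    · exact AEStronglyMeasurable.mul (by fun_prop) hs.aestronglyMeasurable.comp_snd
  refine hF.integral_prod_right.congr ?_
  filter_upwards [ae_restrict_mem measurableSet_Ioi] with x hx
  have hx' : (0:ℝ) < x := hx
  rw [integral_mul_const]
  congr 1
  have := integral_exp_mul_Ioi (a := -x) (by linarith) 0
  simp only [neg_mul, mul_comm x] at this
  rw [this]
  simp [neg_div_neg_eq]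

theorem mul_setIntegral_Ioi_rpow {a y : ℝ} (ha : 0 < a) (hy : 0 < y) :
    a * ∫ x in Set.Ioi y, x ^ (-1 - a) = y ^ (-a) := by
  rw [integral_Ioi_rpow_of_lt (by linarith) hy]
  have : -1 - a + 1 = -a := by ring
  rw [this]
  field_simp

theorem mul_setIntegral_Ioi_exp_mul_rpow {a lam y : ℝ} (ha : 0 < a) (hlam : 0 < lam)
    (hy : 0 < y) :
    a * ∫ x in Set.Ioi y, Real.exp (-(lam * x)) * x ^ (-1 - a)
      = Real.exp (-(lam * y)) * y ^ (-a)
        - lam * ∫ x in Set.Ioi y, Real.exp (-(lam * x)) * x ^ (-a) := by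
  have hmem : ∀ᵐ x ∂(volume.restrict (Set.Ioi y)), y < x := ae_restrict_mem measurableSet_Ioi
  have hexp : IntegrableOn (fun x => Real.exp (-(lam * x))) (Set.Ioi y) := by
    simpa only [neg_mul] using exp_neg_integrableOn_Ioi y hlam
  have h1 : IntegrableOn (fun x => Real.exp (-(lam * x)) * x ^ (-a)) (Set.Ioi y) := by
    refine Integrable.mul_bdd (c := y ^ (-a)) hexp (by measurability) ?_
    filter_upwards [hmem] with x hx
    rw [Real.norm_of_nonneg (Real.rpow_nonneg (hy.trans hx).le _)]
    exact Real.rpow_le_rpow_of_nonpos hy hx.le (by linarith)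
  have h2 : IntegrableOn (fun x => Real.exp (-(lam * x)) * x ^ (-1 - a)) (Set.Ioi y) := by
    refine Integrable.mul_bdd (c := y ^ (-1 - a)) hexp (by measurability) ?_
    filter_upwards [hmem] with x hx
    rw [Real.norm_of_nonneg (Real.rpow_nonneg (hy.trans hx).le _)]
    exact Real.rpow_le_rpow_of_nonpos hy hx.le (by linarith)
  have hd : ∀ x ∈ Set.Ici y, HasDerivAt (fun x => -(Real.exp (-(lam * x)) * x ^ (-a)))
      (lam * (Real.exp (-(lam * x)) * x ^ (-a)) + a * (Real.exp (-(lam * x)) * x ^ (-1 - a))) x := by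
    intro x hx
    have hx0 : 0 < x := hy.trans_le hx
    have e1 : HasDerivAt (fun x => Real.exp (-(lam * x))) (Real.exp (-(lam * x)) * -(lam * 1)) x :=
      (((hasDerivAt_id x).const_mul lam).neg).exp
    have e2 := Real.hasDerivAt_rpow_const (x := x) (p := -a) (Or.inl hx0.ne')
    have e3 := (e1.mul e2).neg
    refine e3.congr_deriv ?_
    have : -a - 1 = -1 - a := by ring
    rw [this]
    ring
  have ht : Filter.Tendsto (fun x => -(Real.exp (-(lam * x)) * x ^ (-a))) Filter.atTop (nhds 0) := by
    have t1 : Filter.Tendsto (fun x => Real.exp (-(lam * x))) Filter.atTop (nhds 0) :=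
      Real.tendsto_exp_neg_atTop_nhds_zero.comp (Filter.tendsto_id.const_mul_atTop hlam)
    simpa using (t1.mul (tendsto_rpow_neg_atTop ha)).neg
  have h3 := integral_Ioi_of_hasDerivAt_of_tendsto' hd ((h1.const_mul lam).add (h2.const_mul a)) ht
  rw [integral_add (h1.const_mul lam) (h2.const_mul a), integral_const_mul, integral_const_mul] at h3
  linarith

theorem inv_mul_exp_sub_setIntegral_Ioi {a lam y : ℝ} (ha : 0 < a) (hlam : 0 ≤ lam) (hy : 0 < y) :
    y⁻¹ * Real.exp (-(lam * y))
        - a * (y ^ (a - 1) * ∫ x in Set.Ioi y, Real.exp (-(lam * x)) * x ^ (-1 - a))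
      = lam ^ a * ∫ ν in Set.Ioi lam, Real.exp (-(y * ν)) * ν ^ (-a) := by
  have hya : y ^ (a - 1) * y ^ (-a) = y⁻¹ := by
    rw [← Real.rpow_add hy, ← Real.rpow_neg_one]
    congr 1
    ring
  rcases hlam.eq_or_lt with rfl | hlam
  · have := mul_setIntegral_Ioi_rpow ha hy
    simp only [zero_mul, neg_zero, Real.exp_zero, one_mul, Real.zero_rpow ha.ne', mul_one]
    rw [mul_left_comm, this, hya, sub_self]
  · have hsub := integral_comp_mul_left_Ioi (fun x => Real.exp (-(lam * x)) * x ^ (-a)) lam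
      (div_pos hy hlam)
    rw [div_mul_cancel₀ _ hlam.ne', smul_eq_mul] at hsub
    have hcong : ∫ ν in Set.Ioi lam, Real.exp (-(lam * (y / lam * ν))) * (y / lam * ν) ^ (-a)
        = (y / lam) ^ (-a) * ∫ ν in Set.Ioi lam, Real.exp (-(y * ν)) * ν ^ (-a) := by
      rw [← integral_const_mul]
      refine setIntegral_congr_fun measurableSet_Ioi fun ν hν => ?_
      rw [Real.mul_rpow (div_pos hy hlam).le (hlam.trans hν).le, ← mul_assoc lam,
        mul_div_cancel₀ _ hlam.ne']
      ring
    rw [hcong] at hsub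
    rw [mul_left_comm, mul_setIntegral_Ioi_exp_mul_rpow ha hlam hy, mul_sub]
    set J := ∫ ν in Set.Ioi lam, Real.exp (-(y * ν)) * ν ^ (-a)
    set I := ∫ x in Set.Ioi y, Real.exp (-(lam * x)) * x ^ (-a)
    have hI : I = (y / lam) * ((y / lam) ^ (-a) * J) := by
      rw [hsub]
      field_simp
    have hdiv : (y / lam) ^ (-a) = y ^ (-a) * lam ^ a := by
      rw [Real.div_rpow hy.le hlam.le, Real.rpow_neg hlam.le, div_inv_eq_mul]
    calc y⁻¹ * Real.exp (-(lam * y))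
          - (y ^ (a - 1) * (Real.exp (-(lam * y)) * y ^ (-a)) - y ^ (a - 1) * (lam * I))
        = y⁻¹ * Real.exp (-(lam * y)) - (y ^ (a - 1) * y ^ (-a)) * Real.exp (-(lam * y))
          + (y ^ (a - 1) * y ^ (-a)) * y * (lam / lam) * (lam ^ a * J) := by
          rw [hI, hdiv]; ring
      _ = lam ^ a * J := by
          rw [hya, inv_mul_cancel₀ hy.ne', div_self hlam.ne']; ring

/-- The integrand on the triangle `{0 < y ≤ x}` whose `y`-marginal is
`x ^ (-1 - a) * ∫ y in (0, x], y ^ (a - 1) * s y`. -/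
noncomputable def triangleKernel (a : ℝ) (s : ℝ → ℝ) : ℝ × ℝ → ℝ :=
  Set.indicator {p : ℝ × ℝ | p.2 ≤ p.1} fun p => p.1 ^ (-1 - a) * (p.2 ^ (a - 1) * s p.2)

theorem setIntegral_mul_triangleKernel_snd (a : ℝ) (s f : ℝ → ℝ) (x : ℝ) :
    ∫ y in Set.Ioi (0:ℝ), f x * triangleKernel a s (x, y)
      = f x * (x ^ (-1 - a) * ∫ y in Set.Ioc (0:ℝ) x, y ^ (a - 1) * s y) := by
  have h : ∀ y, triangleKernel a s (x, y)
      = (Set.Iic x).indicator (fun y => x ^ (-1 - a) * (y ^ (a - 1) * s y)) y := fun y => rfl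
  simp only [h]
  rw [integral_const_mul, setIntegral_indicator measurableSet_Iic, Set.Ioi_inter_Iic,
    integral_const_mul]

theorem setIntegral_mul_triangleKernel_fst (a : ℝ) (s f : ℝ → ℝ) {y : ℝ} (hy : 0 < y) :
    ∫ x in Set.Ioi (0:ℝ), f x * triangleKernel a s (x, y)
      = (y ^ (a - 1) * ∫ x in Set.Ioi y, f x * x ^ (-1 - a)) * s y := by
  have h : ∀ x, f x * triangleKernel a s (x, y)
      = (Set.Ici y).indicator (fun x => (f x * x ^ (-1 - a)) * (y ^ (a - 1) * s y)) x := by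
    intro x
    by_cases hxy : y ≤ x <;> simp [triangleKernel, hxy, mul_assoc]
  simp only [h]
  rw [setIntegral_indicator measurableSet_Ici,
    Set.inter_eq_right.2 (Set.Ici_subset_Ioi.2 hy), integral_Ici_eq_integral_Ioi,
    integral_mul_const]
  ring

theorem triangleKernel_nonneg (a : ℝ) {s : ℝ → ℝ} (hs0 : ∀ x ∈ Set.Ioi (0:ℝ), 0 ≤ s x)
    {x y : ℝ} (hx : 0 < x) (hy : 0 < y) : 0 ≤ triangleKernel a s (x, y) := by
  refine Set.indicator_apply_nonneg fun _ => ?_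
  have := hs0 y hy
  positivity

theorem integrable_triangleKernel {a : ℝ} (ha : 0 < a) {s : ℝ → ℝ}
    (hsm : AEStronglyMeasurable s (volume.restrict (Set.Ioi 0)))
    (hs0 : ∀ x ∈ Set.Ioi (0:ℝ), 0 ≤ s x)
    (hsi : IntegrableOn (fun x => x⁻¹ * s x) (Set.Ioi 0)) :
    Integrable (triangleKernel a s)
      ((volume.restrict (Set.Ioi 0)).prod (volume.restrict (Set.Ioi 0))) := by
  rw [integrable_prod_iff']
  · constructor
    · filter_upwards [ae_restrict_mem measurableSet_Ioi] with y hy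
      have hy' : (0:ℝ) < y := hy
      have h : (fun x => triangleKernel a s (x, y))
          = (Set.Ici y).indicator (fun x => x ^ (-1 - a) * (y ^ (a - 1) * s y)) := by
        ext x
        by_cases hxy : y ≤ x <;> simp [triangleKernel, hxy]
      rw [h, integrable_indicator_iff measurableSet_Ici, IntegrableOn,
        Measure.restrict_restrict measurableSet_Ici,
        Set.inter_eq_left.2 (Set.Ici_subset_Ioi.2 hy')]
      refine Integrable.mul_const ?_ _
      exact (integrableOn_Ici_iff_integrableOn_Ioi (by simp)).2 <|
        integrableOn_Ioi_rpow_of_lt (by linarith) hy'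
    · refine (hsi.const_mul a⁻¹).congr ?_
      filter_upwards [ae_restrict_mem measurableSet_Ioi] with y hy
      have hy' : (0:ℝ) < y := hy
      have h1 : ∫ x in Set.Ioi (0:ℝ), ‖triangleKernel a s (x, y)‖
          = ∫ x in Set.Ioi (0:ℝ), (fun _ => (1:ℝ)) x * triangleKernel a s (x, y) := by
        refine setIntegral_congr_fun measurableSet_Ioi fun x hx => ?_
        simp only [one_mul]
        exact Real.norm_of_nonneg (triangleKernel_nonneg a hs0 hx hy)
      rw [h1, setIntegral_mul_triangleKernel_fst a s _ hy']
      have h2 := mul_setIntegral_Ioi_rpow ha hy'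
      have h3 : y ^ (a - 1) * y ^ (-a) = y⁻¹ := by
        rw [← Real.rpow_add hy', ← Real.rpow_neg_one]
        congr 1
        ring
      simp only [one_mul]
      rw [← h3, ← h2]
      field_simp
  · refine AEStronglyMeasurable.indicator ?_ (measurableSet_le measurable_snd measurable_fst)
    refine AEStronglyMeasurable.mul (measurable_fst.pow_const _).aestronglyMeasurable
      (AEStronglyMeasurable.mul (measurable_snd.pow_const _).aestronglyMeasurable ?_)
    exact hsm.comp_snd

theorem hasDerivAt_neg_exp_neg_mul_rpow {γ x : ℝ} (hγ : γ ≠ 0) (hx : 0 < x) :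
    HasDerivAt (fun x => -Real.exp (-(γ * x ^ ((γ - 1) / γ))))
      ((γ - 1) * (Real.exp (-(γ * x ^ ((γ - 1) / γ))) * x ^ (-(1 / γ)))) x := by
  have e := (((Real.hasDerivAt_rpow_const (x := x) (p := (γ - 1) / γ)
    (Or.inl hx.ne')).const_mul γ).neg.exp).neg
  refine e.congr_deriv ?_
  have h : (γ - 1) / γ - 1 = -(1 / γ) := by field_simp; ring
  rw [h]
  simp only [Pi.neg_apply]
  field_simp

theorem setIntegral_Ioi_exp_neg_mul_rpow {γ lam : ℝ} (hγ : 1 < γ) (hlam : 0 < lam) :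
    IntegrableOn (fun x => Real.exp (-(γ * x ^ ((γ - 1) / γ))) * x ^ (-(1 / γ))) (Set.Ioi lam) ∧
    (γ - 1) * ∫ x in Set.Ioi lam, Real.exp (-(γ * x ^ ((γ - 1) / γ))) * x ^ (-(1 / γ))
      = Real.exp (-(γ * lam ^ ((γ - 1) / γ))) := by
  have hγ0 : 0 < γ := by linarith
  have hd : ∀ x ∈ Set.Ici lam, HasDerivAt (fun x => -Real.exp (-(γ * x ^ ((γ - 1) / γ))))
      ((γ - 1) * (Real.exp (-(γ * x ^ ((γ - 1) / γ))) * x ^ (-(1 / γ)))) x :=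
    fun x hx => hasDerivAt_neg_exp_neg_mul_rpow hγ0.ne' (hlam.trans_le hx)
  have ht : Filter.Tendsto (fun x : ℝ => -Real.exp (-(γ * x ^ ((γ - 1) / γ)))) Filter.atTop
      (nhds 0) := by
    have := (Real.tendsto_exp_neg_atTop_nhds_zero.comp ((tendsto_rpow_atTop
      (div_pos (sub_pos.2 hγ) hγ0)).const_mul_atTop hγ0)).neg
    simpa [Function.comp_def] using this
  have hi := integrableOn_Ioi_deriv_of_nonneg' hd (fun x hx => by
    have : 0 < x := hlam.trans hx
    have := sub_pos.2 hγ
    positivity) ht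
  have he := integral_Ioi_of_hasDerivAt_of_tendsto' hd hi ht
  constructor
  · refine (hi.const_mul (γ - 1)⁻¹).congr (Filter.Eventually.of_forall fun x => ?_)
    exact inv_mul_cancel_left₀ (sub_pos.2 hγ).ne' _
  · rw [integral_const_mul] at he
    linarith

/-- Fix `γ ∈ (1,2]` and let `s_γ` be the continuous density of the
spectrally positive stable law of index `(γ−1)/γ`.  Define
`θ(x) := (γ−1) x⁻¹ s_γ(x) − ((γ−1)/γ) x^{−1−1/γ} ∫_0^x y^{1/γ−1} s_γ(y) dy` for `x > 0`.
Then `θ` is well-defined and continuous on `(0,∞)`, `∫_0^∞ |θ| < ∞`, and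
`∫_0^∞ e^{−λx} θ(x) dx = λ^{1/γ} exp(−γ λ^{(γ−1)/γ})` for all `λ ≥ 0`. -/
theorem stmt4 (γ : ℝ) (hγ1 : 1 < γ) (hγ2 : γ ≤ 2)
    (s : ℝ → ℝ) (hs_cont : ContinuousOn s (Set.Ici 0))
    (hs_nonneg : ∀ x ∈ Set.Ici (0:ℝ), 0 ≤ s x)
    (hs_lap : ∀ lam : ℝ, 0 ≤ lam →
      (∫ x in Set.Ioi (0:ℝ), Real.exp (-(lam * x)) * s x)
        = Real.exp (-(γ * lam ^ ((γ - 1) / γ))))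
    (θ : ℝ → ℝ)
    (hθ : ∀ x ∈ Set.Ioi (0:ℝ),
      θ x = (γ - 1) * x⁻¹ * s x
        - ((γ - 1) / γ) * x ^ (-1 - 1/γ) * ∫ y in Set.Ioc (0:ℝ) x, y ^ (1/γ - 1) * s y) :
    (∀ x ∈ Set.Ioi (0:ℝ),
      IntegrableOn (fun y => y ^ (1/γ - 1) * s y) (Set.Ioc 0 x)) ∧
    ContinuousOn θ (Set.Ioi 0) ∧
    IntegrableOn θ (Set.Ioi 0) ∧
    ∀ lam : ℝ, 0 ≤ lam →
      (∫ x in Set.Ioi (0:ℝ), Real.exp (-(lam * x)) * θ x)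
        = lam ^ (1/γ) * Real.exp (-(γ * lam ^ ((γ - 1) / γ))) := by
  have hγ0 : 0 < γ := by linarith
  have hα : 0 < (γ - 1) / γ := div_pos (sub_pos.2 hγ1) hγ0
  have ha : 0 < 1 / γ := by positivity
  have hs0 : ∀ x ∈ Set.Ioi (0:ℝ), 0 ≤ s x := fun x hx => hs_nonneg x (Set.Ioi_subset_Ici_self hx)
  have hs_int : IntegrableOn s (Set.Ioi 0) := by
    by_contra h
    have h1 := hs_lap 0 le_rfl
    simp only [zero_mul, neg_zero, Real.exp_zero, one_mul, Real.zero_rpow hα.ne', mul_zero] at h1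
    rw [integral_undef h] at h1
    exact zero_ne_one h1
  have hsi : IntegrableOn (fun x => x⁻¹ * s x) (Set.Ioi 0) := by
    refine integrableOn_inv_mul_of_laplace hs_int hs0 ?_
    refine (integrableOn_exp_neg_mul_rpow_Ioi hα hγ0).congr_fun (fun lam hlam => ?_)
      measurableSet_Ioi
    exact (hs_lap lam (le_of_lt hlam)).symm
  have hK := integrable_triangleKernel ha hs_int.aestronglyMeasurable hs0 hsi
  have hloc : ∀ x : ℝ, 0 < x → IntegrableOn (fun y => y ^ (1/γ - 1) * s y) (Set.Icc 0 x) := by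
    intro x hx
    refine IntegrableOn.mul_continuousOn ?_ (hs_cont.mono Set.Icc_subset_Ici_self) isCompact_Icc
    have := intervalIntegral.intervalIntegrable_rpow' (a := 0) (b := x) (r := 1 / γ - 1)
      (by linarith)
    rwa [intervalIntegrable_iff_integrableOn_Icc_of_le hx.le] at this
  have hθ' : ∀ x ∈ Set.Ioi (0:ℝ), (γ - 1) * (x⁻¹ * s x) - (γ - 1) / γ *
      (x ^ (-1 - 1/γ) * ∫ y in Set.Ioc (0:ℝ) x, y ^ (1/γ - 1) * s y) = θ x := fun x hx => by
    rw [hθ x hx]; ring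
  have hB : IntegrableOn (fun x => x ^ (-1 - 1/γ) * ∫ y in Set.Ioc (0:ℝ) x, y ^ (1/γ - 1) * s y)
      (Set.Ioi 0) := by
    refine hK.integral_prod_left.congr ?_
    filter_upwards with x
    simpa using setIntegral_mul_triangleKernel_snd (1 / γ) s (fun _ => 1) x
  refine ⟨fun x hx => (hloc x hx).mono_set Set.Ioc_subset_Icc_self, ?_, ?_, fun lam hlam => ?_⟩
  · refine ContinuousOn.congr ?_ hθ
    have hne : ∀ x ∈ Set.Ioi (0:ℝ), x ≠ 0 := fun x hx => ne_of_gt hx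
    refine ContinuousOn.sub ?_ (ContinuousOn.mul (continuousOn_const.mul ?_) ?_)
    · exact (continuousOn_const.mul (continuousOn_id.inv₀ hne)).mul
        (hs_cont.mono Set.Ioi_subset_Ici_self)
    · exact continuousOn_id.rpow_const fun x hx => Or.inl (hne x hx)
    · intro x hx
      have hx' : (0:ℝ) < x := hx
      refine ContinuousAt.continuousWithinAt ?_
      exact (intervalIntegral.continuousOn_primitive (hloc (x + 1) (by linarith))).continuousAt
        (Icc_mem_nhds hx' (by linarith))
  · exact IntegrableOn.congr_fun ((hsi.const_mul (γ - 1)).sub (hB.const_mul ((γ - 1) / γ))) hθ'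
      measurableSet_Ioi
  · have hE : Integrable (fun p : ℝ × ℝ => Real.exp (-(lam * p.1)) * triangleKernel (1 / γ) s p)
        ((volume.restrict (Set.Ioi 0)).prod (volume.restrict (Set.Ioi 0))) := by
      refine Integrable.bdd_mul (c := 1) hK (by fun_prop) ?_
      have h1 : ∀ᵐ x ∂(volume.restrict (Set.Ioi (0:ℝ))), 0 < x := ae_restrict_mem measurableSet_Ioi
      filter_upwards [Measure.quasiMeasurePreserving_fst.ae h1] with p hp
      rw [Real.norm_eq_abs, abs_of_pos (Real.exp_pos _), Real.exp_le_one_iff]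
      have := mul_nonneg hlam hp.le
      linarith
    have hE2 : ∫ x in Set.Ioi (0:ℝ), Real.exp (-(lam * x)) *
          (x ^ (-1 - 1/γ) * ∫ y in Set.Ioc (0:ℝ) x, y ^ (1/γ - 1) * s y)
        = ∫ y in Set.Ioi (0:ℝ), (y ^ (1/γ - 1) *
            ∫ x in Set.Ioi y, Real.exp (-(lam * x)) * x ^ (-1 - 1/γ)) * s y := by
      calc _ = ∫ x in Set.Ioi (0:ℝ), ∫ y in Set.Ioi (0:ℝ),
            Real.exp (-(lam * x)) * triangleKernel (1 / γ) s (x, y) := by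
            congr 1
            ext x
            exact (setIntegral_mul_triangleKernel_snd (1 / γ) s
              (fun x => Real.exp (-(lam * x))) x).symm
        _ = ∫ y in Set.Ioi (0:ℝ), ∫ x in Set.Ioi (0:ℝ),
            Real.exp (-(lam * x)) * triangleKernel (1 / γ) s (x, y) :=
            integral_integral_swap hE
        _ = _ := setIntegral_congr_fun measurableSet_Ioi fun y hy =>
            setIntegral_mul_triangleKernel_fst (1 / γ) s (fun x => Real.exp (-(lam * x))) hy
    have hE3 : IntegrableOn (fun y => (y ^ (1/γ - 1) *
            ∫ x in Set.Ioi y, Real.exp (-(lam * x)) * x ^ (-1 - 1/γ)) * s y) (Set.Ioi 0) :=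
      IntegrableOn.congr_fun hE.integral_prod_right (fun y hy =>
            setIntegral_mul_triangleKernel_fst (1 / γ) s (fun x => Real.exp (-(lam * x))) hy)
            measurableSet_Ioi
    have hA := integrableOn_exp_neg_mul_mul hsi hlam
    have hmain : ∫ x in Set.Ioi (0:ℝ), Real.exp (-(lam * x)) * θ x
        = (γ - 1) * ∫ y in Set.Ioi (0:ℝ), lam ^ (1 / γ) *
          ∫ ν in Set.Ioi lam, s y * (Real.exp (-(y * ν)) * ν ^ (-(1 / γ))) := by
      calc _ = ∫ x in Set.Ioi (0:ℝ), ((γ - 1) * (Real.exp (-(lam * x)) * (x⁻¹ * s x))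
            - (γ - 1) / γ * (Real.exp (-(lam * x)) *
              (x ^ (-1 - 1/γ) * ∫ y in Set.Ioc (0:ℝ) x, y ^ (1/γ - 1) * s y))) := by
            refine setIntegral_congr_fun measurableSet_Ioi fun x hx => ?_
            rw [← hθ' x hx]
            ring
        _ = (γ - 1) * (∫ x in Set.Ioi (0:ℝ), Real.exp (-(lam * x)) * (x⁻¹ * s x))
            - (γ - 1) / γ * ∫ y in Set.Ioi (0:ℝ), (y ^ (1/γ - 1) *
              ∫ x in Set.Ioi y, Real.exp (-(lam * x)) * x ^ (-1 - 1/γ)) * s y := by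
            rw [integral_sub (hA.const_mul _)
              ((integrableOn_exp_neg_mul_mul hB hlam).const_mul _), integral_const_mul,
              integral_const_mul, hE2]
        _ = ∫ y in Set.Ioi (0:ℝ), ((γ - 1) * (Real.exp (-(lam * y)) * (y⁻¹ * s y))
            - (γ - 1) / γ * ((y ^ (1/γ - 1) *
              ∫ x in Set.Ioi y, Real.exp (-(lam * x)) * x ^ (-1 - 1/γ)) * s y)) := by
            rw [integral_sub (hA.const_mul _) (hE3.const_mul _), integral_const_mul,
              integral_const_mul]
        _ = _ := by
            rw [← integral_const_mul]
            refine setIntegral_congr_fun measurableSet_Ioi fun y hy => ?_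
            rw [integral_const_mul, mul_left_comm (lam ^ (1 / γ)),
              ← inv_mul_exp_sub_setIntegral_Ioi ha hlam hy]
            ring
    rw [hmain, integral_const_mul]
    rcases hlam.eq_or_lt with rfl | hlam'
    · simp [Real.zero_rpow (inv_pos.2 hγ0).ne']
    · obtain ⟨hJi, hJ⟩ := setIntegral_Ioi_exp_neg_mul_rpow hγ1 hlam'
      have hin : ∀ ν ∈ Set.Ioi lam,
          ∫ y in Set.Ioi (0:ℝ), s y * (Real.exp (-(y * ν)) * ν ^ (-(1 / γ)))
            = Real.exp (-(γ * ν ^ ((γ - 1) / γ))) * ν ^ (-(1 / γ)) := by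
        intro ν hν
        rw [← hs_lap ν (hlam'.trans hν).le, ← integral_mul_const]
        congr 1
        ext y
        rw [mul_comm y]
        ring
      rw [integral_integral_swap, setIntegral_congr_fun measurableSet_Ioi hin, ← hJ]
      · ring
      · have hm : AEStronglyMeasurable (Function.uncurry fun y ν : ℝ =>
            s y * (Real.exp (-(y * ν)) * ν ^ (-(1 / γ))))
            ((volume.restrict (Set.Ioi 0)).prod (volume.restrict (Set.Ioi lam))) :=
          AEStronglyMeasurable.mul hs_int.aestronglyMeasurable.comp_fst
            (AEStronglyMeasurable.mul (by fun_prop) (measurable_snd.pow_const _).aestronglyMeasurable)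
        rw [integrable_prod_iff' hm]
        constructor
        · filter_upwards [ae_restrict_mem measurableSet_Ioi] with ν hν
          refine ((integrableOn_exp_neg_mul_mul hs_int (hlam'.trans hν).le).mul_const
            (ν ^ (-(1 / γ)))).congr ?_
          filter_upwards with y
          simp only [Function.uncurry]
          rw [mul_comm y]
          ring
        · refine IntegrableOn.congr_fun hJi (fun ν hν => ?_) measurableSet_Ioi
          rw [← hin ν hν]
          refine setIntegral_congr_fun measurableSet_Ioi fun y hy => ?_
          have h1 := hs0 y hy
          have h2 : 0 < ν := hlam'.trans hν
          exact (Real.norm_of_nonneg (by positivity)).symm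
end

section
/- Define h⁺(x) := (γ−1) x^{−1} s_γ(x) and h⁻(x) := ((γ−1)/γ) x^{−1−1/γ} ∫_0^x y^{1/γ−1} s_γ(y) dy for x > 0. Then h⁺ and h⁻ are well-defined, continuous, nonnegative and Lebesgue integrable on (0,∞), and for every λ ≥ 0: ∫_0^∞ e^{−λx} h⁺(x) dx = (γ−1) ∫_λ^∞ exp(−γ μ^{(γ−1)/γ}) dμ, and ∫_0^∞ e^{−λx} h⁻(x) dx = (γ−1) ∫_λ^∞ exp(−γ μ^{(γ−1)/γ}) dμ − λ^{1/γ} exp(−γ λ^{(γ−1)/γ}). -/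
open MeasureTheory

open Set Filter Topology

/-- Dividing by `x` integrates the Laplace transform over `(lam, ∞)`. -/
lemma lintegral_exp_mul_inv_mul {s : ℝ → ℝ} (hs : Continuous s) (lam : ℝ) :
    ∫⁻ x in Ioi (0 : ℝ), ENNReal.ofReal (Real.exp (-(lam * x)) * (x⁻¹ * s x))
      = ∫⁻ μ in Ioi lam, ∫⁻ x in Ioi (0 : ℝ), ENNReal.ofReal (Real.exp (-(μ * x)) * s x) := by
  rw [lintegral_lintegral_swap (by fun_prop)]
  refine setLIntegral_congr_fun measurableSet_Ioi fun x (hx : 0 < x) => ?_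
  have hint : ∫ μ in Ioi lam, Real.exp (-x * μ) = Real.exp (-(lam * x)) * x⁻¹ := by
    rw [integral_exp_mul_Ioi (by linarith)]
    rw [neg_div_neg_eq, div_eq_mul_inv, neg_mul, mul_comm x lam]
  have h1 : ∫⁻ μ in Ioi lam, ENNReal.ofReal (Real.exp (-(μ * x)))
      = ENNReal.ofReal (Real.exp (-(lam * x)) * x⁻¹) := by
    rw [← hint, ofReal_integral_eq_lintegral_ofReal (integrableOn_exp_mul_Ioi (by linarith) lam)
      (ae_of_all _ fun _ => (Real.exp_pos _).le)]
    simp only [neg_mul, mul_comm x]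
  simp only [ENNReal.ofReal_mul (Real.exp_pos _).le]
  rw [lintegral_mul_const _ (by fun_prop), h1, ENNReal.ofReal_mul (Real.exp_pos _).le,
    ENNReal.ofReal_mul (inv_pos.2 hx).le, mul_assoc]

lemma integrableOn_exp_mul_rpow {a c y : ℝ} (ha : 0 < a) (hc : 0 ≤ c) (hy : 0 < y) :
    IntegrableOn (fun x : ℝ => Real.exp (-(c * x)) * x ^ (-1 - a)) (Ioi y) := by
  refine (integrableOn_Ioi_rpow_of_lt (a := -1 - a) (by linarith) hy).mono'
    (by fun_prop) ?_
  refine (ae_restrict_mem measurableSet_Ioi).mono fun x (hx : y < x) => ?_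
  have hx0 : 0 < x := hy.trans hx
  have hp : 0 < x ^ (-1 - a) := Real.rpow_pos_of_pos hx0 _
  rw [Real.norm_of_nonneg (by positivity)]
  refine mul_le_of_le_one_left hp.le (Real.exp_le_one_iff.2 ?_)
  have := mul_nonneg hc hx0.le
  linarith

/-- Scaling identity for the incomplete gamma kernel. -/
lemma lintegral_exp_mul_rpow_scale {a lam y : ℝ} (ha : 0 < a) (hlam : 0 ≤ lam) (hy : 0 < y) :
    ENNReal.ofReal (y ^ (a - 1))
        * ∫⁻ x in Ioi y, ENNReal.ofReal (Real.exp (-(lam * x)) * x ^ (-1 - a))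
      = ENNReal.ofReal y⁻¹
        * ∫⁻ t in Ioi (1 : ℝ), ENNReal.ofReal (Real.exp (-(lam * t * y)) * t ^ (-1 - a)) := by
  have e : ∀ t : ℝ, Real.exp (-(lam * t * y)) = Real.exp (-(lam * y * t)) := fun t => by
    ring_nf
  simp only [e]
  rw [← ofReal_integral_eq_lintegral_ofReal (integrableOn_exp_mul_rpow ha hlam hy)
      ((ae_restrict_mem measurableSet_Ioi).mono fun x (hx : y < x) => ?_),
    ← ofReal_integral_eq_lintegral_ofReal
      (integrableOn_exp_mul_rpow ha (mul_nonneg hlam hy.le) one_pos)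
      ((ae_restrict_mem measurableSet_Ioi).mono fun x (hx : 1 < x) => ?_),
    ← ENNReal.ofReal_mul (by positivity), ← ENNReal.ofReal_mul (by positivity)]
  · congr 1
    have h := integral_comp_mul_left_Ioi'
      (fun x : ℝ => Real.exp (-(lam * x)) * x ^ (-1 - a)) 1 hy
    rw [mul_one] at h
    rw [← h, smul_eq_mul, ← integral_const_mul, ← integral_const_mul, ← integral_const_mul]
    refine setIntegral_congr_fun measurableSet_Ioi fun t (ht : 1 < t) => ?_
    have ht0 : 0 < t := one_pos.trans ht
    have e2 : y ^ (a - 1) * y * y ^ (-1 - a) = y⁻¹ := by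
      rw [mul_assoc, ← Real.rpow_one_add' hy.le (by linarith), ← Real.rpow_add hy,
        ← Real.rpow_neg_one]
      congr 1; ring
    rw [Real.mul_rpow hy.le ht0.le, ← e2, ← mul_assoc lam y t]
    ring
  · have : 0 < x := one_pos.trans hx
    simp only [Pi.zero_apply]
    positivity
  · have : 0 < x := hy.trans hx
    simp only [Pi.zero_apply]
    positivity

/-- Tonelli for the averaged density. -/
lemma lintegral_exp_mul_rpow_mul_lintegral {s : ℝ → ℝ} (hs : Continuous s)
    {a lam : ℝ} (ha : 0 < a) (hlam : 0 ≤ lam) :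
    ∫⁻ x in Ioi (0 : ℝ), ENNReal.ofReal (Real.exp (-(lam * x)) * x ^ (-1 - a))
        * ∫⁻ y in Ioc 0 x, ENNReal.ofReal (y ^ (a - 1) * s y)
      = ∫⁻ t in Ioi (1 : ℝ), ENNReal.ofReal (t ^ (-1 - a))
        * ∫⁻ y in Ioi (0 : ℝ), ENNReal.ofReal (Real.exp (-(lam * t * y)) * (y⁻¹ * s y)) := by
  have hm : MeasurableSet {p : ℝ × ℝ | p.2 ≤ p.1} := measurableSet_le (by fun_prop) (by fun_prop)
  set k : ℝ → ℝ → ENNReal := fun x y => {p : ℝ × ℝ | p.2 ≤ p.1}.indicator (fun p : ℝ × ℝ =>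
    ENNReal.ofReal (Real.exp (-(lam * p.1)) * p.1 ^ (-1 - a))
      * ENNReal.ofReal (p.2 ^ (a - 1) * s p.2)) (x, y) with hk
  have hkm : Measurable (Function.uncurry k) := by
    have : Function.uncurry k = {p : ℝ × ℝ | p.2 ≤ p.1}.indicator (fun p : ℝ × ℝ =>
      ENNReal.ofReal (Real.exp (-(lam * p.1)) * p.1 ^ (-1 - a))
        * ENNReal.ofReal (p.2 ^ (a - 1) * s p.2)) := rfl
    rw [this]
    exact Measurable.indicator (by fun_prop) hm
  have hL : ∫⁻ x in Ioi (0 : ℝ), ENNReal.ofReal (Real.exp (-(lam * x)) * x ^ (-1 - a))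
        * ∫⁻ y in Ioc 0 x, ENNReal.ofReal (y ^ (a - 1) * s y)
      = ∫⁻ x in Ioi (0 : ℝ), ∫⁻ y in Ioi (0 : ℝ), k x y := by
    refine setLIntegral_congr_fun measurableSet_Ioi fun x _ => ?_
    rw [← lintegral_const_mul _ (by fun_prop), ← Ioi_inter_Iic, inter_comm,
      ← setLIntegral_indicator measurableSet_Iic]
    rfl
  have hR : ∀ y ∈ Ioi (0 : ℝ), ∫⁻ x in Ioi (0 : ℝ), k x y
      = ∫⁻ t in Ioi (1 : ℝ), ENNReal.ofReal (t ^ (-1 - a))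
        * ENNReal.ofReal (Real.exp (-(lam * t * y)) * (y⁻¹ * s y)) := by
    intro y (hy : 0 < y)
    have h1 : ∫⁻ x in Ioi (0 : ℝ), k x y = ∫⁻ x in Ioi y,
        ENNReal.ofReal (Real.exp (-(lam * x)) * x ^ (-1 - a))
          * ENNReal.ofReal (y ^ (a - 1) * s y) := by
      rw [← setLIntegral_congr (Ioi_ae_eq_Ici (a := y)).symm]
      have : Ici y = Ici y ∩ Ioi 0 := by
        ext x; simp only [mem_Ici, mem_inter_iff, mem_Ioi]; grind
      rw [this, ← setLIntegral_indicator measurableSet_Ici]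
      rfl
    rw [h1, lintegral_mul_const _ (by fun_prop), ENNReal.ofReal_mul (by positivity), ← mul_assoc,
      mul_comm _ (ENNReal.ofReal (y ^ (a - 1))), lintegral_exp_mul_rpow_scale ha hlam hy,
      mul_right_comm, ← ENNReal.ofReal_mul (by positivity), mul_comm,
      ← lintegral_mul_const _ (by fun_prop)]
    refine setLIntegral_congr_fun measurableSet_Ioi fun t (ht : 1 < t) => ?_
    have ht0 : 0 < t := one_pos.trans ht
    rw [ENNReal.ofReal_mul (Real.exp_pos _).le, ENNReal.ofReal_mul (Real.exp_pos _).le]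
    ring
  rw [hL, lintegral_lintegral_swap hkm.aemeasurable, setLIntegral_congr_fun measurableSet_Ioi hR,
    lintegral_lintegral_swap (by fun_prop)]
  refine setLIntegral_congr_fun measurableSet_Ioi fun t _ => ?_
  rw [lintegral_const_mul _ (by fun_prop)]

section StableExponent

variable {γ : ℝ}

lemma continuous_exp_neg_mul_rpow (hγ : 1 < γ) :
    Continuous fun μ : ℝ => Real.exp (-(γ * μ ^ ((γ - 1) / γ))) := by
  have h0 : 0 ≤ (γ - 1) / γ := div_nonneg (by linarith) (by linarith)
  have := Real.continuous_rpow_const h0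
  fun_prop

lemma integrableOn_exp_neg_mul_rpow (hγ : 1 < γ) :
    IntegrableOn (fun μ : ℝ => Real.exp (-(γ * μ ^ ((γ - 1) / γ)))) (Ioi 0) := by
  have h := integrableOn_rpow_mul_exp_neg_mul_rpow (s := 0) (p := (γ - 1) / γ) (b := γ)
    (by norm_num) (div_pos (by linarith) (by linarith)) (by linarith)
  simpa using h

lemma tail_integral_nonneg (lam : ℝ) :
    0 ≤ ∫ μ in Ioi lam, Real.exp (-(γ * μ ^ ((γ - 1) / γ))) :=
  integral_nonneg fun _ => (Real.exp_pos _).le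

lemma tail_integral_le (hγ : 1 < γ) {lam : ℝ} (hlam : 0 ≤ lam) :
    ∫ μ in Ioi lam, Real.exp (-(γ * μ ^ ((γ - 1) / γ)))
      ≤ ∫ μ in Ioi (0 : ℝ), Real.exp (-(γ * μ ^ ((γ - 1) / γ))) :=
  setIntegral_mono_set (integrableOn_exp_neg_mul_rpow hγ)
    (ae_of_all _ fun _ => (Real.exp_pos _).le) (Ioi_subset_Ioi hlam).eventuallyLE

lemma tail_integral_eq_sub (hγ : 1 < γ) {lam : ℝ} (hlam : 0 ≤ lam) :
    ∫ μ in Ioi lam, Real.exp (-(γ * μ ^ ((γ - 1) / γ)))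
      = (∫ μ in Ioi (0 : ℝ), Real.exp (-(γ * μ ^ ((γ - 1) / γ))))
        - ∫ μ in (0 : ℝ)..lam, Real.exp (-(γ * μ ^ ((γ - 1) / γ))) := by
  rw [← intervalIntegral.integral_interval_add_Ioi (integrableOn_exp_neg_mul_rpow hγ)
    ((integrableOn_exp_neg_mul_rpow hγ).mono_set (Ioi_subset_Ioi hlam))]
  ring

/-- `G(lam t)` as a function of `t`, for `G` the tail integral. -/
lemma hasDerivAt_tail_integral_mul (hγ : 1 < γ) {lam t : ℝ} (hlam : 0 ≤ lam) (ht : 0 < t) :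
    HasDerivAt (fun t : ℝ => ∫ μ in Ioi (lam * t), Real.exp (-(γ * μ ^ ((γ - 1) / γ))))
      (-(Real.exp (-(γ * (lam * t) ^ ((γ - 1) / γ))) * lam)) t := by
  have hc := continuous_exp_neg_mul_rpow hγ
  have h1 := (hc.integral_hasStrictDerivAt 0 (lam * t)).hasDerivAt
  have h2 : HasDerivAt (fun t : ℝ => lam * t) lam t := by
    simpa using (hasDerivAt_id t).const_mul lam
  have h3 := (h1.comp t h2).const_sub
    (∫ μ in Ioi (0 : ℝ), Real.exp (-(γ * μ ^ ((γ - 1) / γ))))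
  refine h3.congr_of_eventuallyEq ?_
  filter_upwards [eventually_gt_nhds ht] with u hu
  exact tail_integral_eq_sub hγ (mul_nonneg hlam hu.le)

/-- An antiderivative of `t ^ (-1 - 1/γ) G(lam t)`, for `G` the tail integral. -/
lemma hasDerivAt_rpow_mul_tail_integral (hγ : 1 < γ) {lam t : ℝ} (hlam : 0 ≤ lam) (ht : 0 < t) :
    HasDerivAt (fun t : ℝ =>
        -(γ * (t ^ (-(1 / γ)) * ∫ μ in Ioi (lam * t), Real.exp (-(γ * μ ^ ((γ - 1) / γ)))))
          + γ / (γ - 1) * (lam ^ (1 / γ) * Real.exp (-(γ * (lam * t) ^ ((γ - 1) / γ)))))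
      (t ^ (-1 - 1 / γ) * ∫ μ in Ioi (lam * t), Real.exp (-(γ * μ ^ ((γ - 1) / γ)))) t := by
  have hγ0 : 0 < γ := by linarith
  have hγ1 : γ - 1 ≠ 0 := by linarith
  have hG := hasDerivAt_tail_integral_mul hγ hlam ht
  have hp : HasDerivAt (fun t : ℝ => t ^ (-(1 / γ))) (-(1 / γ) * t ^ (-(1 / γ) - 1)) t :=
    Real.hasDerivAt_rpow_const (Or.inl ht.ne')
  have hA := ((hp.mul hG).const_mul γ).neg
  have hE : HasDerivAt (fun t : ℝ =>
      γ / (γ - 1) * (lam ^ (1 / γ) * Real.exp (-(γ * (lam * t) ^ ((γ - 1) / γ)))))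
      (-(γ * Real.exp (-(γ * (lam * t) ^ ((γ - 1) / γ))) * lam * t ^ (-(1 / γ)))) t := by
    rcases hlam.eq_or_lt with rfl | hl
    · have hz : (0 : ℝ) ^ (1 / γ) = 0 := Real.zero_rpow (by positivity)
      simpa only [hz, zero_mul, mul_zero, neg_zero] using hasDerivAt_const t (0 : ℝ)
    · have hlt : 0 < lam * t := mul_pos hl ht
      have h2 : HasDerivAt (fun t : ℝ => lam * t) lam t := by
        simpa using (hasDerivAt_id t).const_mul lam
      refine ((((h2.rpow_const (p := (γ - 1) / γ) (Or.inl hlt.ne')).const_mul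
        γ).neg.exp.const_mul (lam ^ (1 / γ))).const_mul (γ / (γ - 1))).congr_deriv ?_
      have e1 : (lam * t) ^ ((γ - 1) / γ - 1) = lam ^ (-(1 / γ)) * t ^ (-(1 / γ)) := by
        rw [← Real.mul_rpow hl.le ht.le]
        congr 1; field_simp; ring
      have e2 : lam ^ (1 / γ) * lam ^ (-(1 / γ)) = 1 := by
        rw [← Real.rpow_add hl]; simp
      rw [e1]
      simp only [Pi.neg_apply]
      set E := Real.exp (-(γ * (lam * t) ^ ((γ - 1) / γ)))
      calc _ = -(γ * E * lam * t ^ (-(1 / γ)) * (lam ^ (1 / γ) * lam ^ (-(1 / γ)))) := by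
            field_simp
        _ = _ := by rw [e2, mul_one]
  refine (hA.add hE).congr_deriv ?_
  rw [show -1 - 1 / γ = -(1 / γ) - 1 by ring]
  field_simp
  ring

lemma tendsto_rpow_mul_tail_integral (hγ : 1 < γ) {lam : ℝ} (hlam : 0 ≤ lam) :
    Tendsto (fun t : ℝ =>
        -(γ * (t ^ (-(1 / γ)) * ∫ μ in Ioi (lam * t), Real.exp (-(γ * μ ^ ((γ - 1) / γ)))))
          + γ / (γ - 1) * (lam ^ (1 / γ) * Real.exp (-(γ * (lam * t) ^ ((γ - 1) / γ)))))
      atTop (𝓝 0) := by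
  have hγ0 : 0 < γ := by linarith
  have hp : Tendsto (fun t : ℝ => t ^ (-(1 / γ))) atTop (𝓝 0) :=
    tendsto_rpow_neg_atTop (by positivity)
  have h1 : Tendsto (fun t : ℝ =>
      t ^ (-(1 / γ)) * ∫ μ in Ioi (lam * t), Real.exp (-(γ * μ ^ ((γ - 1) / γ))))
      atTop (𝓝 0) := by
    have hb := hp.mul_const (∫ μ in Ioi (0 : ℝ), Real.exp (-(γ * μ ^ ((γ - 1) / γ))))
    rw [zero_mul] at hb
    refine squeeze_zero' ?_ ?_ hb
    · filter_upwards [eventually_ge_atTop 0] with t ht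
      exact mul_nonneg (Real.rpow_nonneg ht _) (tail_integral_nonneg _)
    · filter_upwards [eventually_ge_atTop 0] with t ht
      exact mul_le_mul_of_nonneg_left (tail_integral_le hγ (mul_nonneg hlam ht))
        (Real.rpow_nonneg ht _)
  have h2 : Tendsto (fun t : ℝ =>
      lam ^ (1 / γ) * Real.exp (-(γ * (lam * t) ^ ((γ - 1) / γ)))) atTop (𝓝 0) := by
    rcases hlam.eq_or_lt with rfl | hl
    · simp [Real.zero_rpow (inv_ne_zero hγ0.ne')]
    · have h3 := (tendsto_rpow_atTop (y := (γ - 1) / γ)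
        (div_pos (by linarith) hγ0)).comp (tendsto_id.const_mul_atTop hl)
      simpa using (Real.tendsto_exp_neg_atTop_nhds_zero.comp
        (h3.const_mul_atTop hγ0)).const_mul (lam ^ (1 / γ))
  simpa using (h1.const_mul γ).neg.add (h2.const_mul (γ / (γ - 1)))

/-- Averaging the tail integral against `t ^ (-1 - 1/γ)` on `(1, ∞)`. -/
lemma integral_rpow_mul_tail_integral (hγ : 1 < γ) {lam : ℝ} (hlam : 0 ≤ lam) :
    IntegrableOn (fun t : ℝ => t ^ (-1 - 1 / γ)
        * ∫ μ in Ioi (lam * t), Real.exp (-(γ * μ ^ ((γ - 1) / γ)))) (Ioi 1) ∧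
    ∫ t in Ioi (1 : ℝ), t ^ (-1 - 1 / γ)
        * ∫ μ in Ioi (lam * t), Real.exp (-(γ * μ ^ ((γ - 1) / γ)))
      = γ * (∫ μ in Ioi lam, Real.exp (-(γ * μ ^ ((γ - 1) / γ))))
        - γ / (γ - 1) * (lam ^ (1 / γ) * Real.exp (-(γ * lam ^ ((γ - 1) / γ)))) := by
  have hd : ∀ t ∈ Ici (1 : ℝ), HasDerivAt _ _ t := fun t (ht : 1 ≤ t) =>
    hasDerivAt_rpow_mul_tail_integral hγ hlam (one_pos.trans_le ht)
  have hnn : ∀ t ∈ Ioi (1 : ℝ), 0 ≤ t ^ (-1 - 1 / γ)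
      * ∫ μ in Ioi (lam * t), Real.exp (-(γ * μ ^ ((γ - 1) / γ))) := fun t (ht : 1 < t) =>
    mul_nonneg (Real.rpow_nonneg (one_pos.trans ht).le _) (tail_integral_nonneg _)
  have hlim := tendsto_rpow_mul_tail_integral hγ hlam
  refine ⟨integrableOn_Ioi_deriv_of_nonneg' hd hnn hlim, ?_⟩
  rw [integral_Ioi_of_hasDerivAt_of_nonneg' hd hnn hlim]
  simp only [mul_one, Real.one_rpow, one_mul]
  ring

end StableExponent

lemma integrableOn_and_integral_eq_of_lintegral {α : Type*} [MeasurableSpace α] {ν : Measure α}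
    {S : Set α} (hS : MeasurableSet S) {f : α → ℝ} {c : ℝ} (hc : 0 ≤ c)
    (hf : AEStronglyMeasurable f (ν.restrict S)) (hnn : ∀ x ∈ S, 0 ≤ f x)
    (h : ∫⁻ x in S, ENNReal.ofReal (f x) ∂ν = ENNReal.ofReal c) :
    IntegrableOn f S ν ∧ ∫ x in S, f x ∂ν = c := by
  have hae : 0 ≤ᵐ[ν.restrict S] f := (ae_restrict_mem hS).mono hnn
  refine ⟨⟨hf, ?_⟩, ?_⟩
  · rw [hasFiniteIntegral_iff_ofReal hae, h]
    exact ENNReal.ofReal_lt_top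
  · rw [integral_eq_lintegral_of_nonneg_ae hae hf, h, ENNReal.toReal_ofReal hc]

lemma integrableOn_rpow_mul_continuous {s : ℝ → ℝ} (hs : Continuous s) {a x : ℝ} (ha : 0 < a)
    (hx : 0 ≤ x) : IntegrableOn (fun y => y ^ (a - 1) * s y) (Ioc 0 x) := by
  rw [← intervalIntegrable_iff_integrableOn_Ioc_of_le hx]
  exact (intervalIntegral.intervalIntegrable_rpow' (by linarith)).mul_continuousOn hs.continuousOn

section LaplaceStable

variable {γ : ℝ} {s : ℝ → ℝ}

lemma lintegral_exp_mul_density (hs0 : ∀ x, 0 ≤ s x)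
    (hlap : ∀ lam : ℝ, 0 ≤ lam → (∫ x in Ioi (0 : ℝ), Real.exp (-(lam * x)) * s x)
      = Real.exp (-(γ * lam ^ ((γ - 1) / γ)))) {lam : ℝ} (hlam : 0 ≤ lam) :
    ∫⁻ x in Ioi (0 : ℝ), ENNReal.ofReal (Real.exp (-(lam * x)) * s x)
      = ENNReal.ofReal (Real.exp (-(γ * lam ^ ((γ - 1) / γ)))) := by
  rw [← hlap lam hlam]
  refine (ofReal_integral_eq_lintegral_ofReal (Integrable.of_integral_ne_zero ?_)
    (ae_of_all _ fun x => mul_nonneg (Real.exp_pos _).le (hs0 x))).symm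
  rw [hlap lam hlam]
  exact (Real.exp_pos _).ne'

lemma lintegral_exp_mul_inv_mul_density (hγ : 1 < γ) (hs : Continuous s) (hs0 : ∀ x, 0 ≤ s x)
    (hlap : ∀ lam : ℝ, 0 ≤ lam → (∫ x in Ioi (0 : ℝ), Real.exp (-(lam * x)) * s x)
      = Real.exp (-(γ * lam ^ ((γ - 1) / γ)))) {lam : ℝ} (hlam : 0 ≤ lam) :
    ∫⁻ x in Ioi (0 : ℝ), ENNReal.ofReal (Real.exp (-(lam * x)) * (x⁻¹ * s x))
      = ENNReal.ofReal (∫ μ in Ioi lam, Real.exp (-(γ * μ ^ ((γ - 1) / γ)))) := by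
  rw [lintegral_exp_mul_inv_mul hs, ofReal_integral_eq_lintegral_ofReal
    ((integrableOn_exp_neg_mul_rpow hγ).mono_set (Ioi_subset_Ioi hlam))
    (ae_of_all _ fun _ => (Real.exp_pos _).le)]
  exact setLIntegral_congr_fun measurableSet_Ioi fun μ (hμ : lam < μ) =>
    lintegral_exp_mul_density hs0 hlap (hlam.trans hμ.le)

lemma lintegral_exp_mul_average_density (hγ : 1 < γ) (hs : Continuous s) (hs0 : ∀ x, 0 ≤ s x)
    (hlap : ∀ lam : ℝ, 0 ≤ lam → (∫ x in Ioi (0 : ℝ), Real.exp (-(lam * x)) * s x)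
      = Real.exp (-(γ * lam ^ ((γ - 1) / γ)))) {lam : ℝ} (hlam : 0 ≤ lam) :
    ∫⁻ x in Ioi (0 : ℝ), ENNReal.ofReal (Real.exp (-(lam * x))
        * (x ^ (-1 - 1 / γ) * ∫ y in Ioc 0 x, y ^ (1 / γ - 1) * s y))
      = ENNReal.ofReal (∫ t in Ioi (1 : ℝ), t ^ (-1 - 1 / γ)
        * ∫ μ in Ioi (lam * t), Real.exp (-(γ * μ ^ ((γ - 1) / γ)))) := by
  have ha : 0 < 1 / γ := by positivity
  have hL : ∫⁻ x in Ioi (0 : ℝ), ENNReal.ofReal (Real.exp (-(lam * x))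
        * (x ^ (-1 - 1 / γ) * ∫ y in Ioc 0 x, y ^ (1 / γ - 1) * s y))
      = ∫⁻ x in Ioi (0 : ℝ), ENNReal.ofReal (Real.exp (-(lam * x)) * x ^ (-1 - 1 / γ))
        * ∫⁻ y in Ioc 0 x, ENNReal.ofReal (y ^ (1 / γ - 1) * s y) := by
    refine setLIntegral_congr_fun measurableSet_Ioi fun x (hx : 0 < x) => ?_
    rw [← ofReal_integral_eq_lintegral_ofReal (integrableOn_rpow_mul_continuous hs ha hx.le)
      ((ae_restrict_mem measurableSet_Ioc).mono fun y hy =>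
        mul_nonneg (Real.rpow_nonneg hy.1.le _) (hs0 y)),
      ← ENNReal.ofReal_mul (by positivity), mul_assoc]
  rw [hL, lintegral_exp_mul_rpow_mul_lintegral hs ha hlam, ofReal_integral_eq_lintegral_ofReal
    (integral_rpow_mul_tail_integral hγ hlam).1
    ((ae_restrict_mem measurableSet_Ioi).mono fun t (ht : 1 < t) =>
      mul_nonneg (Real.rpow_nonneg (one_pos.trans ht).le _) (tail_integral_nonneg _))]
  refine setLIntegral_congr_fun measurableSet_Ioi fun t (ht : 1 < t) => ?_
  have ht0 : 0 < t := one_pos.trans ht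
  rw [lintegral_exp_mul_inv_mul_density hγ hs hs0 hlap (mul_nonneg hlam ht0.le),
    ENNReal.ofReal_mul (by positivity)]

end LaplaceStable

/-- Fix `γ ∈ (1,2]` and let `s_γ` be the continuous density of the
spectrally positive stable law of index `(γ−1)/γ`.  Define
`h⁺(x) := (γ−1) x⁻¹ s_γ(x)` and `h⁻(x) := ((γ−1)/γ) x^{−1−1/γ} ∫_0^x y^{1/γ−1} s_γ(y) dy`.
Then `h⁺, h⁻` are well-defined, continuous, nonnegative, integrable on `(0,∞)`, and their
Laplace transforms are as stated. -/
theorem stmt5 (γ : ℝ) (hγ1 : 1 < γ) (hγ2 : γ ≤ 2)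
    (s : ℝ → ℝ) (hs_cont : ContinuousOn s (Set.Ici 0))
    (hs_nonneg : ∀ x ∈ Set.Ici (0:ℝ), 0 ≤ s x)
    (hs_lap : ∀ lam : ℝ, 0 ≤ lam →
      (∫ x in Set.Ioi (0:ℝ), Real.exp (-(lam * x)) * s x)
        = Real.exp (-(γ * lam ^ ((γ - 1) / γ))))
    (hp hm : ℝ → ℝ)
    (hhp : ∀ x ∈ Set.Ioi (0:ℝ), hp x = (γ - 1) * x⁻¹ * s x)
    (hhm : ∀ x ∈ Set.Ioi (0:ℝ),
      hm x = ((γ - 1) / γ) * x ^ (-1 - 1/γ) * ∫ y in Set.Ioc (0:ℝ) x, y ^ (1/γ - 1) * s y) :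
    (∀ x ∈ Set.Ioi (0:ℝ),
      IntegrableOn (fun y => y ^ (1/γ - 1) * s y) (Set.Ioc 0 x)) ∧
    ContinuousOn hp (Set.Ioi 0) ∧ ContinuousOn hm (Set.Ioi 0) ∧
    (∀ x ∈ Set.Ioi (0:ℝ), 0 ≤ hp x) ∧ (∀ x ∈ Set.Ioi (0:ℝ), 0 ≤ hm x) ∧
    IntegrableOn hp (Set.Ioi 0) ∧ IntegrableOn hm (Set.Ioi 0) ∧
    (∀ lam : ℝ, 0 ≤ lam →
      (∫ x in Set.Ioi (0:ℝ), Real.exp (-(lam * x)) * hp x)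
        = (γ - 1) * ∫ μ in Set.Ioi lam, Real.exp (-(γ * μ ^ ((γ - 1) / γ)))) ∧
    (∀ lam : ℝ, 0 ≤ lam →
      (∫ x in Set.Ioi (0:ℝ), Real.exp (-(lam * x)) * hm x)
        = (γ - 1) * (∫ μ in Set.Ioi lam, Real.exp (-(γ * μ ^ ((γ - 1) / γ))))
          - lam ^ (1/γ) * Real.exp (-(γ * lam ^ ((γ - 1) / γ)))) := by
  obtain ⟨r, hr, hr0, hrs⟩ : ∃ r : ℝ → ℝ, Continuous r ∧ (∀ x, 0 ≤ r x) ∧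
      ∀ x ∈ Ioi (0 : ℝ), s x = r x := by
    refine ⟨fun x => s (max x 0), ?_, fun x => hs_nonneg _ (le_max_right x 0), fun x hx => ?_⟩
    · exact hs_cont.comp_continuous (by fun_prop) fun x => le_max_right x 0
    · simp only [max_eq_left (mem_Ioi.1 hx).le]
  have hlap : ∀ lam : ℝ, 0 ≤ lam → (∫ x in Ioi (0 : ℝ), Real.exp (-(lam * x)) * r x)
      = Real.exp (-(γ * lam ^ ((γ - 1) / γ))) := fun lam hlam => by
    rw [← hs_lap lam hlam]
    exact setIntegral_congr_fun measurableSet_Ioi fun x hx => by simp only [hrs x hx]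
  have hγ0 : 0 < γ := by linarith
  have hγ1' : 0 < γ - 1 := by linarith
  have ha : 0 < 1 / γ := by positivity
  have hsr : ∀ x : ℝ, EqOn (fun y => y ^ (1 / γ - 1) * s y) (fun y => y ^ (1 / γ - 1) * r y)
      (Ioc 0 x) := fun x y hy => by simp only [hrs y hy.1]
  have hP : EqOn hp (fun x => (γ - 1) * (x⁻¹ * r x)) (Ioi 0) := fun x hx => by
    rw [hhp x hx, hrs x hx, mul_assoc]
  have hM : EqOn hm (fun x => (γ - 1) / γ
      * (x ^ (-1 - 1 / γ) * ∫ y in Ioc 0 x, y ^ (1 / γ - 1) * r y)) (Ioi 0) := fun x hx => by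
    rw [hhm x hx, setIntegral_congr_fun measurableSet_Ioc (hsr x), mul_assoc]
  have hint : ∀ x ∈ Ioi (0 : ℝ), IntegrableOn (fun y => y ^ (1 / γ - 1) * r y) (Ioc 0 x) :=
    fun x hx => integrableOn_rpow_mul_continuous hr ha (le_of_lt hx)
  have hPc : ContinuousOn hp (Ioi 0) := by
    refine ContinuousOn.congr ?_ hP
    exact continuousOn_const.mul
      ((continuousOn_inv₀.mono fun x hx => ne_of_gt hx).mul hr.continuousOn)
  have hMc : ContinuousOn hm (Ioi 0) := by
    refine ContinuousOn.congr (continuousOn_const.mul (ContinuousOn.mul ?_ ?_)) hM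
    · exact continuousOn_id.rpow_const fun x hx => Or.inl (ne_of_gt hx)
    · intro x (hx : 0 < x)
      have h := intervalIntegral.continuousOn_primitive
        ((integrableOn_Icc_iff_integrableOn_Ioc).2 (hint (x + 1) (mem_Ioi.2 (by linarith))))
      exact (h.continuousAt (Icc_mem_nhds hx (by linarith))).continuousWithinAt
  have hPnn : ∀ x ∈ Ioi (0 : ℝ), 0 ≤ hp x := fun x (hx : 0 < x) => by
    have := hr0 x
    rw [hP hx]
    positivity
  have hMnn : ∀ x ∈ Ioi (0 : ℝ), 0 ≤ hm x := fun x (hx : 0 < x) => by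
    have : 0 ≤ ∫ y in Ioc 0 x, y ^ (1 / γ - 1) * r y :=
      setIntegral_nonneg measurableSet_Ioc fun y hy =>
        mul_nonneg (Real.rpow_nonneg hy.1.le _) (hr0 y)
    rw [hM hx]
    positivity
  have hexp : ∀ lam : ℝ, ContinuousOn (fun x : ℝ => Real.exp (-(lam * x))) (Ioi 0) :=
    fun lam => by fun_prop
  have keyP : ∀ lam : ℝ, 0 ≤ lam →
      IntegrableOn (fun x => Real.exp (-(lam * x)) * hp x) (Ioi 0) ∧
      (∫ x in Ioi (0 : ℝ), Real.exp (-(lam * x)) * hp x)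
        = (γ - 1) * ∫ μ in Ioi lam, Real.exp (-(γ * μ ^ ((γ - 1) / γ))) := by
    intro lam hlam
    refine integrableOn_and_integral_eq_of_lintegral measurableSet_Ioi
      (mul_nonneg hγ1'.le (tail_integral_nonneg _))
      (((hexp lam).mul hPc).aestronglyMeasurable measurableSet_Ioi)
      (fun x hx => mul_nonneg (Real.exp_pos _).le (hPnn x hx)) ?_
    rw [ENNReal.ofReal_mul hγ1'.le, ← lintegral_exp_mul_inv_mul_density hγ1 hr hr0 hlap hlam,
      ← lintegral_const_mul _ (by fun_prop)]
    refine setLIntegral_congr_fun measurableSet_Ioi fun x hx => ?_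
    simp only [hP hx]
    rw [← ENNReal.ofReal_mul hγ1'.le]
    ring_nf
  have keyM : ∀ lam : ℝ, 0 ≤ lam →
      IntegrableOn (fun x => Real.exp (-(lam * x)) * hm x) (Ioi 0) ∧
      (∫ x in Ioi (0 : ℝ), Real.exp (-(lam * x)) * hm x)
        = (γ - 1) / γ * ∫ t in Ioi (1 : ℝ), t ^ (-1 - 1 / γ)
          * ∫ μ in Ioi (lam * t), Real.exp (-(γ * μ ^ ((γ - 1) / γ))) := by
    intro lam hlam
    have hc : 0 ≤ (γ - 1) / γ := by positivity
    refine integrableOn_and_integral_eq_of_lintegral measurableSet_Ioi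
      (mul_nonneg hc (setIntegral_nonneg measurableSet_Ioi fun t (ht : 1 < t) =>
        mul_nonneg (Real.rpow_nonneg (one_pos.trans ht).le _) (tail_integral_nonneg _)))
      (((hexp lam).mul hMc).aestronglyMeasurable measurableSet_Ioi)
      (fun x hx => mul_nonneg (Real.exp_pos _).le (hMnn x hx)) ?_
    rw [ENNReal.ofReal_mul hc, ← lintegral_exp_mul_average_density hγ1 hr hr0 hlap hlam,
      ← lintegral_const_mul' _ _ ENNReal.ofReal_ne_top]
    refine setLIntegral_congr_fun measurableSet_Ioi fun x hx => ?_
    simp only [hM hx]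
    rw [← ENNReal.ofReal_mul hc]
    ring_nf
  refine ⟨fun x hx => (hint x hx).congr_fun (hsr x).symm measurableSet_Ioc, hPc, hMc, hPnn, hMnn,
    by simpa using (keyP 0 le_rfl).1, by simpa using (keyM 0 le_rfl).1,
    fun lam hlam => (keyP lam hlam).2, fun lam hlam => ?_⟩
  rw [(keyM lam hlam).2, (integral_rpow_mul_tail_integral hγ1 hlam).2]
  field_simp
end

section
/- Assume that for every x > 0, s_γ(x) = ((γ−1)/π) x^{−γ} ∫_0^π m_γ(v) exp(−x^{−(γ−1)} m_γ(v)) dv. Define σ⁺(x) := ((γ−1)²/π) x^{−2γ} ∫_0^π m_γ(v)² exp(−x^{−(γ−1)} m_γ(v)) dv and σ⁻(x) := γ x^{−1} s_γ(x) for x > 0. Then s_γ is differentiable on (0,∞) with s_γ' = σ⁺ − σ⁻; σ⁺ and σ⁻ are continuous, nonnegative and Lebesgue integrable on (0,∞); ∫_0^∞ |s_γ'(x)| dx < ∞; and for every λ ≥ 0: ∫_0^∞ e^{−λx} σ⁺(x) dx = λ exp(−γλ^{(γ−1)/γ}) + γ ∫_λ^∞ exp(−γμ^{(γ−1)/γ})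 dμ, ∫_0^∞ e^{−λx} σ⁻(x) dx = γ ∫_λ^∞ exp(−γμ^{(γ−1)/γ}) dμ, and ∫_0^∞ e^{−λx} s_γ'(x) dx = λ exp(−γλ^{(γ−1)/γ}). -/
open MeasureTheory

section Auxiliary

open Set Filter Topology

theorem pow_mul_exp_neg_mul_le {c x : ℝ} (hc : 0 < c) (hx : 0 ≤ x) (n : ℕ) :
    x ^ n * Real.exp (-(c * x)) ≤ n.factorial / c ^ n := by
  have h := Real.pow_div_factorial_le_exp (c * x) (by positivity) n
  rw [div_le_iff₀ (by positivity), mul_pow] at h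
  rw [Real.exp_neg, ← div_eq_mul_inv, div_le_div_iff₀ (Real.exp_pos _) (by positivity)]
  linarith

section Moments

variable {α : Type*} [MeasurableSpace α] {μ : Measure α} {f : α → ℝ}

theorem aestronglyMeasurable_pow_mul_exp_neg_mul (hf : AEStronglyMeasurable f μ) (n : ℕ) (c : ℝ) :
    AEStronglyMeasurable (fun a => f a ^ n * Real.exp (-(c * f a))) μ :=
  (hf.pow n).mul (Real.continuous_exp.comp_aestronglyMeasurable (hf.const_mul c).neg)

theorem integrable_pow_mul_exp_neg_mul [IsFiniteMeasure μ] (hf : AEStronglyMeasurable f μ)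
    (h0 : ∀ᵐ a ∂μ, 0 ≤ f a) (n : ℕ) {c : ℝ} (hc : 0 < c) :
    Integrable (fun a => f a ^ n * Real.exp (-(c * f a))) μ := by
  refine Integrable.mono' (integrable_const (n.factorial / c ^ n : ℝ))
    (aestronglyMeasurable_pow_mul_exp_neg_mul hf n c) ?_
  filter_upwards [h0] with a ha
  rw [Real.norm_of_nonneg (by positivity)]
  exact pow_mul_exp_neg_mul_le hc ha n

theorem hasDerivAt_integral_pow_mul_exp_neg_mul [IsFiniteMeasure μ]
    (hf : AEStronglyMeasurable f μ) (h0 : ∀ᵐ a ∂μ, 0 ≤ f a) (n : ℕ) {c : ℝ} (hc : 0 < c) :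
    HasDerivAt (fun c => ∫ a, f a ^ n * Real.exp (-(c * f a)) ∂μ)
      (-∫ a, f a ^ (n + 1) * Real.exp (-(c * f a)) ∂μ) c := by
  rw [← integral_neg]
  refine (hasDerivAt_integral_of_dominated_loc_of_deriv_le
    (F' := fun c a => -(f a ^ (n + 1) * Real.exp (-(c * f a))))
    (bound := fun _ => ((n + 1).factorial / (c / 2) ^ (n + 1) : ℝ))
    (Ioi_mem_nhds (half_lt_self hc))
    (Eventually.of_forall fun c => aestronglyMeasurable_pow_mul_exp_neg_mul hf n c)
    (integrable_pow_mul_exp_neg_mul hf h0 n hc)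
    (aestronglyMeasurable_pow_mul_exp_neg_mul hf (n + 1) c).neg ?_ (integrable_const _) ?_).2
  · filter_upwards [h0] with a ha x hx
    rw [norm_neg, Real.norm_of_nonneg (by positivity)]
    refine le_trans ?_ (pow_mul_exp_neg_mul_le (half_pos hc) ha (n + 1))
    have hx' : c / 2 ≤ x := le_of_lt hx
    gcongr
  · refine Eventually.of_forall fun a x _ => ?_
    have h : HasDerivAt (fun x : ℝ => -(x * f a)) (-(1 * f a)) x :=
      ((hasDerivAt_id x).mul_const (f a)).neg
    exact (h.exp.const_mul (f a ^ n)).congr_deriv (by ring)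

end Moments

section Laplace

variable {s : ℝ → ℝ}

theorem integrable_exp_neg_mul_prod (hs : AEStronglyMeasurable s (volume.restrict (Ioi 0)))
    (hs0 : ∀ x ∈ Ioi (0 : ℝ), 0 ≤ s x) {a : ℝ}
    (hint : ∀ t ∈ Ioi a, IntegrableOn (fun x => Real.exp (-(t * x)) * s x) (Ioi 0))
    (hL : IntegrableOn (fun t => ∫ x in Ioi (0 : ℝ), Real.exp (-(t * x)) * s x) (Ioi a)) :
    Integrable (Function.uncurry fun x t => Real.exp (-(t * x)) * s x)
      ((volume.restrict (Ioi (0 : ℝ))).prod (volume.restrict (Ioi a))) := by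
  have hmeas : AEStronglyMeasurable (Function.uncurry fun x t => Real.exp (-(t * x)) * s x)
      ((volume.restrict (Ioi (0 : ℝ))).prod (volume.restrict (Ioi a))) := by
    refine AEStronglyMeasurable.mul (f := fun p : ℝ × ℝ => Real.exp (-(p.2 * p.1)))
      (Continuous.aestronglyMeasurable (by fun_prop)) hs.comp_fst
  refine (integrable_prod_iff' hmeas).2
    ⟨(ae_restrict_iff' measurableSet_Ioi).2 (Eventually.of_forall hint), ?_⟩
  refine hL.congr (Eventually.of_forall fun t => ?_)
  refine setIntegral_congr_fun measurableSet_Ioi fun x hx => ?_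
  have := hs0 x hx
  exact (Real.norm_of_nonneg (by positivity)).symm

theorem integral_Ioi_exp_neg_mul {a x : ℝ} (hx : 0 < x) (r : ℝ) :
    ∫ t in Ioi a, Real.exp (-(t * x)) * r = Real.exp (-(a * x)) * (x⁻¹ * r) := by
  have h := integral_exp_mul_Ioi (neg_lt_zero.2 hx) a
  rw [integral_mul_const]
  have h' : (fun t => Real.exp (-(t * x))) = fun t => Real.exp (-x * t) := by
    ext t; congr 1; ring
  rw [h', h, show -x * a = -(a * x) by ring]
  field_simp

theorem integrableOn_and_integral_exp_neg_mul_inv_mul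
    (hs : AEStronglyMeasurable s (volume.restrict (Ioi 0)))
    (hs0 : ∀ x ∈ Ioi (0 : ℝ), 0 ≤ s x) {a : ℝ}
    (hint : ∀ t ∈ Ioi a, IntegrableOn (fun x => Real.exp (-(t * x)) * s x) (Ioi 0))
    (hL : IntegrableOn (fun t => ∫ x in Ioi (0 : ℝ), Real.exp (-(t * x)) * s x) (Ioi a)) :
    IntegrableOn (fun x => Real.exp (-(a * x)) * (x⁻¹ * s x)) (Ioi 0) ∧
      ∫ x in Ioi (0 : ℝ), Real.exp (-(a * x)) * (x⁻¹ * s x)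
        = ∫ t in Ioi a, ∫ x in Ioi (0 : ℝ), Real.exp (-(t * x)) * s x := by
  have h := integrable_exp_neg_mul_prod hs hs0 hint hL
  refine ⟨?_, ?_⟩
  · refine IntegrableOn.congr_fun h.integral_prod_left (fun x hx => ?_) measurableSet_Ioi
    exact integral_Ioi_exp_neg_mul hx (s x)
  · rw [← integral_integral_swap h]
    exact setIntegral_congr_fun measurableSet_Ioi fun x hx =>
      (integral_Ioi_exp_neg_mul hx (s x)).symm

theorem eq_zero_of_integrableOn_inv_mul (hs : ContinuousWithinAt s (Ici 0) 0)
    (h : IntegrableOn (fun x => x⁻¹ * s x) (Ioi 0)) : s 0 = 0 := by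
  by_contra hne
  have hpos : 0 < |s 0| / 2 := half_pos (abs_pos.2 hne)
  have hev : ∀ᶠ x in 𝓝[≥] (0 : ℝ), |s 0| / 2 < |s x| :=
    hs.abs.eventually (lt_mem_nhds (half_lt_self (abs_pos.2 hne)))
  obtain ⟨η, hη, hsub⟩ := (mem_nhdsGE_iff_exists_Icc_subset).1 hev
  have hη_pos : (0 : ℝ) < η := hη
  have hint : IntegrableOn (fun x : ℝ => x⁻¹) (Ioc 0 η) := by
    refine Integrable.mono' (((h.mono_set Ioc_subset_Ioi_self).norm).const_mul (|s 0| / 2)⁻¹)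
      (by fun_prop) ?_
    refine (ae_restrict_iff' measurableSet_Ioc).2 (Eventually.of_forall fun x hx => ?_)
    have hx' : |s 0| / 2 < |s x| := hsub ⟨hx.1.le, hx.2⟩
    rw [norm_mul, Real.norm_eq_abs (s x), inv_mul_eq_div, le_div_iff₀ hpos]
    gcongr
  have := (intervalIntegrable_iff_integrableOn_Ioc_of_le hη_pos.le).2 hint
  rw [intervalIntegrable_inv_iff] at this
  rcases this with h | h
  · exact hη_pos.ne h
  · exact h (by simp [hη_pos.le])

/-- A nonnegative `p` with `s' = p - q` on `(0, ∞)` is integrable as soon as `q` is and `s` tends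
to a limit at infinity. -/
theorem integrableOn_of_hasDerivAt_sub {p q : ℝ → ℝ} {l : ℝ}
    (hs : ContinuousWithinAt s (Ici 0) 0)
    (hd : ∀ x ∈ Ioi (0 : ℝ), HasDerivAt s (p x - q x) x) (hp : ∀ x ∈ Ioi (0 : ℝ), 0 ≤ p x)
    (hqc : ContinuousOn q (Ioi 0)) (hq : IntegrableOn q (Ioi 0)) (hl : Tendsto s atTop (𝓝 l)) :
    IntegrableOn p (Ioi 0) := by
  have hqi : ∀ x : ℝ, 0 ≤ x → IntervalIntegrable q volume 0 x := fun x hx =>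
    (intervalIntegrable_iff_integrableOn_Ioc_of_le hx).2 (hq.mono_set Ioc_subset_Ioi_self)
  refine integrableOn_Ioi_deriv_of_nonneg (g := fun x => s x + ∫ t in (0 : ℝ)..x, q t)
    (hs.add ?_) (fun x hx => ?_) hp (hl.add (intervalIntegral_tendsto_integral_Ioi 0 hq tendsto_id))
  · have h := intervalIntegral.continuousOn_primitive_interval' (hqi 1 zero_le_one) left_mem_uIcc
    rw [uIcc_of_le zero_le_one] at h
    exact (h 0 (by simp)).mono_of_mem_nhdsWithin (Icc_mem_nhdsGE zero_lt_one)
  · have h := intervalIntegral.integral_hasDerivAt_right (hqi x (le_of_lt hx))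
      (hqc.stronglyMeasurableAtFilter isOpen_Ioi x hx) (hqc.continuousAt (Ioi_mem_nhds hx))
    exact ((hd x hx).add h).congr_deriv (by ring)

theorem integrableOn_exp_neg_mul_mul_s6 {f : ℝ → ℝ} (hf : IntegrableOn f (Ioi 0)) {a : ℝ} (ha : 0 ≤ a) :
    IntegrableOn (fun x => Real.exp (-(a * x)) * f x) (Ioi 0) := by
  refine Integrable.mono' hf.norm ((by fun_prop : AEStronglyMeasurable _ _).mul hf.1) ?_
  refine (ae_restrict_iff' measurableSet_Ioi).2 (Eventually.of_forall fun x hx => ?_)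
  have hx' : (0 : ℝ) < x := hx
  rw [norm_mul, Real.norm_of_nonneg (Real.exp_pos _).le]
  exact mul_le_of_le_one_left (norm_nonneg _) (Real.exp_le_one_iff.2 (by simpa using by positivity))

theorem integral_exp_neg_mul_mul_deriv {s' : ℝ → ℝ} (hs : ContinuousWithinAt s (Ici 0) 0)
    (hs0 : s 0 = 0) (hd : ∀ x ∈ Ioi (0 : ℝ), HasDerivAt s (s' x) x)
    (hi : IntegrableOn s (Ioi 0)) (hi' : IntegrableOn s' (Ioi 0))
    (hl : Tendsto s atTop (𝓝 0)) {a : ℝ} (ha : 0 ≤ a) :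
    ∫ x in Ioi (0 : ℝ), Real.exp (-(a * x)) * s' x
      = a * ∫ x in Ioi (0 : ℝ), Real.exp (-(a * x)) * s x := by
  have h1 := integrableOn_exp_neg_mul_mul_s6 hi ha
  have h2 := integrableOn_exp_neg_mul_mul_s6 hi' ha
  have key := integral_Ioi_of_hasDerivAt_of_tendsto (f := fun x => Real.exp (-(a * x)) * s x)
    (f' := fun x => Real.exp (-(a * x)) * s' x - a * (Real.exp (-(a * x)) * s x))
    (a := 0) (m := 0)
    (ContinuousWithinAt.mul (f := fun x => Real.exp (-(a * x)))
      (Continuous.continuousWithinAt (by fun_prop)) hs)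
    (fun x hx => ?_) (h2.sub (h1.const_mul a)) ?_
  · rw [integral_sub h2 (h1.const_mul a), integral_const_mul, hs0, mul_zero, sub_zero,
      sub_eq_zero] at key
    exact key
  · have he : HasDerivAt (fun x : ℝ => -(a * x)) (-(a * 1)) x :=
      ((hasDerivAt_id x).const_mul a).neg
    exact (he.exp.mul (hd x hx)).congr_deriv (by ring)
  · refine squeeze_zero_norm' (a := fun x => ‖s x‖) ?_ (by simpa using hl.norm)
    filter_upwards [eventually_ge_atTop 0] with x hx
    rw [norm_mul, Real.norm_of_nonneg (Real.exp_pos _).le]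
    exact mul_le_of_le_one_left (norm_nonneg _)
      (Real.exp_le_one_iff.2 (by simpa using by positivity))

end Laplace

theorem hasDerivAt_rpow_neg_mul_comp_rpow_neg {F : ℝ → ℝ} {d γ p x : ℝ} (hx : 0 < x)
    (hF : HasDerivAt F (-d) (x ^ (-(γ - 1)))) :
    HasDerivAt (fun x => x ^ (-p) * F (x ^ (-(γ - 1))))
      ((γ - 1) * x ^ (-(p + γ)) * d - p * x⁻¹ * (x ^ (-p) * F (x ^ (-(γ - 1))))) x := by
  have h1 : ∀ q : ℝ, HasDerivAt (fun x : ℝ => x ^ (-q)) (-q * x ^ (-q - 1)) x := fun q =>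
    Real.hasDerivAt_rpow_const (Or.inl hx.ne')
  refine ((h1 p).mul (hF.comp x (h1 (γ - 1)))).congr_deriv ?_
  rw [show -(γ - 1) - 1 = -γ by ring, neg_add, Real.rpow_add hx, Real.rpow_sub_one hx.ne']
  simp only [Function.comp_apply]
  ring

/-- Zolotarev's function is continuous and positive on `(0, π)`. -/
theorem continuousOn_and_pos_zolotarev {γ : ℝ} (hγ : 1 < γ) {m : ℝ → ℝ}
    (hm : ∀ v ∈ Ioo (0 : ℝ) Real.pi,
      m v = (γ * Real.sin (((γ - 1) / γ) * v) / Real.sin v) ^ (γ - 1)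
        * (γ * Real.sin (v / γ) / Real.sin v)) :
    ContinuousOn m (Ioo 0 Real.pi) ∧ ∀ v ∈ Ioo (0 : ℝ) Real.pi, 0 < m v := by
  have hγ0 : 0 < γ := by linarith
  have hγ1 : 0 < γ - 1 := by linarith
  have hsin : ∀ v ∈ Ioo (0 : ℝ) Real.pi, 0 < Real.sin v := fun v hv =>
    Real.sin_pos_of_mem_Ioo hv
  have h1 : ∀ v ∈ Ioo (0 : ℝ) Real.pi, 0 < Real.sin (((γ - 1) / γ) * v) := fun v hv => by
    refine Real.sin_pos_of_mem_Ioo ⟨mul_pos (by positivity) hv.1, lt_of_le_of_lt ?_ hv.2⟩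
    exact mul_le_of_le_one_left hv.1.le ((div_le_one hγ0).2 (by linarith))
  have h2 : ∀ v ∈ Ioo (0 : ℝ) Real.pi, 0 < Real.sin (v / γ) := fun v hv =>
    Real.sin_pos_of_mem_Ioo ⟨div_pos hv.1 hγ0, lt_of_le_of_lt (div_le_self hv.1.le hγ.le) hv.2⟩
  refine ⟨ContinuousOn.congr ?_ hm, fun v hv => ?_⟩
  · have hne : ∀ v ∈ Ioo (0 : ℝ) Real.pi, Real.sin v ≠ 0 := fun v hv => (hsin v hv).ne'
    refine ContinuousOn.mul (ContinuousOn.rpow_const (ContinuousOn.div (by fun_prop)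
      (by fun_prop) hne) fun v _ => Or.inr hγ1.le) (ContinuousOn.div (by fun_prop) (by fun_prop) hne)
  · have := hsin v hv
    have := h1 v hv
    have := h2 v hv
    rw [hm v hv]
    positivity

end Auxiliary

/-- Fix `γ ∈ (1,2]`, let `s_γ` be the continuous density of the
spectrally positive stable law of index `(γ−1)/γ` and assume the integral representation
`s_γ(x) = ((γ−1)/π) x^{−γ} ∫_0^π m_γ(v) exp(−x^{−(γ−1)} m_γ(v)) dv`.  With `σ⁺, σ⁻` as
defined, `s_γ` is differentiable with `s_γ' = σ⁺ − σ⁻`, the functions `σ⁺, σ⁻` are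
continuous, nonnegative and integrable, `∫ |s_γ'| < ∞`, and the Laplace transforms of
`σ⁺`, `σ⁻` and `s_γ'` are as stated. -/
theorem stmt6 (γ : ℝ) (hγ1 : 1 < γ) (hγ2 : γ ≤ 2)
    (s : ℝ → ℝ) (hs_cont : ContinuousOn s (Set.Ici 0))
    (hs_nonneg : ∀ x ∈ Set.Ici (0:ℝ), 0 ≤ s x)
    (hs_lap : ∀ lam : ℝ, 0 ≤ lam →
      (∫ x in Set.Ioi (0:ℝ), Real.exp (-(lam * x)) * s x)
        = Real.exp (-(γ * lam ^ ((γ - 1) / γ))))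
    (m : ℝ → ℝ)
    (hm0 : m 0 = (γ - 1) ^ (γ - 1))
    (hm : ∀ v ∈ Set.Ioo (0:ℝ) Real.pi,
      m v = (γ * Real.sin (((γ - 1) / γ) * v) / Real.sin v) ^ (γ - 1)
        * (γ * Real.sin (v / γ) / Real.sin v))
    (hrep : ∀ x ∈ Set.Ioi (0:ℝ),
      s x = ((γ - 1) / Real.pi) * x ^ (-γ)
        * ∫ v in (0:ℝ)..Real.pi, m v * Real.exp (-(x ^ (-(γ - 1)) * m v)))
    (σp σm : ℝ → ℝ)
    (hσp : ∀ x ∈ Set.Ioi (0:ℝ),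
      σp x = ((γ - 1) ^ 2 / Real.pi) * x ^ (-(2 * γ))
        * ∫ v in (0:ℝ)..Real.pi, (m v) ^ 2 * Real.exp (-(x ^ (-(γ - 1)) * m v)))
    (hσm : ∀ x ∈ Set.Ioi (0:ℝ), σm x = γ * x⁻¹ * s x) :
    (∀ x ∈ Set.Ioi (0:ℝ), HasDerivAt s (σp x - σm x) x) ∧
    ContinuousOn σp (Set.Ioi 0) ∧ ContinuousOn σm (Set.Ioi 0) ∧
    (∀ x ∈ Set.Ioi (0:ℝ), 0 ≤ σp x) ∧ (∀ x ∈ Set.Ioi (0:ℝ), 0 ≤ σm x) ∧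
    IntegrableOn σp (Set.Ioi 0) ∧ IntegrableOn σm (Set.Ioi 0) ∧
    IntegrableOn (deriv s) (Set.Ioi 0) ∧
    (∀ lam : ℝ, 0 ≤ lam →
      (∫ x in Set.Ioi (0:ℝ), Real.exp (-(lam * x)) * σp x)
        = lam * Real.exp (-(γ * lam ^ ((γ - 1) / γ)))
          + γ * ∫ μ in Set.Ioi lam, Real.exp (-(γ * μ ^ ((γ - 1) / γ)))) ∧
    (∀ lam : ℝ, 0 ≤ lam →
      (∫ x in Set.Ioi (0:ℝ), Real.exp (-(lam * x)) * σm x)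
        = γ * ∫ μ in Set.Ioi lam, Real.exp (-(γ * μ ^ ((γ - 1) / γ)))) ∧
    (∀ lam : ℝ, 0 ≤ lam →
      (∫ x in Set.Ioi (0:ℝ), Real.exp (-(lam * x)) * deriv s x)
        = lam * Real.exp (-(γ * lam ^ ((γ - 1) / γ)))) := by
  have hγ0 : 0 < γ := by linarith
  have hγ' : 0 < γ - 1 := by linarith
  have hpi := Real.pi_pos
  have hexp : 0 < (γ - 1) / γ := by positivity
  obtain ⟨hmc, hmpos⟩ := continuousOn_and_pos_zolotarev hγ1 hm
  have hmeas : AEStronglyMeasurable m (volume.restrict (Set.Ioo 0 Real.pi)) :=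
    hmc.aestronglyMeasurable measurableSet_Ioo
  have hm_nonneg : ∀ᵐ v ∂(volume.restrict (Set.Ioo 0 Real.pi)), 0 ≤ m v :=
    (ae_restrict_iff' measurableSet_Ioo).2 (Filter.Eventually.of_forall fun v hv => (hmpos v hv).le)
  set J : ℕ → ℝ → ℝ := fun n c => ∫ v in Set.Ioo 0 Real.pi, m v ^ n * Real.exp (-(c * m v)) with hJ
  have hJ_nonneg : ∀ n c, 0 ≤ J n c := fun n c => integral_nonneg_of_ae <| by
    filter_upwards [hm_nonneg] with v hv
    positivity
  have hJ_deriv : ∀ n c, 0 < c → HasDerivAt (J n) (-J (n + 1) c) c := fun n c hc =>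
    hasDerivAt_integral_pow_mul_exp_neg_mul hmeas hm_nonneg n hc
  have hs_eq : ∀ x ∈ Set.Ioi (0 : ℝ),
      s x = (γ - 1) / Real.pi * (x ^ (-γ) * J 1 (x ^ (-(γ - 1)))) := fun x hx => by
    rw [hrep x hx, intervalIntegral.integral_of_le hpi.le, integral_Ioc_eq_integral_Ioo, hJ]
    simp only [pow_one, mul_assoc]
  have hσp_eq : ∀ x ∈ Set.Ioi (0 : ℝ),
      σp x = (γ - 1) ^ 2 / Real.pi * (x ^ (-(2 * γ)) * J 2 (x ^ (-(γ - 1)))) := fun x hx => by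
    rw [hσp x hx, intervalIntegral.integral_of_le hpi.le, integral_Ioc_eq_integral_Ioo, hJ, mul_assoc]
  have hderiv : ∀ p n, ∀ x ∈ Set.Ioi (0 : ℝ),
      HasDerivAt (fun x => x ^ (-p) * J n (x ^ (-(γ - 1))))
        ((γ - 1) * x ^ (-(p + γ)) * J (n + 1) (x ^ (-(γ - 1)))
          - p * x⁻¹ * (x ^ (-p) * J n (x ^ (-(γ - 1))))) x := fun p n x hx =>
    hasDerivAt_rpow_neg_mul_comp_rpow_neg hx (hJ_deriv n _ (Real.rpow_pos_of_pos hx _))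
  have hsd : ∀ x ∈ Set.Ioi (0 : ℝ), HasDerivAt s (σp x - σm x) x := fun x hx => by
    refine HasDerivAt.congr_of_eventuallyEq ?_
      (Filter.eventuallyEq_of_mem (Ioi_mem_nhds hx) hs_eq)
    refine ((hderiv γ 1 x hx).const_mul ((γ - 1) / Real.pi)).congr_deriv ?_
    rw [hσp_eq x hx, hσm x hx, hs_eq x hx, two_mul]
    ring
  have hσp_cont : ContinuousOn σp (Set.Ioi 0) := by
    refine ContinuousOn.congr (fun x hx => ?_) hσp_eq
    exact ((hderiv (2 * γ) 2 x hx).const_mul _).continuousAt.continuousWithinAt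
  have hs_cont' : ContinuousOn s (Set.Ioi 0) := hs_cont.mono Set.Ioi_subset_Ici_self
  have hs_cont0 : ContinuousWithinAt s (Set.Ici 0) 0 := hs_cont 0 Set.self_mem_Ici
  have hσm_cont : ContinuousOn σm (Set.Ioi 0) :=
    ((continuousOn_const.mul (continuousOn_id.inv₀ fun x hx => ne_of_gt hx)).mul hs_cont').congr hσm
  have hs0 : ∀ x ∈ Set.Ioi (0 : ℝ), 0 ≤ s x := fun x hx => hs_nonneg x (Set.Ioi_subset_Ici_self hx)
  have hσp_nonneg : ∀ x ∈ Set.Ioi (0 : ℝ), 0 ≤ σp x := fun x hx => by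
    have := hJ_nonneg 2 (x ^ (-(γ - 1)))
    have hx' : (0 : ℝ) < x := hx
    rw [hσp_eq x hx]
    positivity
  have hσm_nonneg : ∀ x ∈ Set.Ioi (0 : ℝ), 0 ≤ σm x := fun x hx => by
    have hx' : (0 : ℝ) < x := hx
    have := hs0 x hx
    rw [hσm x hx]
    positivity
  have hs_tendsto : Filter.Tendsto s Filter.atTop (nhds 0) := by
    have hlim : Filter.Tendsto (fun x : ℝ => (γ - 1) * x⁻¹) Filter.atTop (nhds 0) := by
      simpa using tendsto_inv_atTop_zero.const_mul (γ - 1)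
    refine squeeze_zero' ?_ ?_ hlim
    · filter_upwards [Filter.eventually_ge_atTop 0] with x hx using hs_nonneg x hx
    · filter_upwards [Filter.eventually_gt_atTop 0] with x hx
      have hc := Real.rpow_pos_of_pos hx (-(γ - 1))
      have hJ1 : J 1 (x ^ (-(γ - 1))) ≤ Real.pi / x ^ (-(γ - 1)) := by
        have h : J 1 (x ^ (-(γ - 1))) ≤ ∫ _ in Set.Ioo 0 Real.pi, (1 / x ^ (-(γ - 1)) : ℝ) := by
          refine integral_mono_ae (integrable_pow_mul_exp_neg_mul hmeas hm_nonneg 1 hc)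
            (integrable_const _) ?_
          filter_upwards [hm_nonneg] with v hv
          simpa using pow_mul_exp_neg_mul_le hc hv 1
        refine h.trans_eq ?_
        rw [setIntegral_const, Real.volume_real_Ioo_of_le hpi.le, sub_zero, smul_eq_mul]
        ring
      rw [hs_eq x hx]
      calc (γ - 1) / Real.pi * (x ^ (-γ) * J 1 (x ^ (-(γ - 1))))
          ≤ (γ - 1) / Real.pi * (x ^ (-γ) * (Real.pi / x ^ (-(γ - 1)))) := by gcongr
        _ = (γ - 1) * x⁻¹ := by
            rw [show -γ = -(γ - 1) - 1 by ring, Real.rpow_sub_one hx.ne']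
            field_simp
  have hs_int : ∀ t, 0 ≤ t → IntegrableOn (fun x => Real.exp (-(t * x)) * s x) (Set.Ioi 0) :=
    fun t ht => Integrable.of_integral_ne_zero (by rw [hs_lap t ht]; exact (Real.exp_pos _).ne')
  have hs_int0 : IntegrableOn s (Set.Ioi 0) := by simpa using hs_int 0 le_rfl
  have hL_int : ∀ t, 0 ≤ t → IntegrableOn
      (fun u => ∫ x in Set.Ioi (0 : ℝ), Real.exp (-(u * x)) * s x) (Set.Ioi t) := fun t ht => by
    refine IntegrableOn.congr_fun (f := fun u => Real.exp (-(γ * u ^ ((γ - 1) / γ)))) ?_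
      (fun u hu => (hs_lap u (ht.trans (le_of_lt hu))).symm) measurableSet_Ioi
    have h := integrableOn_rpow_mul_exp_neg_mul_rpow (s := 0) (by norm_num) hexp hγ0
    simp only [Real.rpow_zero, one_mul, neg_mul] at h
    exact h.mono_set (Set.Ioi_subset_Ioi ht)
  have hinv : ∀ t, 0 ≤ t →
      IntegrableOn (fun x => Real.exp (-(t * x)) * (x⁻¹ * s x)) (Set.Ioi 0) ∧
        ∫ x in Set.Ioi (0 : ℝ), Real.exp (-(t * x)) * (x⁻¹ * s x)
          = ∫ u in Set.Ioi t, Real.exp (-(γ * u ^ ((γ - 1) / γ))) := fun t ht => by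
    have h := integrableOn_and_integral_exp_neg_mul_inv_mul hs_int0.1 hs0
      (fun u hu => hs_int u (ht.trans (le_of_lt hu))) (hL_int t ht)
    exact ⟨h.1, h.2.trans (setIntegral_congr_fun measurableSet_Ioi fun u hu =>
      hs_lap u (ht.trans (le_of_lt hu)))⟩
  have hinv0 : IntegrableOn (fun x => x⁻¹ * s x) (Set.Ioi 0) := by simpa using (hinv 0 le_rfl).1
  have hs_zero : s 0 = 0 := eq_zero_of_integrableOn_inv_mul hs_cont0 hinv0
  have hσm_int : IntegrableOn σm (Set.Ioi 0) :=
    IntegrableOn.congr_fun (hinv0.const_mul γ)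
      (fun x hx => by rw [hσm x hx, mul_assoc]) measurableSet_Ioi
  have hσp_int : IntegrableOn σp (Set.Ioi 0) :=
    integrableOn_of_hasDerivAt_sub hs_cont0 hsd hσp_nonneg hσm_cont hσm_int hs_tendsto
  have hsd' : Set.EqOn (fun x => σp x - σm x) (deriv s) (Set.Ioi 0) := fun x hx =>
    (hsd x hx).deriv.symm
  have hds_int : IntegrableOn (deriv s) (Set.Ioi 0) :=
    IntegrableOn.congr_fun (hσp_int.sub hσm_int) hsd' measurableSet_Ioi
  have hlap_m : ∀ t : ℝ, 0 ≤ t → ∫ x in Set.Ioi (0 : ℝ), Real.exp (-(t * x)) * σm x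
      = γ * ∫ u in Set.Ioi t, Real.exp (-(γ * u ^ ((γ - 1) / γ))) := fun t ht => by
    rw [← (hinv t ht).2, ← integral_const_mul]
    refine setIntegral_congr_fun measurableSet_Ioi fun x hx => ?_
    simp only [hσm x hx]
    ring
  have hlap_d : ∀ t : ℝ, 0 ≤ t → ∫ x in Set.Ioi (0 : ℝ), Real.exp (-(t * x)) * deriv s x
      = t * Real.exp (-(γ * t ^ ((γ - 1) / γ))) := fun t ht => by
    rw [← hs_lap t ht]
    exact integral_exp_neg_mul_mul_deriv hs_cont0 hs_zero
      (fun x hx => (hsd x hx).differentiableAt.hasDerivAt) hs_int0 hds_int hs_tendsto ht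
  refine ⟨hsd, hσp_cont, hσm_cont, hσp_nonneg, hσm_nonneg, hσp_int, hσm_int, hds_int,
    fun t ht => ?_, hlap_m, hlap_d⟩
  rw [← hlap_d t ht, ← hlap_m t ht, ← integral_add (integrableOn_exp_neg_mul_mul_s6 hds_int ht)
    (integrableOn_exp_neg_mul_mul_s6 hσm_int ht)]
  refine setIntegral_congr_fun measurableSet_Ioi fun x hx => ?_
  simp only [← hsd' hx]
  ring
end

section
/- Let s_γ : (0,∞) → ℝ be C¹ with s_γ(x) = ∫_0^x s_γ'(y) dy for all x > 0. Assume there exist real sequences (S_n*)_{n≥0} and (T_n*)_{n≥0} such that for every integer N ≥ 1, as x → 0+: s_γ(x) = Σ_{0≤n<N} S_n* · x^{n(γ−1) − (γ+1)/2} e^{−b(x)} + O( x^{N(γ−1) − (γ+1)/2} e^{−b(x)} ) and s_γ'(x) = Σ_{0≤n<N} T_n* · x^{n(γ−1) − (3γ+1)/2} e^{−b(x)} + O( x^{N(γ−1) − (3γ+1)/2} e^{−b(x)} ). Then T₀* = (γ−1)^γ S₀* and, for every n ≥ 1, T_n* = (γ−1)^γ S_n* + ( n(γ−1) − (3γ−1)/2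 ) S_{n−1}*. -/
open MeasureTheory Asymptotics Filter Topology

/-- The function `x ^ p * exp (-b x)` with `b x = (c / x) ^ c`. -/
noncomputable def rpowExp (c p x : ℝ) : ℝ := x ^ p * Real.exp (-((c / x) ^ c))

theorem rpowExp_pos (c p : ℝ) {x : ℝ} (hx : 0 < x) : 0 < rpowExp c p x :=
  mul_pos (Real.rpow_pos_of_pos hx p) (Real.exp_pos _)

theorem rpowExp_div (c p q : ℝ) {x : ℝ} (hx : 0 < x) :
    rpowExp c p x / rpowExp c q x = x ^ (p - q) := by
  rw [rpowExp, rpowExp, mul_div_mul_right _ _ (Real.exp_ne_zero _), Real.rpow_sub hx]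

theorem tendsto_rpow_nhdsGT_zero {p : ℝ} (hp : 0 < p) :
    Tendsto (fun x : ℝ => x ^ p) (𝓝[>] 0) (𝓝 0) := by
  have h := (Real.continuousAt_rpow_const 0 p (Or.inr hp.le)).tendsto
  rw [Real.zero_rpow hp.ne'] at h
  exact h.mono_left nhdsWithin_le_nhds

theorem rpowExp_isLittleO (c : ℝ) {p q : ℝ} (h : q < p) :
    rpowExp c p =o[𝓝[>] (0 : ℝ)] rpowExp c q := by
  rw [isLittleO_iff_tendsto']
  · refine (tendsto_rpow_nhdsGT_zero (sub_pos.2 h)).congr' ?_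
    filter_upwards [self_mem_nhdsWithin] with x hx
    exact (rpowExp_div c p q hx).symm
  · filter_upwards [self_mem_nhdsWithin] with x hx h0
    exact absurd h0 (rpowExp_pos c q hx).ne'

theorem tendsto_rpowExp {c : ℝ} (hc : 0 < c) (p : ℝ) :
    Tendsto (rpowExp c p) (𝓝[>] 0) (𝓝 0) := by
  have hinv : Tendsto (fun x : ℝ => (x⁻¹) ^ c) (𝓝[>] 0) atTop :=
    (tendsto_rpow_atTop hc).comp tendsto_inv_nhdsGT_zero
  refine ((tendsto_rpow_mul_exp_neg_mul_atTop_nhds_zero (-p / c) (c ^ c)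
    (Real.rpow_pos_of_pos hc c)).comp hinv).congr' ?_
  filter_upwards [self_mem_nhdsWithin] with x hx
  have hx : 0 < x := hx
  have h1 : ((x⁻¹) ^ c) ^ (-p / c) = x ^ p := by
    rw [← Real.rpow_mul (inv_nonneg.2 hx.le), mul_div_cancel₀ _ hc.ne',
      Real.inv_rpow hx.le, Real.rpow_neg hx.le, inv_inv]
  have h2 : (c / x) ^ c = c ^ c * (x⁻¹) ^ c := by
    rw [div_eq_mul_inv, Real.mul_rpow hc.le (inv_nonneg.2 hx.le)]
  simp only [Function.comp_apply, rpowExp, h1, h2, neg_mul]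

theorem hasDerivAt_rpowExp {c : ℝ} (hc : 0 < c) (p : ℝ) {x : ℝ} (hx : 0 < x) :
    HasDerivAt (rpowExp c p)
      (p * rpowExp c (p - 1) x + c ^ (c + 1) * rpowExp c (p - (c + 1)) x) x := by
  have hb : HasDerivAt (fun y : ℝ => (c / y) ^ c) (c * (-c / x ^ 2) * (c / x) ^ (c - 1)) x := by
    have h := ((hasDerivAt_const x c).div (hasDerivAt_id x) hx.ne').rpow_const
      (p := c) (Or.inl (div_pos hc hx).ne')
    refine h.congr_deriv ?_
    simp only [Pi.div_apply, id_eq]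
    ring
  have h := (Real.hasDerivAt_rpow_const (p := p) (Or.inl hx.ne')).mul hb.neg.exp
  refine HasDerivAt.congr_deriv (f := rpowExp c p) h ?_
  have h1 : c ^ (c + 1) = c ^ c * c := Real.rpow_add_one hc.ne' c
  have h2 : x ^ (p - (c + 1)) = x ^ p / (x ^ c * x) := by
    rw [Real.rpow_sub hx, Real.rpow_add_one hx.ne']
  have h3 : (c / x) ^ (c - 1) = c ^ c / x ^ c * (x / c) := by
    rw [Real.rpow_sub_one (div_pos hc hx).ne', Real.div_rpow hc.le hx.le]
    field_simp
  have h4 : x ^ c ≠ 0 := (Real.rpow_pos_of_pos hx c).ne'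
  simp only [rpowExp, h1, h2, h3, Pi.neg_apply]
  field_simp

/-- If `r = o(x ^ p * exp (-b x))`, the coefficient of the leading-order term of `r'` vanishes. -/
theorem leading_coeff_deriv_eq_zero {c : ℝ} (hc : 0 < c) (p δ : ℝ) {r r' : ℝ → ℝ}
    (hr : ∀ x, 0 < x → HasDerivAt r (r' x) x)
    (hro : r =o[𝓝[>] (0 : ℝ)] rpowExp c p)
    (hr'o : (fun x => r' x - δ * rpowExp c (p - (c + 1)) x)
      =o[𝓝[>] (0 : ℝ)] rpowExp c (p - (c + 1))) : δ = 0 := by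
  have hK : c ^ (c + 1) ≠ 0 := (Real.rpow_pos_of_pos hc _).ne'
  have hpos : ∀ᶠ x : ℝ in 𝓝[>] 0, 0 < x := self_mem_nhdsWithin
  have hnum : Tendsto (fun x => r' x / rpowExp c (p - (c + 1)) x) (𝓝[>] 0) (𝓝 δ) := by
    have h := hr'o.tendsto_div_nhds_zero.add_const δ
    rw [zero_add] at h
    refine h.congr' ?_
    filter_upwards [hpos] with x hx
    have := (rpowExp_pos c (p - (c + 1)) hx).ne'
    field_simp
    ring
  have hden : Tendsto (fun x => (p * rpowExp c (p - 1) x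
      + c ^ (c + 1) * rpowExp c (p - (c + 1)) x) / rpowExp c (p - (c + 1)) x)
      (𝓝[>] 0) (𝓝 (c ^ (c + 1))) := by
    have h := ((rpowExp_isLittleO c
      (show p - (c + 1) < p - 1 by linarith)).tendsto_div_nhds_zero.const_mul p).add_const
        (c ^ (c + 1))
    rw [mul_zero, zero_add] at h
    refine h.congr' ?_
    filter_upwards [hpos] with x hx
    have := (rpowExp_pos c (p - (c + 1)) hx).ne'
    field_simp
  have hne := hden.eventually_ne hK
  have hlim := HasDerivAt.lhopital_zero_nhdsGT (hpos.mono hr)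
    (hpos.mono fun x hx => hasDerivAt_rpowExp hc p hx)
    (hne.mono fun x hx h0 => hx (by rw [h0, zero_div]))
    (hro.trans_tendsto (tendsto_rpowExp hc p)) (tendsto_rpowExp hc p)
    (l := 𝓝 (δ / c ^ (c + 1))) ((hnum.div hden hK).congr' (by
      filter_upwards [hpos] with x hx
      exact div_div_div_cancel_right₀ (rpowExp_pos c (p - (c + 1)) hx).ne' _ _))
  have h0 := tendsto_nhds_unique hlim hro.tendsto_div_nhds_zero
  simpa [hK] using h0

/-- Termwise differentiation of a finite expansion, collected by powers of `x`. -/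
theorem sum_range_deriv_collect (K : ℝ) (S a U φ : ℕ → ℝ) (h0 : U 0 = K * S 0)
    (hU : ∀ n, U (n + 1) = K * S (n + 1) + a n * S n) (n : ℕ) :
    ∑ k ∈ Finset.range (n + 1), S k * (a k * φ (k + 1) + K * φ k)
      = ∑ k ∈ Finset.range (n + 1), U k * φ k + S n * a n * φ (n + 1) := by
  induction n with
  | zero => simp [h0]; ring
  | succ n ih =>
    rw [Finset.sum_range_succ, ih, Finset.sum_range_succ _ (n + 1), hU]
    ring

/-- Fix `γ ∈ (1,2]` and set `b(x) := ((γ−1)/x)^{γ−1}`.  Let `s_γ` be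
`C¹` on `(0,∞)` with `s_γ(x) = ∫_0^x s_γ'(y) dy`, and suppose `s_γ` and `s_γ'` admit the
asymptotic expansions at `0+` with coefficients `(S_n*)` and `(T_n*)` respectively.  Then
`T₀* = (γ−1)^γ S₀*` and `T_n* = (γ−1)^γ S_n* + (n(γ−1) − (3γ−1)/2) S_{n−1}*` for `n ≥ 1`. -/
theorem stmt7 (γ : ℝ) (hγ1 : 1 < γ) (hγ2 : γ ≤ 2)
    (s s' : ℝ → ℝ)
    (hderiv : ∀ x ∈ Set.Ioi (0:ℝ), HasDerivAt s (s' x) x)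
    (hderiv_cont : ContinuousOn s' (Set.Ioi 0))
    (hFTC : ∀ x ∈ Set.Ioi (0:ℝ), s x = ∫ y in Set.Ioc (0:ℝ) x, s' y)
    (S T : ℕ → ℝ)
    (hS : ∀ N : ℕ, 1 ≤ N →
      (fun x => s x - ∑ n ∈ Finset.range N,
          S n * x ^ ((n:ℝ) * (γ - 1) - (γ + 1)/2) * Real.exp (-(((γ - 1)/x) ^ (γ - 1))))
        =O[𝓝[>] (0:ℝ)]
      fun x => x ^ ((N:ℝ) * (γ - 1) - (γ + 1)/2) * Real.exp (-(((γ - 1)/x) ^ (γ - 1))))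
    (hT : ∀ N : ℕ, 1 ≤ N →
      (fun x => s' x - ∑ n ∈ Finset.range N,
          T n * x ^ ((n:ℝ) * (γ - 1) - (3*γ + 1)/2) * Real.exp (-(((γ - 1)/x) ^ (γ - 1))))
        =O[𝓝[>] (0:ℝ)]
      fun x => x ^ ((N:ℝ) * (γ - 1) - (3*γ + 1)/2) * Real.exp (-(((γ - 1)/x) ^ (γ - 1)))) :
    T 0 = (γ - 1) ^ γ * S 0 ∧
    ∀ n : ℕ, T (n + 1)
      = (γ - 1) ^ γ * S (n + 1) + (((n:ℝ) + 1) * (γ - 1) - (3*γ - 1)/2) * S n := by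
  obtain ⟨c, rfl⟩ : ∃ c, γ = c + 1 := ⟨γ - 1, by ring⟩
  have hc : 0 < c := by linarith
  simp only [add_sub_cancel_right] at hS hT ⊢
  have ha : ∀ n : ℕ, (n : ℝ) * c - (3 * (c + 1) + 1) / 2
      = (n * c - (c + 1 + 1) / 2) - (c + 1) := fun n => by ring
  let a : ℕ → ℝ := fun n => n * c - (c + 1 + 1) / 2
  have ha_lt : ∀ n, a n < a (n + 1) := fun n => by
    simp only [a]; push_cast; linarith
  have ha_succ : ∀ n, a n - 1 = a (n + 1) - (c + 1) := fun n => by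
    simp only [a]; push_cast; ring
  have hS' : ∀ n : ℕ, (fun x => s x - ∑ k ∈ Finset.range (n + 1), S k * rpowExp c (a k) x)
      =O[𝓝[>] (0 : ℝ)] rpowExp c (a (n + 1)) := fun n => by
    have h := hS (n + 1) (Nat.le_add_left 1 n)
    simp only [mul_assoc] at h
    exact h
  have hT' : ∀ n : ℕ, (fun x => s' x - ∑ k ∈ Finset.range (n + 1),
      T k * rpowExp c (a k - (c + 1)) x)
      =O[𝓝[>] (0 : ℝ)] rpowExp c (a (n + 1) - (c + 1)) := fun n => by
    have h := hT (n + 1) (Nat.le_add_left 1 n)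
    simp only [mul_assoc, ha] at h
    exact h
  let U : ℕ → ℝ := fun n => c ^ (c + 1) * S n + if n = 0 then 0 else a (n - 1) * S (n - 1)
  have hU0 : U 0 = c ^ (c + 1) * S 0 := by simp [U]
  have hU : ∀ n, U (n + 1) = c ^ (c + 1) * S (n + 1) + a n * S n := fun n => by simp [U]
  have key : ∀ n, T n = U n := by
    intro n
    induction n using Nat.strong_induction_on with
    | _ n ih =>
      refine sub_eq_zero.1 (leading_coeff_deriv_eq_zero hc (a n) (T n - U n)
        (r := fun x => s x - ∑ k ∈ Finset.range (n + 1), S k * rpowExp c (a k) x)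
        (r' := fun x => s' x - ∑ k ∈ Finset.range (n + 1), S k * (a k * rpowExp c (a k - 1) x
          + c ^ (c + 1) * rpowExp c (a k - (c + 1)) x)) ?_ ?_ ?_)
      · intro x hx
        exact (hderiv x hx).sub (HasDerivAt.fun_sum fun k _ =>
          (hasDerivAt_rpowExp hc (a k) hx).const_mul (S k))
      · exact (hS' n).trans_isLittleO (rpowExp_isLittleO c (ha_lt n))
      · refine (((hT' n).sub ((isBigO_refl _ _).const_mul_left (S n * a n))).trans_isLittleO
          (rpowExp_isLittleO c (sub_lt_sub_right (ha_lt n) (c + 1)))).congr_left fun x => ?_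
        simp only [ha_succ]
        rw [sum_range_deriv_collect (c ^ (c + 1)) S a U
          (fun k => rpowExp c (a k - (c + 1)) x) hU0 hU n, Finset.sum_range_succ,
          Finset.sum_range_succ,
          Finset.sum_congr rfl fun k hk => by rw [ih k (Finset.mem_range.1 hk)]]
        ring
  refine ⟨(key 0).trans hU0, fun n => ?_⟩
  rw [key, hU]
  simp only [a]
  ring
end

section
/- Assume that for every x > 0, s_γ(x) = ((γ−1)/π) x^{−γ} ∫_0^π m_γ(v) exp(−x^{−(γ−1)} m_γ(v)) dv, and define σ⁺(x) := ((γ−1)²/π) x^{−2γ} ∫_0^π m_γ(v)² exp(−x^{−(γ−1)} m_γ(v)) dv and σ⁻(x) := γ x^{−1} s_γ(x). Then there exist A, x₀ ∈ (0,∞) such that for all x ∈ (0,x₀]: σ⁺(x) ≤ A x^{−(3γ+1)/2} e^{−b(x)} and σ⁻(x) ≤ A x^{−(3γ+1)/2} e^{−b(x)}. -/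
open MeasureTheory

/-- `sin` is concave on `[0, π]`, in the form used along rays from the origin. -/
lemma mul_sin_le_sin_mul {p v : ℝ} (hp0 : 0 ≤ p) (hp1 : p ≤ 1) (hv0 : 0 ≤ v)
    (hv : v ≤ Real.pi) : p * Real.sin v ≤ Real.sin (p * v) := by
  have h := strictConcaveOn_sin_Icc.concaveOn.2 (x := 0) (y := v)
    ⟨le_rfl, Real.pi_pos.le⟩ ⟨hv0, hv⟩ (sub_nonneg.2 hp1) hp0 (by ring)
  simpa using h

/-- A quantitative version of `p sin v ≤ sin (p v)`. -/
lemma exists_mul_sin_mul_one_add_sq_le_sin_mul {p : ℝ} (hp0 : 0 < p) (hp1 : p < 1) :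
    ∃ k : ℝ, 0 < k ∧ ∀ v : ℝ, 0 < v → v < Real.pi →
      p * Real.sin v * (1 + k * v ^ 2) ≤ Real.sin (p * v) := by
  have hπ := Real.pi_pos
  have hS : 0 < Real.sin ((1 + p) * Real.pi / 2) :=
    Real.sin_pos_of_pos_of_lt_pi (by positivity) (by nlinarith)
  have hT : 0 < Real.sin ((1 - p) * Real.pi / 2) :=
    Real.sin_pos_of_pos_of_lt_pi (by nlinarith) (by nlinarith)
  set S := Real.sin ((1 + p) * Real.pi / 2)
  set T := Real.sin ((1 - p) * Real.pi / 2)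
  set k : ℝ := 2 * S * T / (3 * Real.pi ^ 2) with hk
  have hk0 : 0 < k := by positivity
  refine ⟨k, hk0, fun v hv0 hvπ => ?_⟩
  let g : ℝ → ℝ := fun u => Real.sin (p * u) - p * Real.sin u - p * k * u ^ 3
  have hg : ∀ u, HasDerivAt g
      (Real.cos (p * u) * p - p * Real.cos u - p * k * (3 * u ^ 2)) u := by
    intro u
    have h1 : HasDerivAt (fun u => Real.sin (p * u)) (Real.cos (p * u) * p) u := by
      simpa using ((hasDerivAt_id u).const_mul p).sin
    have h2 := (Real.hasDerivAt_sin u).const_mul p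
    have h3 : HasDerivAt (fun u : ℝ => p * k * u ^ 3) (p * k * (3 * u ^ 2)) u := by
      simpa using (hasDerivAt_pow 3 u).const_mul (p * k)
    exact (h1.sub h2).sub h3
  have hmono : MonotoneOn g (Set.Icc 0 Real.pi) := by
    refine monotoneOn_of_deriv_nonneg (convex_Icc _ _)
      (fun u _ => (hg u).continuousAt.continuousWithinAt)
      (fun u _ => (hg u).differentiableAt.differentiableWithinAt) fun u hu => ?_
    rw [interior_Icc] at hu
    rw [(hg u).deriv]
    have hr0 : 0 ≤ u / Real.pi := div_nonneg hu.1.le hπ.le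
    have hr1 : u / Real.pi ≤ 1 := (div_le_one hπ).2 hu.2.le
    have e1 := mul_sin_le_sin_mul hr0 hr1 (v := (1 + p) * Real.pi / 2)
      (by positivity) (by nlinarith)
    have e2 := mul_sin_le_sin_mul hr0 hr1 (v := (1 - p) * Real.pi / 2)
      (by nlinarith) (by nlinarith)
    have a1 : u / Real.pi * ((1 + p) * Real.pi / 2) = (u + p * u) / 2 := by field_simp
    have a2 : u / Real.pi * ((1 - p) * Real.pi / 2) = (u - p * u) / 2 := by field_simp
    rw [a1] at e1
    rw [a2] at e2
    have e3 := mul_le_mul e1 e2 (mul_nonneg hr0 hT.le)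
      ((mul_nonneg hr0 hS.le).trans e1)
    have e4 : Real.cos u - Real.cos (p * u) =
        -2 * Real.sin ((u + p * u) / 2) * Real.sin ((u - p * u) / 2) :=
      Real.cos_sub_cos _ _
    have e5 : k * (3 * u ^ 2) = 2 * (u / Real.pi * S * (u / Real.pi * T)) := by
      rw [hk]; field_simp
    have e6 : k * (3 * u ^ 2) ≤ Real.cos (p * u) - Real.cos u := by
      rw [e5]; linarith
    nlinarith [mul_le_mul_of_nonneg_left e6 hp0.le]
  have h := hmono ⟨le_rfl, hπ.le⟩ ⟨hv0.le, hvπ.le⟩ hv0.le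
  simp only [g, mul_zero, Real.sin_zero] at h
  have hs := mul_le_mul_of_nonneg_left (Real.sin_le hv0.le)
    (show 0 ≤ p * k * v ^ 2 by positivity)
  nlinarith

/-- The sine-ratio function `m_γ` exceeds its limit at `0` by a multiple of `v ^ 2`. -/
lemma exists_add_sq_le_sin_ratio {γ : ℝ} (hγ1 : 1 < γ) :
    ∃ k : ℝ, 0 < k ∧ ∀ v : ℝ, 0 < v → v < Real.pi →
      (γ - 1) ^ (γ - 1) + k * v ^ 2 ≤
        (γ * Real.sin (((γ - 1) / γ) * v) / Real.sin v) ^ (γ - 1)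
          * (γ * Real.sin (v / γ) / Real.sin v) := by
  have hγ0 : 0 < γ := by linarith
  have hc : 0 < γ - 1 := by linarith
  obtain ⟨k, hk0, hk⟩ := exists_mul_sin_mul_one_add_sq_le_sin_mul
    (p := 1 / γ) (by positivity) ((div_lt_one hγ0).2 hγ1)
  have hM : 0 < (γ - 1) ^ (γ - 1) := Real.rpow_pos_of_pos hc _
  refine ⟨(γ - 1) ^ (γ - 1) * k, mul_pos hM hk0, fun v hv0 hvπ => ?_⟩
  have hs : 0 < Real.sin v := Real.sin_pos_of_pos_of_lt_pi hv0 hvπ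
  have h1 : γ - 1 ≤ γ * Real.sin (((γ - 1) / γ) * v) / Real.sin v := by
    have h := mul_sin_le_sin_mul (p := (γ - 1) / γ) (by positivity)
      ((div_le_one hγ0).2 (by linarith)) hv0.le hvπ.le
    rw [le_div_iff₀ hs]
    calc (γ - 1) * Real.sin v = γ * ((γ - 1) / γ * Real.sin v) := by field_simp
      _ ≤ _ := mul_le_mul_of_nonneg_left h hγ0.le
  have h2 : 1 + k * v ^ 2 ≤ γ * Real.sin (v / γ) / Real.sin v := by
    have h := hk v hv0 hvπ
    rw [show 1 / γ * v = v / γ by ring] at h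
    rw [le_div_iff₀ hs]
    calc (1 + k * v ^ 2) * Real.sin v
        = γ * (1 / γ * Real.sin v * (1 + k * v ^ 2)) := by field_simp
      _ ≤ _ := mul_le_mul_of_nonneg_left h hγ0.le
  calc _ = (γ - 1) ^ (γ - 1) * (1 + k * v ^ 2) := by ring
    _ ≤ _ := mul_le_mul (Real.rpow_le_rpow hc.le h1 hc.le) h2 (by positivity)
      (Real.rpow_nonneg (hc.le.trans h1) _)

/-- Laplace-type upper bound for a phase growing at least quadratically from `M`. -/
lemma exists_integral_pow_mul_exp_le (n : ℕ) {m : ℝ → ℝ} {M k L : ℝ} (hM : 0 ≤ M)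
    (hk : 0 < k) (hL : 0 ≤ L) (hm : ∀ v ∈ Set.Ioo 0 L, M + k * v ^ 2 ≤ m v) :
    ∃ C : ℝ, 0 < C ∧ ∀ t : ℝ, 1 ≤ t →
      ∫ v in (0:ℝ)..L, m v ^ n * Real.exp (-(t * m v)) ≤
        C * t ^ (-(1 / 2) : ℝ) * Real.exp (-(t * M)) := by
  set B : ℝ := 2 ^ n * n.factorial * Real.exp (M / 2) with hB
  refine ⟨B * √(2 * Real.pi / k), by positivity, fun t ht => ?_⟩
  have ht0 : 0 < t := by linarith
  have hb : 0 < t * k / 2 := by positivity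
  have hgi : Integrable fun v : ℝ => Real.exp (-(t * k / 2) * v ^ 2) :=
    integrable_exp_neg_mul_sq hb
  have hpt : ∀ v ∈ Set.Ioo 0 L, m v ^ n * Real.exp (-(t * m v)) ≤
      B * Real.exp (-(t * M)) * Real.exp (-(t * k / 2) * v ^ 2) := by
    intro v hv
    have hD := hm v hv
    have hkv : 0 ≤ k * v ^ 2 := by positivity
    have hm0 : 0 ≤ m v := by linarith
    have hpow : m v ^ n ≤ 2 ^ n * n.factorial * Real.exp (m v / 2) := by
      have h := Real.pow_div_factorial_le_exp (m v / 2) (by positivity) n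
      rw [div_le_iff₀ (by positivity), div_pow, div_le_iff₀ (by positivity)] at h
      linarith
    calc m v ^ n * Real.exp (-(t * m v))
        ≤ 2 ^ n * n.factorial * Real.exp (m v / 2) * Real.exp (-(t * m v)) := by gcongr
      _ = 2 ^ n * n.factorial * Real.exp (m v / 2 + -(t * m v)) := by
        rw [Real.exp_add]; ring
      _ ≤ 2 ^ n * n.factorial *
          Real.exp (M / 2 + -(t * M) + -(t * k / 2) * v ^ 2) := by
        refine mul_le_mul_of_nonneg_left (Real.exp_le_exp.2 ?_) (by positivity)
        nlinarith [mul_nonneg (sub_nonneg.2 ht) (sub_nonneg.2 hD),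
          mul_nonneg (sub_nonneg.2 ht) hkv]
      _ = _ := by rw [hB, Real.exp_add, Real.exp_add]; ring
  rw [intervalIntegral.integral_of_le hL, integral_Ioc_eq_integral_Ioo]
  calc ∫ v in Set.Ioo 0 L, m v ^ n * Real.exp (-(t * m v))
      ≤ ∫ v in Set.Ioo 0 L,
          B * Real.exp (-(t * M)) * Real.exp (-(t * k / 2) * v ^ 2) := by
        refine integral_mono_of_nonneg ?_ (hgi.const_mul _).integrableOn ?_
        · filter_upwards [ae_restrict_mem measurableSet_Ioo] with v hv
          have : 0 ≤ m v := le_trans (by positivity) (hm v hv)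
          simp only [Pi.zero_apply]
          positivity
        · filter_upwards [ae_restrict_mem measurableSet_Ioo] with v hv using hpt v hv
    _ ≤ ∫ v, B * Real.exp (-(t * M)) * Real.exp (-(t * k / 2) * v ^ 2) :=
        setIntegral_le_integral (hgi.const_mul _)
          (Filter.Eventually.of_forall fun v => by simp only [Pi.zero_apply]; positivity)
    _ = B * √(2 * Real.pi / k) * t ^ (-(1 / 2) : ℝ) * Real.exp (-(t * M)) := by
        have e : Real.pi / (t * k / 2) = 2 * Real.pi / k * t⁻¹ := by field_simp
        rw [integral_const_mul, integral_gaussian, e, Real.sqrt_mul (by positivity),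
          Real.sqrt_inv, Real.rpow_neg ht0.le, ← Real.sqrt_eq_rpow]
        ring

/-- Fix `γ ∈ (1,2]`, set `b(x) := ((γ−1)/x)^{γ−1}`, and let `m_γ` and
the representation of `s_γ` be as in the context.  With
`σ⁺(x) := ((γ−1)²/π) x^{−2γ} ∫_0^π m_γ(v)² exp(−x^{−(γ−1)} m_γ(v)) dv` and
`σ⁻(x) := γ x⁻¹ s_γ(x)`, there are `A, x₀ ∈ (0,∞)` with
`σ±(x) ≤ A x^{−(3γ+1)/2} e^{−b(x)}` for all `x ∈ (0,x₀]`. -/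
theorem stmt8 (γ : ℝ) (hγ1 : 1 < γ) (hγ2 : γ ≤ 2)
    (s m σp σm : ℝ → ℝ)
    (hm0 : m 0 = (γ - 1) ^ (γ - 1))
    (hm : ∀ v ∈ Set.Ioo (0:ℝ) Real.pi,
      m v = (γ * Real.sin (((γ - 1) / γ) * v) / Real.sin v) ^ (γ - 1)
        * (γ * Real.sin (v / γ) / Real.sin v))
    (hrep : ∀ x ∈ Set.Ioi (0:ℝ),
      s x = ((γ - 1) / Real.pi) * x ^ (-γ)
        * ∫ v in (0:ℝ)..Real.pi, m v * Real.exp (-(x ^ (-(γ - 1)) * m v)))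
    (hσp : ∀ x ∈ Set.Ioi (0:ℝ),
      σp x = ((γ - 1) ^ 2 / Real.pi) * x ^ (-(2 * γ))
        * ∫ v in (0:ℝ)..Real.pi, (m v) ^ 2 * Real.exp (-(x ^ (-(γ - 1)) * m v)))
    (hσm : ∀ x ∈ Set.Ioi (0:ℝ), σm x = γ * x⁻¹ * s x) :
    ∃ A x₀ : ℝ, 0 < A ∧ 0 < x₀ ∧
      ∀ x : ℝ, 0 < x → x ≤ x₀ →
        σp x ≤ A * x ^ (-(3*γ + 1)/2) * Real.exp (-(((γ - 1)/x) ^ (γ - 1))) ∧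
        σm x ≤ A * x ^ (-(3*γ + 1)/2) * Real.exp (-(((γ - 1)/x) ^ (γ - 1))) := by
  have hc : 0 < γ - 1 := by linarith
  have hπ := Real.pi_pos
  obtain ⟨k, hk0, hk⟩ := exists_add_sq_le_sin_ratio hγ1
  set M : ℝ := (γ - 1) ^ (γ - 1) with hM
  have hM0 : 0 < M := Real.rpow_pos_of_pos hc _
  have hlow : ∀ v ∈ Set.Ioo 0 Real.pi, M + k * v ^ 2 ≤ m v := fun v hv => by
    rw [hm v hv]
    exact hk v hv.1 hv.2
  obtain ⟨C₁, hC₁, h₁⟩ := exists_integral_pow_mul_exp_le 1 hM0.le hk0 hπ.le hlow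
  obtain ⟨C₂, hC₂, h₂⟩ := exists_integral_pow_mul_exp_le 2 hM0.le hk0 hπ.le hlow
  simp only [pow_one] at h₁
  set A₁ := γ * ((γ - 1) / Real.pi) * C₁ with hA₁
  set A₂ := (γ - 1) ^ 2 / Real.pi * C₂ with hA₂
  have hA₁0 : 0 < A₁ := by positivity
  have hA₂0 : 0 < A₂ := by positivity
  refine ⟨A₁ + A₂, 1, by positivity, one_pos, fun x hx hx1 => ?_⟩
  have ht : 1 ≤ x ^ (-(γ - 1)) :=
    Real.one_le_rpow_of_pos_of_le_one_of_nonpos hx hx1 (by linarith)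
  have hb : x ^ (-(γ - 1)) * M = ((γ - 1) / x) ^ (γ - 1) := by
    rw [Real.div_rpow hc.le hx.le, Real.rpow_neg hx.le, hM]
    ring
  have hhalf : (x ^ (-(γ - 1))) ^ (-(1 / 2) : ℝ) = x ^ ((γ - 1) / 2) := by
    rw [← Real.rpow_mul hx.le]
    congr 1
    ring
  have h₁x := h₁ _ ht
  have h₂x := h₂ _ ht
  rw [hhalf, hb] at h₁x h₂x
  set E := Real.exp (-(((γ - 1) / x) ^ (γ - 1)))
  have hE : 0 < E := Real.exp_pos _
  set X := x ^ (-(3 * γ + 1) / 2) with hX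
  have hX0 : 0 < X := Real.rpow_pos_of_pos hx _
  constructor
  · have e : x ^ (-(2 * γ)) * x ^ ((γ - 1) / 2) = X := by
      rw [← Real.rpow_add hx, hX]
      congr 1
      ring
    calc σp x ≤ (γ - 1) ^ 2 / Real.pi * x ^ (-(2 * γ)) * (C₂ * x ^ ((γ - 1) / 2) * E) := by
          rw [hσp x hx]
          gcongr
      _ = A₂ * X * E := by rw [← e, hA₂]; ring
      _ ≤ (A₁ + A₂) * X * E := by gcongr; linarith
  · have e : x⁻¹ * x ^ (-γ) * x ^ ((γ - 1) / 2) ≤ X := by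
      rw [← Real.rpow_neg_one, ← Real.rpow_add hx, ← Real.rpow_add hx]
      exact Real.rpow_le_rpow_of_exponent_ge hx hx1 (by linarith)
    calc σm x ≤ γ * x⁻¹ * ((γ - 1) / Real.pi * x ^ (-γ) * (C₁ * x ^ ((γ - 1) / 2) * E)) := by
          rw [hσm x hx, hrep x hx]
          gcongr
      _ = A₁ * (x⁻¹ * x ^ (-γ) * x ^ ((γ - 1) / 2)) * E := by rw [hA₁]; ring
      _ ≤ (A₁ + A₂) * X * E := by gcongr; linarith
end

section
/- Let f : [0,∞) → [0,∞) and, for each n ∈ ℕ, g_n, h_n : [0,∞) → [0,∞) be continuous nonnegative functions; set f_n := g_n − h_n. Let (q_n)_{n≥0} be a real sequence. Assume: (a) there exists λ₀ ≥ 0 such that ∫_0^∞ e^{−λ₀x} f(x) dx < ∞ and Σ_{n≥0} |q_n| ∫_0^∞ e^{−λ₀x} ( g_n(x) + h_n(x) ) dx < ∞; (b) for every λ ≥ λ₀, ∫_0^∞ e^{−λx} f(x) dx = Σ_{n≥0} q_n ∫_0^∞ e^{−λx} f_n(x) dx; (c) for every x ≥ 0, Σ_{n≥0} |q_n| ( sup_{y∈[0,x]}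 g_n(y) + sup_{y∈[0,x]} h_n(y) ) < ∞. Then f(x) = Σ_{n≥0} q_n f_n(x) for every x ≥ 0. -/
open MeasureTheory

/-- If `ψ` is integrable on `(0, ∞)` and its Laplace transform vanishes at every natural number,
then `ψ` vanishes almost everywhere on `(0, ∞)`. -/
theorem ae_eq_zero_of_forall_integral_exp_neg_nat_mul_eq_zero {ψ : ℝ → ℝ}
    (hψ : IntegrableOn ψ (Set.Ioi 0))
    (h0 : ∀ k : ℕ, ∫ x in Set.Ioi (0 : ℝ), Real.exp (-x) ^ k * ψ x = 0) :
    ∀ᵐ x, x ∈ Set.Ioi (0 : ℝ) → ψ x = 0 := by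
  have hexp : ∀ x ∈ Set.Ioi (0 : ℝ), Real.exp (-x) ∈ Set.Icc (0 : ℝ) 1 := fun x hx =>
    ⟨(Real.exp_pos _).le, Real.exp_le_one_iff.2 (by simpa using (Set.mem_Ioi.1 hx).le)⟩
  have hpow_int : ∀ k : ℕ,
      IntegrableOn (fun x => Real.exp (-x) ^ k * ψ x) (Set.Ioi 0) := fun k => by
    refine Integrable.bdd_mul (c := 1) hψ (by fun_prop) ?_
    filter_upwards [ae_restrict_mem measurableSet_Ioi] with x hx
    rw [Real.norm_of_nonneg (by positivity)]
    exact pow_le_one₀ (hexp x hx).1 (hexp x hx).2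
  have hpoly_expand : ∀ (p : Polynomial ℝ) (x : ℝ), p.eval (Real.exp (-x)) * ψ x =
      ∑ i ∈ Finset.range (p.natDegree + 1), p.coeff i * (Real.exp (-x) ^ i * ψ x) := fun p x => by
    rw [Polynomial.eval_eq_sum_range, Finset.sum_mul]
    exact Finset.sum_congr rfl fun i _ => mul_assoc _ _ _
  have hpoly_int : ∀ p : Polynomial ℝ,
      IntegrableOn (fun x => p.eval (Real.exp (-x)) * ψ x) (Set.Ioi 0) := fun p => by
    simp only [hpoly_expand]
    exact integrable_finsetSum _ fun i _ => (hpow_int i).const_mul _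
  have hpoly : ∀ p : Polynomial ℝ,
      ∫ x in Set.Ioi (0 : ℝ), p.eval (Real.exp (-x)) * ψ x = 0 := fun p => by
    simp only [hpoly_expand]
    rw [integral_finsetSum _ fun i _ => (hpow_int i).const_mul _]
    simp [integral_const_mul, h0]
  refine isOpen_Ioi.ae_eq_zero_of_integral_contDiff_smul_eq_zero hψ.locallyIntegrableOn ?_
  intro φ hφ hφc hφs
  have hφ0 : φ 0 = 0 := image_eq_zero_of_notMem_tsupport fun h => lt_irrefl (0 : ℝ) (hφs h)
  set G : ℝ → ℝ := fun t => φ (-Real.log t) with hG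
  have hGcont : Continuous G := by
    refine continuous_iff_continuousAt.2 fun t => ?_
    rcases eq_or_ne t 0 with rfl | ht
    · rw [continuousAt_iff_punctured_nhds]
      have h1 : Filter.Tendsto (fun t : ℝ => -Real.log t) (nhdsWithin 0 {0}ᶜ)
          (Filter.cocompact ℝ) :=
        (Filter.tendsto_neg_atBot_atTop.comp Real.tendsto_log_nhdsNE_zero).mono_right
          atTop_le_cocompact
      simpa [hG, hφ0, Function.comp_def] using hφc.is_zero_at_infty.comp h1
    · exact (hφ.continuous.continuousAt).comp (Real.continuousAt_log ht).neg
  have hGexp : ∀ x, G (Real.exp (-x)) = φ x := fun x => by simp [hG]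
  have hφint : IntegrableOn (fun x => φ x * ψ x) (Set.Ioi 0) := by
    obtain ⟨C, hC⟩ := hφc.exists_bound_of_continuous hφ.continuous
    exact Integrable.bdd_mul (c := C) hψ hφ.continuous.aestronglyMeasurable
      (Filter.Eventually.of_forall hC)
  have hres : ∫ x, φ x • ψ x = ∫ x in Set.Ioi (0 : ℝ), φ x * ψ x := by
    refine (setIntegral_eq_integral_of_forall_compl_eq_zero fun x hx => ?_).symm
    rw [image_eq_zero_of_notMem_tsupport fun h => hx (hφs h), zero_smul]
  rw [hres]
  set N := ∫ x in Set.Ioi (0 : ℝ), ‖ψ x‖ with hN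
  have hN0 : 0 ≤ N := integral_nonneg fun _ => norm_nonneg _
  have hbound : ∀ ε > 0, |∫ x in Set.Ioi (0 : ℝ), φ x * ψ x| ≤ ε * N := fun ε hε => by
    obtain ⟨p, hp⟩ := exists_polynomial_near_of_continuousOn 0 1 G hGcont.continuousOn ε hε
    have hsub := integral_sub hφint (hpoly_int p)
    rw [hpoly p, sub_zero] at hsub
    rw [← hsub, ← Real.norm_eq_abs, hN, ← integral_const_mul]
    refine norm_integral_le_of_norm_le (hψ.norm.const_mul ε) ?_
    filter_upwards [ae_restrict_mem measurableSet_Ioi] with x hx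
    rw [← sub_mul, norm_mul, ← hGexp, Real.norm_eq_abs, abs_sub_comm]
    exact mul_le_mul_of_nonneg_right (hp _ (hexp x hx)).le (norm_nonneg _)
  refine abs_eq_zero.1 (le_antisymm (le_of_forall_pos_le_add fun ε hε => ?_) (abs_nonneg _))
  calc _ ≤ ε / (N + 1) * N := hbound _ (by positivity)
    _ ≤ ε / (N + 1) * (N + 1) := by gcongr; linarith
    _ = 0 + ε := by field_simp; ring


open MeasureTheory

/-- Lemma 4.1.  Let `f, g_n, h_n : [0,∞) → [0,∞)` be continuous
nonnegative functions, `f_n := g_n − h_n`, and `(q_n)` a real sequence satisfying the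
Laplace-transform assumptions (a), (b) and the local normal-convergence assumption (c).
Then `f(x) = Σ_n q_n f_n(x)` for every `x ≥ 0`. -/
theorem stmt9 (f : ℝ → ℝ) (g h : ℕ → ℝ → ℝ) (q : ℕ → ℝ)
    (hf_cont : ContinuousOn f (Set.Ici 0))
    (hf_nonneg : ∀ x ∈ Set.Ici (0:ℝ), 0 ≤ f x)
    (hg_cont : ∀ n, ContinuousOn (g n) (Set.Ici 0))
    (hg_nonneg : ∀ n, ∀ x ∈ Set.Ici (0:ℝ), 0 ≤ g n x)
    (hh_cont : ∀ n, ContinuousOn (h n) (Set.Ici 0))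
    (hh_nonneg : ∀ n, ∀ x ∈ Set.Ici (0:ℝ), 0 ≤ h n x)
    (lam0 : ℝ) (hlam0 : 0 ≤ lam0)
    (ha_f : (∫⁻ x in Set.Ioi (0:ℝ), ENNReal.ofReal (Real.exp (-(lam0 * x)) * f x)) < ⊤)
    (ha_gh : (∑' n : ℕ, ENNReal.ofReal |q n|
        * ∫⁻ x in Set.Ioi (0:ℝ),
            ENNReal.ofReal (Real.exp (-(lam0 * x)) * (g n x + h n x))) < ⊤)
    (hb : ∀ lam : ℝ, lam0 ≤ lam →
      (∫ x in Set.Ioi (0:ℝ), Real.exp (-(lam * x)) * f x)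
        = ∑' n : ℕ, q n * ∫ x in Set.Ioi (0:ℝ), Real.exp (-(lam * x)) * (g n x - h n x))
    (hc : ∀ x : ℝ, 0 ≤ x →
      Summable (fun n : ℕ =>
        |q n| * (sSup (g n '' Set.Icc 0 x) + sSup (h n '' Set.Icc 0 x)))) :
    ∀ x : ℝ, 0 ≤ x → HasSum (fun n : ℕ => q n * (g n x - h n x)) (f x) := by
  set F : ℕ → ℝ → ℝ := fun n x => q n * (g n x - h n x) with hF
  set S : ℝ → ℝ := fun x => ∑' n, F n x with hS
  have hF_cont : ∀ n, ContinuousOn (F n) (Set.Ici 0) := fun n =>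
    continuousOn_const.mul ((hg_cont n).sub (hh_cont n))
  have hle_sSup : ∀ {φ : ℝ → ℝ}, ContinuousOn φ (Set.Ici 0) → ∀ {X x : ℝ}, x ∈ Set.Icc 0 X →
      φ x ≤ sSup (φ '' Set.Icc 0 X) := fun hφ X x hx =>
    le_csSup (isCompact_Icc.bddAbove_image (hφ.mono Set.Icc_subset_Ici_self))
      (Set.mem_image_of_mem _ hx)
  have hF_abs : ∀ n, ∀ x ∈ Set.Ici (0 : ℝ), ‖F n x‖ ≤ |q n| * (g n x + h n x) := fun n x hx => by
    rw [hF, norm_mul, Real.norm_eq_abs, Real.norm_eq_abs]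
    have := hg_nonneg n x hx
    have := hh_nonneg n x hx
    gcongr
    exact abs_le.2 ⟨by linarith, by linarith⟩
  have hF_bound : ∀ X n, ∀ x ∈ Set.Icc (0 : ℝ) X, ‖F n x‖ ≤
      |q n| * (sSup (g n '' Set.Icc 0 X) + sSup (h n '' Set.Icc 0 X)) := fun X n x hx =>
    (hF_abs n x hx.1).trans (mul_le_mul_of_nonneg_left
      (add_le_add (hle_sSup (hg_cont n) hx) (hle_sSup (hh_cont n) hx)) (abs_nonneg _))
  have hF_sum : ∀ x, 0 ≤ x → Summable fun n => F n x := fun x hx =>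
    .of_norm_bounded (hc x hx) fun n => hF_bound x n x ⟨hx, le_rfl⟩
  have hS_cont : ContinuousOn S (Set.Ici 0) := fun x hx => by
    have hx0 : 0 ≤ x := hx
    have h1 : ContinuousOn S (Set.Icc 0 (x + 1)) :=
      continuousOn_tsum (fun n => (hF_cont n).mono Set.Icc_subset_Ici_self)
        (hc (x + 1) (by linarith)) fun n y hy => hF_bound _ n y hy
    refine (h1 x ⟨hx0, by linarith⟩).mono_of_mem_nhdsWithin ?_
    rw [← Set.Ici_inter_Iic]
    exact inter_mem_nhdsWithin _ (Iic_mem_nhds (by linarith))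
  have hmeas : ∀ {φ : ℝ → ℝ} (lam : ℝ), ContinuousOn φ (Set.Ici 0) →
      AEStronglyMeasurable (fun x => Real.exp (-(lam * x)) * φ x)
        (volume.restrict (Set.Ioi 0)) := fun lam hφ =>
    ((by fun_prop : Continuous fun x : ℝ => Real.exp (-(lam * x))).continuousOn.mul
      (hφ.mono Set.Ioi_subset_Ici_self)).aestronglyMeasurable measurableSet_Ioi
  have hnormal : ∀ lam, lam0 ≤ lam →
      ∑' n, ∫⁻ x in Set.Ioi (0 : ℝ), ‖Real.exp (-(lam * x)) * F n x‖ₑ ≠ ⊤ := fun lam hlam => by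
    refine ne_top_of_le_ne_top ha_gh.ne (ENNReal.tsum_le_tsum fun n => ?_)
    rw [← lintegral_const_mul' _ _ ENNReal.ofReal_ne_top]
    refine setLIntegral_mono' measurableSet_Ioi fun x hx => ?_
    have hx0 : 0 ≤ x := (Set.mem_Ioi.1 hx).le
    rw [← ENNReal.ofReal_mul (abs_nonneg _), ← ofReal_norm, norm_mul,
      Real.norm_of_nonneg (Real.exp_pos _).le]
    refine ENNReal.ofReal_le_ofReal ?_
    calc _ ≤ Real.exp (-(lam0 * x)) * (|q n| * (g n x + h n x)) := by
          gcongr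
          exact hF_abs n x hx0
      _ = _ := by ring
  have hS_int : ∀ lam, lam0 ≤ lam →
      IntegrableOn (fun x => Real.exp (-(lam * x)) * S x) (Set.Ioi 0) := fun lam hlam => by
    refine ⟨hmeas lam hS_cont, lt_of_le_of_lt ?_ (hnormal lam hlam).lt_top⟩
    rw [← lintegral_tsum fun n => (hmeas lam (hF_cont n)).enorm]
    refine lintegral_mono fun x => ?_
    simp only [hS, ← tsum_mul_left]
    exact enorm_tsum_le_tsum_enorm
  have hS_laplace : ∀ lam, lam0 ≤ lam → ∫ x in Set.Ioi (0 : ℝ), Real.exp (-(lam * x)) * S x =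
      ∫ x in Set.Ioi (0 : ℝ), Real.exp (-(lam * x)) * f x := fun lam hlam => by
    rw [hb lam hlam]
    simp only [hS, ← tsum_mul_left]
    rw [integral_tsum (fun n => hmeas lam (hF_cont n)) (hnormal lam hlam)]
    refine tsum_congr fun n => ?_
    rw [← integral_const_mul]
    congr 1 with x
    ring
  have hf_int : ∀ lam, lam0 ≤ lam →
      IntegrableOn (fun x => Real.exp (-(lam * x)) * f x) (Set.Ioi 0) := fun lam hlam => by
    refine ⟨hmeas lam hf_cont, lt_of_le_of_lt ?_ ha_f⟩
    refine setLIntegral_mono' measurableSet_Ioi fun x hx => ?_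
    have hx0 : 0 ≤ x := (Set.mem_Ioi.1 hx).le
    have := hf_nonneg x hx0
    rw [Real.enorm_of_nonneg (by positivity)]
    beta_reduce
    gcongr
  have hzero := ae_eq_zero_of_forall_integral_exp_neg_nat_mul_eq_zero
    (ψ := fun x => Real.exp (-(lam0 * x)) * S x - Real.exp (-(lam0 * x)) * f x)
    ((hS_int lam0 le_rfl).sub (hf_int lam0 le_rfl)) fun k => by
      have hlam : lam0 ≤ lam0 + k := by simp
      refine Eq.trans ?_ ((integral_sub (hS_int _ hlam) (hf_int _ hlam)).trans
        (sub_eq_zero.2 (hS_laplace _ hlam)))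
      congr 1 with x
      rw [add_mul, neg_add, Real.exp_add, ← Real.exp_nat_mul, mul_neg]
      ring
  have hae : S =ᵐ[volume.restrict (Set.Ici 0)] f := by
    rw [← restrict_Ioi_eq_restrict_Ici, Filter.EventuallyEq, ae_restrict_iff' measurableSet_Ioi]
    filter_upwards [hzero] with x hx hx0
    exact mul_left_cancel₀ (Real.exp_pos _).ne' (sub_eq_zero.1 (hx hx0))
  have heq : Set.EqOn S f (Set.Ici 0) :=
    Measure.eqOn_of_ae_eq hae hS_cont hf_cont (by simp [closure_Ioi])
  intro x hx
  exact heq hx ▸ (hF_sum x hx).hasSum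
end

section
/- Let a ∈ ℝ be such that −(a+1)/(γ−1) is not a positive integer. Set J_a(x) := ∫_0^x y^a e^{−b(y)} dy for x > 0 (this integral converges for every a ∈ ℝ), c₀(a,γ) := (γ−1)^{−γ} and, for each integer q ≥ 1, c_q(a,γ) := (−1)^q (γ−1)^{−(q+1)γ} ∏_{1≤k≤q} ( a + 1 + k(γ−1) ). Then for every integer p ≥ 1 and every x > 0: J_a(x) = Σ_{0≤q<p} c_q(a,γ) x^{a+γ+q(γ−1)} e^{−b(x)} + (γ−1)^γ c_p(a,γ) J_{a+p(γ−1)}(x); consequently, as x → 0+, x^{−a−γ} e^{b(x)} J_a(x) = Σ_{0≤q<p} c_q(a,γ) x^{q(γ−1)} + O( x^{p(γ−1)} ). -/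
open MeasureTheory Asymptotics Filter Topology

theorem tendsto_rpow_mul_exp_neg_div_rpow {g : ℝ} (hg : 0 < g) (s : ℝ) :
    Tendsto (fun y : ℝ => y ^ s * Real.exp (-((g / y) ^ g))) (𝓝[>] 0) (𝓝 0) := by
  have h1 := tendsto_rpow_mul_exp_neg_mul_atTop_nhds_zero (-s / g) (g ^ g) (by positivity)
  have h2 : Tendsto (fun y : ℝ => y ^ (-g)) (𝓝[>] 0) atTop :=
    tendsto_rpow_neg_nhdsGT_zero (neg_lt_zero.2 hg)
  refine (h1.comp h2).congr' ?_
  filter_upwards [self_mem_nhdsWithin] with y (hy : 0 < y)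
  have h3 : (y ^ (-g)) ^ (-s / g) = y ^ s := by
    rw [← Real.rpow_mul hy.le]
    congr 1
    field_simp
  simp only [Function.comp_apply, h3]
  rw [Real.div_rpow hg.le hy.le, Real.rpow_neg hy.le, neg_mul, div_eq_mul_inv]

theorem continuousOn_rpow_mul_exp_neg_div_rpow (g s : ℝ) {t : Set ℝ} (hg : 0 < g)
    (ht : ∀ y ∈ t, 0 < y) :
    ContinuousOn (fun y : ℝ => y ^ s * Real.exp (-((g / y) ^ g))) t := by
  intro y hy
  have hy0 := ht y hy
  refine ContinuousAt.continuousWithinAt ?_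
  have h1 : ContinuousAt (fun y : ℝ => y ^ s) y :=
    Real.continuousAt_rpow_const _ _ (Or.inl hy0.ne')
  have h2 : ContinuousAt (fun y : ℝ => (g / y) ^ g) y :=
    (continuousAt_const.div continuousAt_id hy0.ne').rpow_const (Or.inr hg.le)
  exact h1.mul h2.neg.rexp

theorem integrableOn_rpow_mul_exp_neg_div_rpow {g : ℝ} (hg : 0 < g) (s x : ℝ) :
    IntegrableOn (fun y : ℝ => y ^ s * Real.exp (-((g / y) ^ g))) (Set.Ioc 0 x) := by
  have h : ContinuousOn
      (Function.update (fun y : ℝ => y ^ s * Real.exp (-((g / y) ^ g))) 0 0) (Set.Icc 0 x) := by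
    rw [continuousOn_update_iff]
    have hpos : ∀ y ∈ Set.Icc 0 x \ {0}, 0 < y := fun y hy => lt_of_le_of_ne hy.1.1 (Ne.symm hy.2)
    exact ⟨continuousOn_rpow_mul_exp_neg_div_rpow g s hg hpos, fun _ =>
      (tendsto_rpow_mul_exp_neg_div_rpow hg s).mono_left (nhdsWithin_mono _ hpos)⟩
  refine (h.integrableOn_Icc.mono_set Set.Ioc_subset_Icc_self).congr_fun ?_ measurableSet_Ioc
  intro y hy
  simp [Function.update_of_ne hy.1.ne']

theorem hasDerivAt_rpow_mul_exp_neg_div_rpow {g : ℝ} (hg : 0 < g) (s : ℝ) {y : ℝ} (hy : 0 < y) :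
    HasDerivAt (fun y : ℝ => y ^ (s + g + 1) * Real.exp (-((g / y) ^ g)))
      ((s + g + 1) * (y ^ (s + g) * Real.exp (-((g / y) ^ g)))
        + g ^ (g + 1) * (y ^ s * Real.exp (-((g / y) ^ g)))) y := by
  have h1 : HasDerivAt (fun y : ℝ => y ^ (s + g + 1)) ((s + g + 1) * y ^ (s + g)) y := by
    simpa using Real.hasDerivAt_rpow_const (p := s + g + 1) (Or.inl hy.ne')
  have h2 : HasDerivAt (fun y : ℝ => g / y) (-g / y ^ 2) y := by
    simpa [div_eq_mul_inv, neg_mul, mul_neg] using (hasDerivAt_inv hy.ne').const_mul g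
  have h3 := (h2.rpow_const (p := g) (Or.inl (by positivity))).neg.exp
  refine (h1.mul h3).congr_deriv ?_
  have e1 : (g / y) ^ (g - 1) = g ^ g / g / (y ^ g / y) := by
    rw [Real.div_rpow hg.le hy.le, Real.rpow_sub_one hg.ne', Real.rpow_sub_one hy.ne']
  have e2 : y ^ (s + g + 1) = y ^ s * y ^ g * y := by
    rw [Real.rpow_add_one hy.ne', Real.rpow_add hy]
  have e3 : g ^ (g + 1) = g ^ g * g := Real.rpow_add_one hg.ne' _
  have : y ^ g ≠ 0 := by positivity
  simp only [Pi.neg_apply]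
  rw [e1, e2, e3]
  field_simp

theorem integral_rpow_mul_exp_neg_div_rpow_recursion {g : ℝ} (hg : 0 < g) (s : ℝ) {x : ℝ}
    (hx : 0 < x) :
    (s + g + 1) * (∫ y in Set.Ioc 0 x, y ^ (s + g) * Real.exp (-((g / y) ^ g)))
        + g ^ (g + 1) * (∫ y in Set.Ioc 0 x, y ^ s * Real.exp (-((g / y) ^ g)))
      = x ^ (s + g + 1) * Real.exp (-((g / x) ^ g)) := by
  have i1 := (integrableOn_rpow_mul_exp_neg_div_rpow hg (s + g) x).const_mul (s + g + 1)
  have i2 := (integrableOn_rpow_mul_exp_neg_div_rpow hg s x).const_mul (g ^ (g + 1))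
  have h := intervalIntegral.integral_eq_sub_of_hasDerivAt_of_tendsto hx
    (fun y hy => hasDerivAt_rpow_mul_exp_neg_div_rpow hg s hy.1)
    ((intervalIntegrable_iff_integrableOn_Ioc_of_le hx.le).2 (i1.add i2))
    (tendsto_rpow_mul_exp_neg_div_rpow hg (s + g + 1))
    ((hasDerivAt_rpow_mul_exp_neg_div_rpow hg s hx).continuousAt.tendsto.mono_left
      nhdsWithin_le_nhds)
  rw [intervalIntegral.integral_of_le hx.le, integral_add i1 i2, integral_const_mul,
    integral_const_mul, sub_zero] at h
  exact h

theorem integral_rpow_mul_exp_neg_div_rpow_nonneg (g s x : ℝ) :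
    0 ≤ ∫ y in Set.Ioc 0 x, y ^ s * Real.exp (-((g / y) ^ g)) :=
  setIntegral_nonneg measurableSet_Ioc fun _ hy =>
    mul_nonneg (Real.rpow_nonneg hy.1.le _) (Real.exp_pos _).le

theorem integral_rpow_add_mul_exp_neg_div_rpow_le {g : ℝ} (hg : 0 < g) (s x : ℝ) :
    (∫ y in Set.Ioc 0 x, y ^ (s + g) * Real.exp (-((g / y) ^ g)))
      ≤ x ^ g * ∫ y in Set.Ioc 0 x, y ^ s * Real.exp (-((g / y) ^ g)) := by
  rw [← integral_const_mul]
  refine setIntegral_mono_on (integrableOn_rpow_mul_exp_neg_div_rpow hg _ x)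
    ((integrableOn_rpow_mul_exp_neg_div_rpow hg s x).const_mul _) measurableSet_Ioc ?_
  intro y hy
  have h1 : y ^ g ≤ x ^ g := Real.rpow_le_rpow hy.1.le hy.2 hg.le
  have h2 : 0 ≤ y ^ s * Real.exp (-((g / y) ^ g)) :=
    mul_nonneg (Real.rpow_nonneg hy.1.le _) (Real.exp_pos _).le
  rw [Real.rpow_add hy.1]
  nlinarith [mul_le_mul_of_nonneg_right h1 h2]

theorem eventually_integral_rpow_mul_exp_neg_div_rpow_le {g : ℝ} (hg : 0 < g) (s : ℝ) :
    ∀ᶠ x in 𝓝[>] (0 : ℝ),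
      g ^ (g + 1) * (∫ y in Set.Ioc 0 x, y ^ s * Real.exp (-((g / y) ^ g)))
        ≤ 2 * (x ^ (s + g + 1) * Real.exp (-((g / x) ^ g))) := by
  have ht : Tendsto (fun x : ℝ => 2 * |s + g + 1| * x ^ g) (𝓝[>] 0) (𝓝 0) := by
    have h := ((Real.continuousAt_rpow_const 0 g (Or.inr hg.le)).tendsto.const_mul
      (2 * |s + g + 1|))
    rw [Real.zero_rpow hg.ne', mul_zero] at h
    exact h.mono_left nhdsWithin_le_nhds
  have hpos : (0 : ℝ) < g ^ (g + 1) := by positivity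
  filter_upwards [self_mem_nhdsWithin, ht.eventually (gt_mem_nhds hpos)] with x (hx : 0 < x) hsmall
  have hrec := integral_rpow_mul_exp_neg_div_rpow_recursion hg s hx
  have hle := integral_rpow_add_mul_exp_neg_div_rpow_le hg s x
  have h0 := integral_rpow_mul_exp_neg_div_rpow_nonneg g s x
  have h1 := integral_rpow_mul_exp_neg_div_rpow_nonneg g (s + g) x
  set I := ∫ y in Set.Ioc 0 x, y ^ s * Real.exp (-((g / y) ^ g))
  set K := ∫ y in Set.Ioc 0 x, y ^ (s + g) * Real.exp (-((g / y) ^ g))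
  have h2 := mul_le_mul_of_nonneg_right (neg_abs_le (s + g + 1)) h1
  have h3 := mul_le_mul_of_nonneg_left hle (abs_nonneg (s + g + 1))
  have h4 := mul_le_mul_of_nonneg_right hsmall.le h0
  nlinarith

/-- Lemma 4.2.  Fix `γ ∈ (1,2]`, `b(x) := ((γ−1)/x)^{γ−1}`, let
`a ∈ ℝ` be such that `−(a+1)/(γ−1)` is not a positive integer, and set
`J_{a'}(x) := ∫_0^x y^{a'} e^{−b(y)} dy` (a convergent integral) and the coefficients
`c_q(a,γ)` as in the statement.  Then for every `p ≥ 1` and `x > 0` the recursion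
for `J_a(x)` holds, and as `x → 0+`,
`x^{−a−γ} e^{b(x)} J_a(x) = Σ_{q<p} c_q x^{q(γ−1)} + O(x^{p(γ−1)})`. -/
theorem stmt10 (γ : ℝ) (hγ1 : 1 < γ) (hγ2 : γ ≤ 2) (a : ℝ)
    (ha : ∀ k : ℕ, 1 ≤ k → -(a + 1) / (γ - 1) ≠ (k : ℝ))
    (J : ℝ → ℝ → ℝ)
    (hJ : ∀ a' x : ℝ,
      J a' x = ∫ y in Set.Ioc (0:ℝ) x, y ^ a' * Real.exp (-(((γ - 1)/y) ^ (γ - 1))))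
    (c : ℕ → ℝ)
    (hc0 : c 0 = (γ - 1) ^ (-γ))
    (hc : ∀ q : ℕ, 1 ≤ q →
      c q = (-1 : ℝ) ^ q * (γ - 1) ^ (-(((q:ℝ) + 1) * γ))
        * ∏ k ∈ Finset.Icc 1 q, (a + 1 + (k:ℝ) * (γ - 1))) :
    (∀ a' x : ℝ, 0 < x →
      IntegrableOn (fun y => y ^ a' * Real.exp (-(((γ - 1)/y) ^ (γ - 1)))) (Set.Ioc 0 x)) ∧
    (∀ p : ℕ, 1 ≤ p → ∀ x : ℝ, 0 < x →
      J a x = (∑ q ∈ Finset.range p,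
          c q * x ^ (a + γ + (q:ℝ) * (γ - 1)) * Real.exp (-(((γ - 1)/x) ^ (γ - 1))))
        + (γ - 1) ^ γ * c p * J (a + (p:ℝ) * (γ - 1)) x) ∧
    (∀ p : ℕ, 1 ≤ p →
      (fun x => x ^ (-a - γ) * Real.exp (((γ - 1)/x) ^ (γ - 1)) * J a x
          - ∑ q ∈ Finset.range p, c q * x ^ ((q:ℝ) * (γ - 1)))
        =O[𝓝[>] (0:ℝ)] fun x => x ^ ((p:ℝ) * (γ - 1))) := by
  obtain ⟨g, rfl⟩ : ∃ g, γ = g + 1 := ⟨γ - 1, by ring⟩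
  simp only [add_sub_cancel_right] at *
  have hg : 0 < g := by linarith
  have hG : (0 : ℝ) < g ^ (g + 1) := by positivity
  have hc0' : g ^ (g + 1) * c 0 = 1 := by
    rw [hc0, ← Real.rpow_add hg]
    simp
  have hcs : ∀ q : ℕ, g ^ (g + 1) * c (q + 1) = -(c q * (a + 1 + ((q : ℝ) + 1) * g)) := by
    intro q
    have hexp : g ^ (g + 1) * g ^ (-((((q + 1 : ℕ) : ℝ) + 1) * (g + 1)))
        = g ^ (-(((q : ℝ) + 1) * (g + 1))) := by
      rw [← Real.rpow_add hg]
      congr 1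
      push_cast
      ring
    have hcq : c q = (-1 : ℝ) ^ q * g ^ (-(((q : ℝ) + 1) * (g + 1)))
        * ∏ k ∈ Finset.Icc 1 q, (a + 1 + (k : ℝ) * g) := by
      rcases Nat.eq_zero_or_pos q with rfl | hq
      · simp [hc0]
      · exact hc q hq
    rw [hc (q + 1) (by omega), hcq, ← hexp, Finset.prod_Icc_succ_top (by omega), pow_succ]
    push_cast
    ring
  have hJrec : ∀ s x : ℝ, 0 < x → (s + g + 1) * J (s + g) x + g ^ (g + 1) * J s x
      = x ^ (s + g + 1) * Real.exp (-((g / x) ^ g)) := by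
    intro s x hx
    rw [hJ, hJ]
    exact integral_rpow_mul_exp_neg_div_rpow_recursion hg s hx
  have hexpand : ∀ p : ℕ, ∀ x : ℝ, 0 < x →
      J a x = (∑ q ∈ Finset.range p,
          c q * x ^ (a + (g + 1) + (q : ℝ) * g) * Real.exp (-((g / x) ^ g)))
        + g ^ (g + 1) * c p * J (a + (p : ℝ) * g) x := by
    intro p x hx
    induction p with
    | zero => simp [hc0']
    | succ p ih =>
      rw [ih, Finset.sum_range_succ, hcs p]
      have h := hJrec (a + p * g) x hx
      have e1 : a + (p : ℝ) * g + g = a + ((p + 1 : ℕ) : ℝ) * g := by push_cast; ring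
      have e2 : a + (g + 1) + (p : ℝ) * g = a + (p : ℝ) * g + g + 1 := by ring
      rw [e2, mul_assoc (c p), ← h, e1]
      push_cast
      ring
  refine ⟨fun s x _ => integrableOn_rpow_mul_exp_neg_div_rpow hg s x,
    fun p _ x hx => hexpand p x hx, fun p _ => ?_⟩
  refine IsBigO.of_bound (2 * |c p|) ?_
  filter_upwards [self_mem_nhdsWithin,
    eventually_integral_rpow_mul_exp_neg_div_rpow_le hg (a + p * g)] with x (hx : 0 < x) hle
  have h0 := integral_rpow_mul_exp_neg_div_rpow_nonneg g (a + p * g) x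
  rw [← hJ] at hle h0
  have hE : Real.exp ((g / x) ^ g) * Real.exp (-((g / x) ^ g)) = 1 := by
    rw [← Real.exp_add, add_neg_cancel, Real.exp_zero]
  have hmul : ∀ r : ℝ, x ^ (-a - (g + 1)) * x ^ (a + (g + 1) + r) = x ^ r := by
    intro r
    rw [← Real.rpow_add hx]
    congr 1
    ring
  have hrem : x ^ (-a - (g + 1)) * Real.exp ((g / x) ^ g) * J a x
      - ∑ q ∈ Finset.range p, c q * x ^ ((q : ℝ) * g)
      = c p * (x ^ (-a - (g + 1)) * Real.exp ((g / x) ^ g)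
          * (g ^ (g + 1) * J (a + p * g) x)) := by
    have hsum : x ^ (-a - (g + 1)) * Real.exp ((g / x) ^ g) * (∑ q ∈ Finset.range p,
          c q * x ^ (a + (g + 1) + (q : ℝ) * g) * Real.exp (-((g / x) ^ g)))
        = ∑ q ∈ Finset.range p, c q * x ^ ((q : ℝ) * g) := by
      rw [Finset.mul_sum]
      refine Finset.sum_congr rfl fun q _ => ?_
      rw [← hmul ((q : ℝ) * g)]
      linear_combination (c q * x ^ (-a - (g + 1)) * x ^ (a + (g + 1) + (q : ℝ) * g)) * hE
    rw [hexpand p x hx, mul_add, hsum]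
    ring
  have hW : 0 ≤ x ^ (-a - (g + 1)) * Real.exp ((g / x) ^ g) := by positivity
  have hbd : x ^ (-a - (g + 1)) * Real.exp ((g / x) ^ g) * (g ^ (g + 1) * J (a + p * g) x)
      ≤ 2 * x ^ ((p : ℝ) * g) := by
    refine (mul_le_mul_of_nonneg_left hle hW).trans_eq ?_
    rw [← hmul ((p : ℝ) * g), show a + (p : ℝ) * g + g + 1 = a + (g + 1) + (p : ℝ) * g by ring]
    linear_combination (2 * x ^ (-a - (g + 1)) * x ^ (a + (g + 1) + (p : ℝ) * g)) * hE
  rw [hrem, Real.norm_eq_abs, Real.norm_eq_abs, abs_mul,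
    abs_of_nonneg (mul_nonneg hW (mul_nonneg hG.le h0)),
    abs_of_nonneg (Real.rpow_nonneg hx.le _)]
  nlinarith [mul_le_mul_of_nonneg_left hbd (abs_nonneg (c p))]
end

section
/- There exists a real sequence (A_n)_{n≥1} such that exp(G(y)) = 1 + Σ_{n≥1} A_n y^n for every y ∈ [−1,1], the series being absolutely convergent, and 1 + Σ_{n≥1} |A_n| < e^{γ−1}. -/
/-- On `s`, the function `f` is the sum of a power series whose coefficients have absolute values
summing to at most `M`. -/
def HasL1Expansion (f : ℝ → ℝ) (s : Set ℝ) (M : ℝ) : Prop :=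
  ∃ a : ℕ → ℝ, Summable (fun n => |a n|) ∧ ∑' n, |a n| ≤ M ∧
    ∀ y ∈ s, HasSum (fun n => a n * y ^ n) (f y)

lemma summable_abs_mul_pow {a : ℕ → ℝ} (ha : Summable (fun n => |a n|)) {y : ℝ} (hy : |y| ≤ 1) :
    Summable (fun n => |a n * y ^ n|) := by
  refine ha.of_nonneg_of_le (fun n => abs_nonneg _) (fun n => ?_)
  rw [abs_mul, abs_pow]
  exact mul_le_of_le_one_right (abs_nonneg _) (pow_le_one₀ (abs_nonneg _) hy)

lemma abs_tsum_le_tsum_abs {a : ℕ → ℝ} (ha : Summable (fun n => |a n|)) :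
    |∑' n, a n| ≤ ∑' n, |a n| :=
  norm_tsum_le_tsum_norm (f := a) ha

namespace HasL1Expansion

variable {f g : ℝ → ℝ} {s : Set ℝ} {M N : ℝ}

lemma congr (hf : HasL1Expansion f s M) (h : ∀ y ∈ s, g y = f y) : HasL1Expansion g s M := by
  obtain ⟨a, ha, hM, hs⟩ := hf
  exact ⟨a, ha, hM, fun y hy => h y hy ▸ hs y hy⟩

lemma bound_nonneg (hf : HasL1Expansion f s M) : 0 ≤ M := by
  obtain ⟨a, -, hM, -⟩ := hf
  exact (tsum_nonneg fun n => abs_nonneg (a n)).trans hM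

lemma abs_apply_le (hf : HasL1Expansion f s M) {y : ℝ} (hys : y ∈ s) (hy : |y| ≤ 1) : |f y| ≤ M := by
  obtain ⟨a, ha, hM, hs⟩ := hf
  have hsum := summable_abs_mul_pow ha hy
  rw [← (hs y hys).tsum_eq]
  refine (abs_tsum_le_tsum_abs hsum).trans (le_trans ?_ hM)
  refine hsum.tsum_le_tsum (fun n => ?_) ha
  rw [abs_mul, abs_pow]
  exact mul_le_of_le_one_right (abs_nonneg _) (pow_le_one₀ (abs_nonneg _) hy)

lemma const (c : ℝ) (s : Set ℝ) : HasL1Expansion (fun _ => c) s |c| := by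
  have h (n : ℕ) (hn : n ≠ 0) : |if n = 0 then c else 0| = 0 := by simp [hn]
  refine ⟨fun n => if n = 0 then c else 0, (hasSum_single 0 h).summable, ?_, fun y _ => ?_⟩
  · simp [(hasSum_single 0 h).tsum_eq]
  · have h' : HasSum (fun n => (if n = 0 then c else 0) * y ^ n)
        ((if 0 = 0 then c else 0) * y ^ 0) := hasSum_single 0 fun n hn => by simp [hn]
    rwa [if_pos rfl, pow_zero, mul_one] at h'

lemma id (s : Set ℝ) : HasL1Expansion (fun y => y) s 1 := by
  have h (n : ℕ) (hn : n ≠ 1) : |if n = 1 then (1 : ℝ) else 0| = 0 := by simp [hn]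
  refine ⟨fun n => if n = 1 then 1 else 0, (hasSum_single 1 h).summable, ?_, fun y _ => ?_⟩
  · simp [(hasSum_single 1 h).tsum_eq]
  · have h' : HasSum (fun n => (if n = 1 then 1 else 0) * y ^ n)
        ((if 1 = 1 then 1 else 0) * y ^ 1) := hasSum_single 1 fun n hn => by simp [hn]
    rwa [if_pos rfl, pow_one, one_mul] at h'

lemma mul (hf : HasL1Expansion f s M) (hg : HasL1Expansion g s N) (hs : ∀ y ∈ s, |y| ≤ 1) :
    HasL1Expansion (fun y => f y * g y) s (M * N) := by
  have hM0 := hf.bound_nonneg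
  obtain ⟨a, ha, hM, hfa⟩ := hf
  obtain ⟨b, hb, hN, hgb⟩ := hg
  have ha' : Summable (fun n => ‖|a n|‖) := by simpa using ha
  have hb' : Summable (fun n => ‖|b n|‖) := by simpa using hb
  have habs : Summable (fun n => ∑ p ∈ Finset.HasAntidiagonal.antidiagonal n, |a p.1| * |b p.2|) :=
    (summable_norm_sum_mul_antidiagonal_of_summable_norm ha' hb').of_norm
  have hle (n : ℕ) : |∑ p ∈ Finset.HasAntidiagonal.antidiagonal n, a p.1 * b p.2| ≤
      ∑ p ∈ Finset.HasAntidiagonal.antidiagonal n, |a p.1| * |b p.2| := by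
    simpa only [abs_mul] using
      Finset.abs_sum_le_sum_abs (fun p : ℕ × ℕ => a p.1 * b p.2) (Finset.HasAntidiagonal.antidiagonal n)
  have hsum := habs.of_nonneg_of_le (fun n => abs_nonneg _) hle
  refine ⟨fun n => ∑ p ∈ Finset.HasAntidiagonal.antidiagonal n, a p.1 * b p.2, hsum, ?_,
    fun y hy => ?_⟩
  · refine (hsum.tsum_le_tsum hle habs).trans ?_
    rw [← tsum_mul_tsum_eq_tsum_sum_antidiagonal_of_summable_norm ha' hb']
    exact mul_le_mul hM hN (tsum_nonneg fun n => abs_nonneg _) hM0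
  · have hay : Summable (fun n => ‖a n * y ^ n‖) := summable_abs_mul_pow ha (hs y hy)
    have hby : Summable (fun n => ‖b n * y ^ n‖) := summable_abs_mul_pow hb (hs y hy)
    beta_reduce
    rw [← (hfa y hy).tsum_eq, ← (hgb y hy).tsum_eq,
      tsum_mul_tsum_eq_tsum_sum_antidiagonal_of_summable_norm hay hby]
    have hcauchy := (summable_norm_sum_mul_antidiagonal_of_summable_norm hay hby).of_norm.hasSum
    convert! hcauchy using 2 with n
    rw [Finset.sum_mul]
    refine Finset.sum_congr rfl fun p hp => ?_
    rw [← Finset.HasAntidiagonal.mem_antidiagonal.mp hp, pow_add]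
    ring

lemma pow (hf : HasL1Expansion f s M) (hs : ∀ y ∈ s, |y| ≤ 1) (n : ℕ) :
    HasL1Expansion (fun y => f y ^ n) s (M ^ n) := by
  induction n with
  | zero => simpa using const 1 s
  | succ n ih => simpa only [pow_succ] using ih.mul hf hs

lemma tsum {F : ℕ → ℝ → ℝ} {B : ℕ → ℝ} (hF : ∀ n, HasL1Expansion (F n) s (B n))
    (hB : Summable B) (hs : ∀ y ∈ s, |y| ≤ 1) :
    HasL1Expansion (fun y => ∑' n, F n y) s (∑' n, B n) := by
  choose a ha hM hFa using hF
  have hrow : Summable (fun n => ∑' k, |a n k|) :=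
    hB.of_nonneg_of_le (fun n => tsum_nonneg fun k => abs_nonneg _) hM
  have hprod : Summable (fun p : ℕ × ℕ => |a p.1 p.2|) :=
    (summable_prod_of_nonneg fun p => abs_nonneg _).2 ⟨ha, hrow⟩
  have hswap : Summable (fun p : ℕ × ℕ => |a p.2 p.1|) := hprod.prod_symm
  have hle (k : ℕ) : |∑' n, a n k| ≤ ∑' n, |a n k| :=
    abs_tsum_le_tsum_abs (hswap.prod_factor k)
  have hsum := hswap.prod.of_nonneg_of_le (fun k => abs_nonneg _) hle
  refine ⟨fun k => ∑' n, a n k, hsum, ?_, fun y hy => ?_⟩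
  · calc ∑' k, |∑' n, a n k| ≤ ∑' k, ∑' n, |a n k| := hsum.tsum_le_tsum hle hswap.prod
      _ = ∑' n, ∑' k, |a n k| := hprod.tsum_comm
      _ ≤ ∑' n, B n := hrow.tsum_le_tsum hM hB
  · have hprody : Summable (fun p : ℕ × ℕ => a p.1 p.2 * y ^ p.2) := by
      refine Summable.of_norm_bounded hprod fun p => ?_
      rw [Real.norm_eq_abs, abs_mul, abs_pow]
      exact mul_le_of_le_one_right (abs_nonneg _) (pow_le_one₀ (abs_nonneg _) (hs y hy))
    have hcol : Summable (fun k => ∑' n, a n k * y ^ k) := hprody.prod_symm.prod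
    have hval : ∑' k, ∑' n, a n k * y ^ k = ∑' n, F n y :=
      hprody.tsum_comm.trans (tsum_congr fun n => (hFa n y hy).tsum_eq)
    beta_reduce
    rw [← hval]
    simpa only [tsum_mul_right] using hcol.hasSum

lemma one_sub_inv (hf : HasL1Expansion f s M) (hM : M < 1) (hs : ∀ y ∈ s, |y| ≤ 1) :
    HasL1Expansion (fun y => (1 - f y)⁻¹) s (1 - M)⁻¹ := by
  have h := tsum (hf.pow hs) (summable_geometric_of_lt_one hf.bound_nonneg hM) hs
  rw [tsum_geometric_of_lt_one hf.bound_nonneg hM] at h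
  exact h.congr fun y hy =>
    (tsum_geometric_of_abs_lt_one ((hf.abs_apply_le hy (hs y hy)).trans_lt hM)).symm

/-- If `f` has an expansion with bound `M`, then `(exp (y f) - 1) / y` has one with bound
`exp M - 1`. -/
lemma exp_id_mul (hf : HasL1Expansion f s M) (hs : ∀ y ∈ s, |y| ≤ 1) :
    ∃ g, HasL1Expansion g s (Real.exp M - 1) ∧ ∀ y, Real.exp (y * f y) = 1 + y * g y := by
  have hexp (x : ℝ) : HasSum (fun n : ℕ => x ^ (n + 1) / ((n + 1).factorial : ℝ))
      (Real.exp x - 1) := by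
    have h := NormedSpace.expSeries_div_hasSum_exp x
    rw [← Real.exp_eq_exp_ℝ] at h
    simpa using (hasSum_nat_add_iff' 1).2 h
  have hterm (n : ℕ) : HasL1Expansion
      (fun y => y ^ n * f y ^ (n + 1) * ((n + 1).factorial : ℝ)⁻¹) s
      (M ^ (n + 1) / ((n + 1).factorial : ℝ)) := by
    have h := (((id s).pow hs n).mul (hf.pow hs (n + 1)) hs).mul
      (const ((n + 1).factorial : ℝ)⁻¹ s) hs
    rwa [abs_of_nonneg (by positivity), one_pow, one_mul, ← div_eq_mul_inv] at h
  have h := tsum hterm (hexp M).summable hs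
  rw [(hexp M).tsum_eq] at h
  refine ⟨_, h, fun y => ?_⟩
  rw [← tsum_mul_left, ← sub_eq_iff_eq_add', ← (hexp (y * f y)).tsum_eq]
  refine tsum_congr fun n => ?_
  rw [mul_pow, pow_succ]
  ring

end HasL1Expansion

lemma HasL1Expansion.integral {f : ℝ → ℝ} {M : ℝ} (hf : HasL1Expansion f (Set.Ioo (-1) 1) M) :
    ∃ g, HasL1Expansion g (Set.Icc (-1) 1) ((M + |f 0|) / 2) ∧
      ∀ y ∈ Set.Icc (-1 : ℝ) 1, ∫ u in (0 : ℝ)..y, f u = y * g y := by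
  obtain ⟨a, ha, hM, hfa⟩ := hf
  have hf0 : f 0 = a 0 := by
    rw [← (hfa 0 (by norm_num)).tsum_eq, tsum_eq_single 0 fun n hn => by simp [hn]]
    simp
  have hle (n : ℕ) : |a n / (n + 1)| ≤ |a n| := by
    rw [abs_div, abs_of_pos (by positivity : (0 : ℝ) < n + 1)]
    exact div_le_self (abs_nonneg _) (by linarith [n.cast_nonneg (α := ℝ)])
  have hsum : Summable (fun n : ℕ => |a n / (n + 1)|) :=
    ha.of_nonneg_of_le (fun n => abs_nonneg _) hle
  have hsplit := ha.tsum_eq_zero_add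
  have htail : ∑' n : ℕ, |a (n + 1) / ((n + 1 : ℕ) + 1)| ≤ ∑' n : ℕ, |a (n + 1)| / 2 := by
    refine ((summable_nat_add_iff 1).2 hsum).tsum_le_tsum (fun n => ?_)
      (((summable_nat_add_iff 1).2 ha).div_const 2)
    rw [abs_div, abs_of_pos (by positivity : (0 : ℝ) < (n + 1 : ℕ) + 1)]
    gcongr
    push_cast
    linarith [n.cast_nonneg (α := ℝ)]
  rw [tsum_div_const] at htail
  refine ⟨fun y => ∑' n : ℕ, a n / (n + 1) * y ^ n, ⟨fun n => a n / (n + 1), hsum, ?_, ?_⟩, ?_⟩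
  · rw [hsum.tsum_eq_zero_add, hf0]
    simp only [Nat.cast_zero, zero_add, div_one]
    linarith
  · intro y hy
    exact (summable_abs_mul_pow hsum (abs_le.2 hy)).of_abs.hasSum
  · intro y hy
    have hy1 : |y| ≤ 1 := abs_le.2 hy
    have habs {u : ℝ} (hu : u ∈ Set.uIoc 0 y) : |u| ≤ |y| := by
      simpa using Set.abs_sub_left_of_mem_uIcc (Set.uIoc_subset_uIcc hu)
    have hint : HasSum (fun n => ∫ u in (0 : ℝ)..y, a n * u ^ n) (∫ u in (0 : ℝ)..y, f u) := by
      refine intervalIntegral.hasSum_integral_of_dominated_convergence (fun n _ => |a n|)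
        (fun n => (by fun_prop : Continuous fun u : ℝ => a n * u ^ n).aestronglyMeasurable)
        (fun n => .of_forall fun u hu => ?_) (.of_forall fun u _ => ha) (by simp) ?_
      · rw [Real.norm_eq_abs, abs_mul, abs_pow]
        exact mul_le_of_le_one_right (abs_nonneg _)
          (pow_le_one₀ (abs_nonneg _) ((habs hu).trans hy1))
      · have hne : ∀ᵐ u : ℝ, u ≠ 1 ∧ u ≠ -1 :=
          (MeasureTheory.Measure.ae_ne _ _).and (MeasureTheory.Measure.ae_ne _ _)
        filter_upwards [hne] with u hu hmem
        have h := abs_le.1 ((habs hmem).trans hy1)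
        exact hfa u ⟨lt_of_le_of_ne h.1 hu.2.symm, lt_of_le_of_ne h.2 hu.1⟩
    rw [← hint.tsum_eq, ← tsum_mul_left]
    refine tsum_congr fun n => ?_
    rw [intervalIntegral.integral_const_mul, integral_pow]
    simp
    ring

lemma succ_mul_choose_succ (r : ℝ) (n : ℕ) :
    (n + 1) * Ring.choose r (n + 1) = (r - n) * Ring.choose r n := by
  have h (k : ℕ) := Ring.descPochhammer_eq_factorial_smul_choose r k
  have h1 := h (n + 1)
  rw [descPochhammer_succ_right, Polynomial.smeval_mul, h n] at h1
  simp [Polynomial.smeval_sub, Polynomial.smeval_natCast, Nat.factorial_succ] at h1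
  have hn : (n.factorial : ℝ) ≠ 0 := by positivity
  apply mul_left_cancel₀ hn
  linarith

lemma neg_one_pow_mul_choose_nonneg {r : ℝ} (h1 : 1 ≤ r) (h2 : r ≤ 2) (n : ℕ) :
    0 ≤ (-1) ^ n * Ring.choose r (n + 2) := by
  induction n with
  | zero =>
    have h := succ_mul_choose_succ r 1
    rw [Ring.choose_one_right] at h
    norm_num at h ⊢
    nlinarith
  | succ n ih =>
    have h := succ_mul_choose_succ r (n + 2)
    have hn : (0 : ℝ) < (n + 2 : ℕ) + 1 := by positivity
    have heq : (-1) ^ (n + 1) * Ring.choose r (n + 1 + 2) =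
        (((n + 2 : ℕ) - r) / ((n + 2 : ℕ) + 1)) * ((-1) ^ n * Ring.choose r (n + 2)) := by
      rw [show n + 1 + 2 = n + 2 + 1 by ring, div_mul_eq_mul_div, eq_div_iff hn.ne', pow_succ]
      linear_combination (-(-1) ^ n) * h
    rw [heq]
    refine mul_nonneg (div_nonneg ?_ hn.le) ih
    push_cast
    linarith [n.cast_nonneg (α := ℝ)]

lemma hasSum_one_add_rpow (r : ℝ) {x : ℝ} (hx : |x| < 1) :
    HasSum (fun n => Ring.choose r n * x ^ n) ((1 + x) ^ r) := by
  have h := (Real.one_add_rpow_hasFPowerSeriesOnBall_zero (a := r)).hasSum (y := x)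
    (by simpa [enorm_eq_nnnorm, ← NNReal.coe_lt_coe] using hx)
  simpa [binomialSeries, mul_comm] using h

lemma hasSum_one_add_rpow_tail (r : ℝ) {x : ℝ} (hx : |x| < 1) :
    HasSum (fun n => Ring.choose r (n + 2) * x ^ (n + 2)) ((1 + x) ^ r - 1 - r * x) := by
  have h := (hasSum_nat_add_iff' 2).2 (hasSum_one_add_rpow r hx)
  simpa [Finset.sum_range_succ, sub_sub] using h

lemma hasL1Expansion_rpow_remainder {r : ℝ} (h1 : 1 ≤ r) (h2 : r ≤ 2) :
    ∃ β : ℝ → ℝ, HasL1Expansion β (Set.Ioo (-1) 1) (r - 1) ∧ β 0 = r * (r - 1) / 2 ∧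
      ∀ x ∈ Set.Ioo (-1 : ℝ) 1, (1 + x) ^ r - 1 - r * x = x ^ 2 * β x := by
  set c : ℕ → ℝ := fun n => Ring.choose r (n + 2) with hc
  have hcabs (n : ℕ) : |c n| = (-1) ^ n * c n := by
    rw [← abs_of_nonneg (neg_one_pow_mul_choose_nonneg h1 h2 n)]
    simp [abs_mul, hc]
  have hpart (N : ℕ) : ∑ n ∈ Finset.range N, |c n| ≤ r - 1 := by
    have hlim : Filter.Tendsto (fun t : ℝ => ∑ n ∈ Finset.range N, |c n| * t ^ (n + 2))
        (nhdsWithin 1 (Set.Ioo 0 1)) (nhds (∑ n ∈ Finset.range N, |c n|)) := by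
      have : Continuous fun t : ℝ => ∑ n ∈ Finset.range N, |c n| * t ^ (n + 2) := by fun_prop
      simpa using (this.tendsto 1).mono_left nhdsWithin_le_nhds
    have hlim2 : Filter.Tendsto (fun t : ℝ => (1 + -t) ^ r - 1 - r * -t)
        (nhdsWithin 1 (Set.Ioo 0 1)) (nhds (r - 1)) := by
      have : Continuous fun t : ℝ => (1 + -t) ^ r - 1 - r * -t := by
        have := Real.continuous_rpow_const (q := r) (by linarith)
        fun_prop
      have h := (this.tendsto 1).mono_left (nhdsWithin_le_nhds (s := Set.Ioo 0 1))
      convert! h using 2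
      rw [show (1 : ℝ) + -1 = 0 by ring, Real.zero_rpow (by linarith)]
      ring
    have : (nhdsWithin (1 : ℝ) (Set.Ioo 0 1)).NeBot := by
      rw [nhdsWithin_Ioo_eq_nhdsLT one_pos]
      infer_instance
    refine le_of_tendsto_of_tendsto hlim hlim2 ?_
    filter_upwards [self_mem_nhdsWithin] with t ht
    have hs : HasSum (fun n => |c n| * t ^ (n + 2)) ((1 + -t) ^ r - 1 - r * -t) := by
      convert! hasSum_one_add_rpow_tail r (x := -t)
        (by rw [abs_neg, abs_of_pos ht.1]; exact ht.2) using 2 with n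
      rw [hcabs, neg_pow t, pow_add (-1 : ℝ) n 2]
      ring
    exact sum_le_hasSum _ (fun n _ => mul_nonneg (abs_nonneg _) (pow_nonneg ht.1.le _)) hs
  have hsum : Summable (fun n => |c n|) :=
    summable_of_sum_range_le (fun n => abs_nonneg _) hpart
  refine ⟨fun x => ∑' n, c n * x ^ n, ⟨c, hsum,
    Real.tsum_le_of_sum_range_le (fun n => abs_nonneg _) hpart, fun x hx => ?_⟩, ?_, ?_⟩
  · exact (summable_abs_mul_pow hsum (abs_lt.2 hx).le).of_abs.hasSum
  · have h := succ_mul_choose_succ r 1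
    rw [Ring.choose_one_right] at h
    norm_num at h
    simp only
    rw [tsum_eq_single 0 fun n hn => by simp [hn]]
    simp only [hc, zero_add, pow_zero, mul_one]
    linarith
  · intro x hx
    rw [← (hasSum_one_add_rpow_tail r (abs_lt.2 hx)).tsum_eq, ← tsum_mul_left]
    refine tsum_congr fun n => ?_
    simp only [hc]
    ring

lemma hasL1Expansion_integrand {γ : ℝ} (hγ1 : 1 < γ) (hγ2 : γ ≤ 2) :
    HasL1Expansion (fun u => if u = 0 then (γ - 1) / 2
        else ((1 + u) ^ γ - 1 - γ * u) / (u * ((1 + u) ^ γ - 1)))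
      (Set.Ioo (-1) 1) (γ - 1) := by
  have hs : ∀ y ∈ Set.Ioo (-1 : ℝ) 1, |y| ≤ 1 := fun y hy => (abs_lt.2 hy).le
  obtain ⟨β, hβ, hβ0, hβeq⟩ := hasL1Expansion_rpow_remainder hγ1.le hγ2
  have hγ : 0 < γ := by linarith
  have hβγ := hβ.mul (HasL1Expansion.const (-γ⁻¹) _) hs
  rw [abs_neg, abs_of_pos (inv_pos.2 hγ)] at hβγ
  have hlt : 1 * ((γ - 1) * γ⁻¹) < 1 := by
    rw [one_mul, ← div_eq_mul_inv, div_lt_one hγ]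
    linarith
  have hid := (HasL1Expansion.id (Set.Ioo (-1) 1)).mul hβγ hs
  have hden := hid.one_sub_inv hlt hs
  have h := (hβ.mul (HasL1Expansion.const γ⁻¹ _) hs).mul hden hs
  have hbound : (γ - 1) * |γ⁻¹| * (1 - 1 * ((γ - 1) * γ⁻¹))⁻¹ = γ - 1 := by
    rw [abs_of_pos (inv_pos.2 hγ), show 1 - 1 * ((γ - 1) * γ⁻¹) = γ⁻¹ by field_simp; ring]
    field_simp
  rw [hbound] at h
  refine h.congr fun u hu => ?_
  have hpos : 1 - u * (β u * -γ⁻¹) ≠ 0 := by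
    have := (abs_le.1 (hid.abs_apply_le hu (hs u hu))).2
    linarith
  split_ifs with hu0
  · subst hu0
    rw [hβ0]
    field_simp
    simp
  · have hrpow : (1 + u) ^ γ - 1 = γ * u * (1 - u * (β u * -γ⁻¹)) := by
      field_simp
      linear_combination hβeq u hu
    rw [hβeq u hu, hrpow]
    field_simp

/-- Fix `γ ∈ (1,2]` and set
`G(y) := ∫_0^y (du/u) ((1+u)^γ − 1 − γu)/((1+u)^γ − 1)` (integrand extended continuously
at `0` by `(γ−1)/2`).  There is a real sequence `(A_n)_{n≥1}` such that
`exp(G(y)) = 1 + Σ_{n≥1} A_n y^n` for all `y ∈ [−1,1]`, the series converging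
absolutely, and `1 + Σ_{n≥1} |A_n| < e^{γ−1}`. -/
theorem stmt12 (γ : ℝ) (hγ1 : 1 < γ) (hγ2 : γ ≤ 2)
    (G : ℝ → ℝ)
    (hG : ∀ y : ℝ, G y = ∫ u in (0:ℝ)..y,
      (if u = 0 then (γ - 1)/2
        else ((1 + u) ^ γ - 1 - γ * u) / (u * ((1 + u) ^ γ - 1)))) :
    ∃ A : ℕ → ℝ,
      (∀ y ∈ Set.Icc (-1:ℝ) 1, Summable (fun n : ℕ => |A n * y ^ (n + 1)|)) ∧
      (∀ y ∈ Set.Icc (-1:ℝ) 1, Real.exp (G y) = 1 + ∑' n : ℕ, A n * y ^ (n + 1)) ∧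
      1 + (∑' n : ℕ, |A n|) < Real.exp (γ - 1) := by
  have hs : ∀ y ∈ Set.Icc (-1 : ℝ) 1, |y| ≤ 1 := fun y hy => abs_le.2 hy
  obtain ⟨H, hH, hGH⟩ := (hasL1Expansion_integrand hγ1 hγ2).integral
  obtain ⟨K, ⟨A, hA, hAle, hKA⟩, hexp⟩ := hH.exp_id_mul hs
  refine ⟨A, fun y hy => ?_, fun y hy => ?_, ?_⟩
  · refine (summable_abs_mul_pow hA (hs y hy)).of_nonneg_of_le (fun n => abs_nonneg _) fun n => ?_
    rw [pow_succ, ← mul_assoc, abs_mul _ y]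
    exact mul_le_of_le_one_right (abs_nonneg _) (hs y hy)
  · rw [hG, hGH y hy, hexp, ← (hKA y hy).tsum_eq, ← tsum_mul_left]
    congr 1
    exact tsum_congr fun n => by ring
  · have hlt : (γ - 1 + |(γ - 1) / 2|) / 2 < γ - 1 := by
      rw [abs_of_pos (by linarith)]
      linarith
    simp only [if_true] at hAle
    linarith [Real.exp_lt_exp.2 hlt]
end

section
/- Set φ(y) := w(y) − 1 and y₀ := ∫_1^∞ du/((u+1)^γ − 1). Then for every y ∈ [y₀,∞): e^{γy − C₀} φ(y) = exp(G(φ(y))). Moreover there exist a real sequence (β_n)_{n≥1} and y₁ ∈ [y₀,∞) such that Σ_{n≥1} |β_n| e^{−γ n y₁} < ∞ and φ(y) = Σ_{n≥1} β_n e^{−γ n y} for every y ∈ [y₁,∞); in addition β₁ = e^{C₀} and β₂ = ((γ−1)/2) e^{2C₀}. -/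
open Filter Topology

/-- The primitive of a real function analytic at `0` is analytic at `0`. -/
theorem AnalyticAt.intervalIntegral_zero {f : ℝ → ℝ} (hf : AnalyticAt ℝ f 0) :
    AnalyticAt ℝ (fun y => ∫ u in (0 : ℝ)..y, f u) 0 := by
  obtain ⟨p, hp⟩ := hf
  have hev := hasFPowerSeriesAt_iff.1 hp
  simp only [zero_add, smul_eq_mul] at hev
  obtain ⟨r, hr, h⟩ := Metric.eventually_nhds_iff.1 hev
  have hsum : Summable fun n => (r / 2) ^ n * |p.coeff n| := by
    have := (h (y := r / 2) (by simp [abs_of_pos hr]; linarith)).summable.abs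
    simpa only [smul_eq_mul, abs_mul, abs_pow, abs_of_pos (half_pos hr)] using this
  have hseries : HasFPowerSeriesAt (fun y => ∫ u in (0 : ℝ)..y, f u)
      (.ofScalars ℝ fun n => p.coeff (n - 1) / n) 0 := by
    rw [hasFPowerSeriesAt_iff]
    filter_upwards [Metric.ball_mem_nhds (0 : ℝ) (half_pos hr)] with z hz
    simp only [zero_add, smul_eq_mul, FormalMultilinearSeries.coeff_ofScalars]
    rw [← hasSum_nat_add_iff' 1]
    have hmem : ∀ t ∈ Set.uIoc 0 z, |t| < r / 2 := fun t ht => by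
      have := Set.abs_sub_left_of_mem_uIcc (Set.uIoc_subset_uIcc ht)
      simp only [sub_zero, Metric.mem_ball, dist_zero_right, Real.norm_eq_abs] at this hz
      linarith
    have key := intervalIntegral.hasSum_integral_of_dominated_convergence
      (μ := MeasureTheory.volume) (a := 0) (b := z) (F := fun n u => u ^ n * p.coeff n) (f := f)
      (fun n _ => (r / 2) ^ n * |p.coeff n|)
      (fun n => (by fun_prop : Continuous fun u : ℝ => u ^ n * p.coeff n).aestronglyMeasurable)
      (fun n => .of_forall fun t ht => by
        rw [Real.norm_eq_abs, abs_mul, abs_pow]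
        gcongr
        exact (hmem t ht).le)
      (.of_forall fun t _ => hsum) intervalIntegrable_const
      (.of_forall fun t ht => h (by
        rw [dist_zero_right, Real.norm_eq_abs]
        linarith [hmem t ht]))
    convert! key using 2 with n
    · rw [intervalIntegral.integral_mul_const, integral_pow]
      simp
      ring
    · simp
  exact ⟨_, hseries⟩

/-- Lagrange-type inversion of `x ↦ x * exp (-G x)`, with its first two coefficients. -/
theorem exists_hasSum_inverse_mul_exp_neg {G : ℝ → ℝ} {g : ℝ} (hG : AnalyticAt ℝ G 0)
    (hG0 : G 0 = 0) (hg : HasDerivAt G g 0) :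
    ∃ c : ℕ → ℝ, c 1 = 1 ∧ c 2 = g ∧
      ∀ᶠ x in 𝓝 0, HasSum (fun n => c (n + 1) * (x * Real.exp (-G x)) ^ (n + 1)) x := by
  set K : ℝ → ℝ := fun x => x * Real.exp (-G x) with hK
  have hKa : AnalyticAt ℝ K 0 := analyticAt_id.mul hG.neg.rexp
  have hK0 : K 0 = 0 := by simp [hK]
  have hK' : deriv K 0 = 1 := by
    have : HasDerivAt K _ 0 := (hasDerivAt_id (0 : ℝ)).mul hg.neg.exp
    simpa [hG0] using this.deriv
  have hne : deriv K 0 ≠ 0 := by simp [hK']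
  have hs := hKa.hasStrictDerivAt
  set Ψ := hs.localInverse _ _ _ hne with hΨ
  have hleft : ∀ᶠ x in 𝓝 0, Ψ (K x) = x := HasStrictFDerivAt.eventually_left_inverse ..
  have hright : ∀ᶠ z in 𝓝 0, K (Ψ z) = z := by
    have : ∀ᶠ z in 𝓝 (K 0), K (Ψ z) = z := HasStrictFDerivAt.eventually_right_inverse ..
    rwa [hK0] at this
  have hΨ0 : Ψ 0 = 0 := by simpa [hK0] using hleft.self_of_nhds
  have hΨa : AnalyticAt ℝ Ψ 0 := by simpa [hK0] using hKa.analyticAt_localInverse hne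
  have hΨ' : HasDerivAt Ψ 1 0 := by
    have := (hs.to_localInverse hne).hasDerivAt
    simpa [hK0, hK'] using this
  obtain ⟨p, hp⟩ := hΨa
  have hp' := hp.has_fpower_series_dslope_fslope
  have hslope : dslope Ψ 0 =ᶠ[𝓝 0] fun z => Real.exp (G (Ψ z)) := by
    filter_upwards [hright] with z hz
    rcases eq_or_ne z 0 with rfl | h0
    · simp [hΨ0, hG0, hΨ'.deriv]
    · rw [dslope_of_ne _ h0, slope_def_field, hΨ0, sub_zero, sub_zero, div_eq_iff h0]
      nth_rewrite 3 [← hz]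
      simp only [hK, Real.exp_neg]
      field_simp
  have hd : HasDerivAt (fun z => Real.exp (G (Ψ z))) g 0 := by
    have hg' : HasDerivAt G g (Ψ 0) := by rwa [hΨ0]
    simpa [hΨ0, hG0] using (hg'.comp 0 hΨ').exp
  refine ⟨p.coeff, ?_, ?_, ?_⟩
  · exact hp.deriv.symm.trans hΨ'.deriv
  · have h1 : deriv (dslope Ψ 0) 0 = p.fslope.coeff 1 := hp'.deriv
    rw [FormalMultilinearSeries.coeff_fslope] at h1
    rw [← h1, hslope.deriv_eq, hd.deriv]
  · have h1 := hasFPowerSeriesAt_iff.1 hp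
    have hc : Tendsto K (𝓝 0) (𝓝 0) := by simpa [hK0] using hKa.continuousAt.tendsto
    have hp0 : p.coeff 0 = 0 := (hp.coeff_zero 1).trans hΨ0
    filter_upwards [hc.eventually h1, hleft] with x hx hx'
    rw [zero_add, hx', ← hasSum_nat_add_iff' 1] at hx
    simpa [hp0, mul_comm] using hx

/-- The integrand `(1 - γ u / ((1 + u) ^ γ - 1)) / u`, extended continuously to `u = 0`. -/
noncomputable def correctionIntegrand (γ u : ℝ) : ℝ :=
  if u = 0 then (γ - 1) / 2 else ((1 + u) ^ γ - 1 - γ * u) / (u * ((1 + u) ^ γ - 1))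

theorem one_add_rpow_sub_one_ne_zero {γ u : ℝ} (hγ : 0 < γ) (hu : -1 < u) (h0 : u ≠ 0) :
    (1 + u) ^ γ - 1 ≠ 0 := by
  intro h
  have : (1 + u) ^ γ = 1 ^ γ := by rw [Real.one_rpow]; linarith
  exact h0 (by linarith [(Real.rpow_left_inj (by linarith) zero_le_one hγ.ne').1 this])

theorem analyticAt_correctionIntegrand {γ : ℝ} (hγ : 0 < γ) :
    AnalyticAt ℝ (correctionIntegrand γ) 0 := by
  have hp := Real.one_add_rpow_hasFPowerSeriesAt_zero (a := γ)
  set F : ℝ → ℝ := fun x => (1 + x) ^ γ with hF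
  have hq := hp.has_fpower_series_dslope_fslope
  have hF' : deriv F 0 = γ := by
    have := ((hasDerivAt_id (0 : ℝ)).const_add 1).rpow_const (p := γ) (by simp)
    simpa using this.deriv
  have hq0 : dslope F 0 0 = γ := by rw [dslope_same, hF']
  have hq' : deriv (dslope F 0) 0 = γ * (γ - 1) / 2 := by
    have h1 : deriv (dslope F 0) 0 = (binomialSeries ℝ γ).fslope.coeff 1 := hq.deriv
    rw [h1, FormalMultilinearSeries.coeff_fslope, binomialSeries,
      FormalMultilinearSeries.coeff_ofScalars, Ring.choose_eq_smul]
    simp [descPochhammer_succ_right, Polynomial.smeval_mul, Polynomial.smeval_sub]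
    ring
  have hr := hq.has_fpower_series_dslope_fslope
  have hquot := hr.analyticAt.div hq.analyticAt (by rw [hq0]; exact hγ.ne')
  refine hquot.congr ?_
  filter_upwards [lt_mem_nhds (show (-1 : ℝ) < 0 by norm_num)] with u hu
  rcases eq_or_ne u 0 with rfl | h0
  · simp only [Pi.div_apply, dslope_same, hq', hF', correctionIntegrand, if_true]
    field_simp
  · have := one_add_rpow_sub_one_ne_zero hγ hu h0
    simp only [Pi.div_apply, dslope_of_ne _ h0, slope_def_field, hq0, correctionIntegrand, if_neg h0]
    simp only [hF, sub_zero, add_zero, Real.one_rpow]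
    field_simp

theorem continuousOn_correctionIntegrand {γ : ℝ} (hγ : 0 < γ) :
    ContinuousOn (correctionIntegrand γ) (Set.Ioi (-1)) := by
  intro u hu
  refine ContinuousAt.continuousWithinAt ?_
  rcases eq_or_ne u 0 with rfl | h0
  · exact (analyticAt_correctionIntegrand hγ).continuousAt
  · have hne := one_add_rpow_sub_one_ne_zero hγ hu h0
    have hrp : ContinuousAt (fun x : ℝ => (1 + x) ^ γ) u :=
      (by fun_prop : ContinuousAt (fun x : ℝ => 1 + x) u).rpow_const (.inr hγ.le)
    have : ContinuousAt (fun u => ((1 + u) ^ γ - 1 - γ * u) / (u * ((1 + u) ^ γ - 1))) u :=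
      ((hrp.sub continuousAt_const).sub (by fun_prop)).div
        (continuousAt_id.mul (hrp.sub continuousAt_const)) (mul_ne_zero h0 hne)
    refine this.congr ?_
    filter_upwards [isOpen_ne.mem_nhds h0] with v hv
    simp [correctionIntegrand, show v ≠ 0 from hv]

theorem hasDerivAt_integral_correctionIntegrand {γ y : ℝ} (hγ : 0 < γ) (hy : -1 < y) :
    HasDerivAt (fun y => ∫ u in (0 : ℝ)..y, correctionIntegrand γ u)
      (correctionIntegrand γ y) y := by
  have hc := continuousOn_correctionIntegrand hγ
  have hnhds : Set.Ioi (-1) ∈ 𝓝 y := Ioi_mem_nhds hy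
  refine intervalIntegral.integral_hasDerivAt_right ?_
    (hc.stronglyMeasurableAtFilter isOpen_Ioi y hy) (hc.continuousAt hnhds)
  exact (hc.mono fun t ht => lt_of_lt_of_le (lt_min (by norm_num) hy) ht.1).intervalIntegrable

theorem integrableOn_Ioi_inv_rpow_sub_one {γ a : ℝ} (hγ : 1 < γ) (ha : 1 < a) :
    MeasureTheory.IntegrableOn (fun u : ℝ => (u ^ γ - 1)⁻¹) (Set.Ioi a) := by
  have ha0 : 0 < a := by linarith
  have hlt : a ^ (-γ) < 1 := Real.rpow_lt_one_of_one_lt_of_neg ha (by linarith)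
  refine ((integrableOn_Ioi_rpow_of_lt (a := -γ) (by linarith) ha0).const_mul
    (1 - a ^ (-γ))⁻¹).mono' (by fun_prop) ?_
  refine (MeasureTheory.ae_restrict_mem measurableSet_Ioi).mono fun u hu => ?_
  have hu : a < u := hu
  have hu0 : 0 < u := ha0.trans hu
  have h1 : 1 < u ^ γ := Real.one_lt_rpow (ha.trans hu) (by linarith)
  have h2 : u ^ (-γ) ≤ a ^ (-γ) := Real.rpow_le_rpow_of_nonpos ha0 hu.le (by linarith)
  rw [Real.norm_eq_abs, abs_of_pos (inv_pos.2 (by linarith)), Real.rpow_neg hu0.le, ← mul_inv]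
  refine inv_anti₀ (mul_pos (by linarith) (by linarith)) ?_
  rw [Real.rpow_neg hu0.le] at h2
  have : u ^ γ * (u ^ γ)⁻¹ = 1 := mul_inv_cancel₀ (by linarith)
  nlinarith

theorem strictAntiOn_integral_Ioi_inv_rpow_sub_one {γ : ℝ} (hγ : 1 < γ) :
    StrictAntiOn (fun a : ℝ => ∫ u in Set.Ioi a, (u ^ γ - 1)⁻¹) (Set.Ioi 1) := by
  intro a ha b hb hab
  have ha : 1 < a := ha
  have hint := integrableOn_Ioi_inv_rpow_sub_one hγ ha
  have hsub := intervalIntegral.integral_Ioi_sub_Ioi hint hab.le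
  have hpos : 0 < ∫ u in a..b, (u ^ γ - 1)⁻¹ := by
    refine intervalIntegral.intervalIntegral_pos_of_pos_on ?_ (fun u hu => ?_) hab
    · rw [intervalIntegrable_iff_integrableOn_Ioc_of_le hab.le]
      exact hint.mono_set Set.Ioc_subset_Ioi_self
    · exact inv_pos.2 (sub_pos.2 (Real.one_lt_rpow (ha.trans hu.1) (by linarith)))
  show (∫ u in Set.Ioi b, (u ^ γ - 1)⁻¹) < ∫ u in Set.Ioi a, (u ^ γ - 1)⁻¹
  linarith

theorem integral_Ioi_one_shift (γ : ℝ) :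
    (∫ u in Set.Ioi (1 : ℝ), ((u + 1) ^ γ - 1)⁻¹) = ∫ u in Set.Ioi (2 : ℝ), (u ^ γ - 1)⁻¹ := by
  have := (MeasureTheory.measurePreserving_add_right MeasureTheory.volume (1 : ℝ)).setIntegral_preimage_emb
    (MeasurableEquiv.addRight (1 : ℝ)).measurableEmbedding (fun u => (u ^ γ - 1)⁻¹) (Set.Ioi 2)
  norm_num at this
  exact this

theorem integral_Ioi_one_shift_pos {γ : ℝ} (hγ : 1 < γ) :
    0 < ∫ u in Set.Ioi (1 : ℝ), ((u + 1) ^ γ - 1)⁻¹ := by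
  rw [integral_Ioi_one_shift]
  have h := strictAntiOn_integral_Ioi_inv_rpow_sub_one hγ (a := 2) (b := 3) (by simp) (by simp)
    (by norm_num)
  refine lt_of_le_of_lt ?_ h
  refine MeasureTheory.setIntegral_nonneg measurableSet_Ioi fun u hu => ?_
  have hu : 3 < u := hu
  exact inv_nonneg.2 (sub_nonneg.2 (Real.one_le_rpow (by linarith) (by linarith)))

/-- Along solutions of `w' = -(w ^ γ - 1)` the quantity `γ y + log φ - G φ`, `φ = w - 1`, is
conserved. -/
theorem rpow_ode_first_integral_eq {γ : ℝ} (hγ : 0 < γ) {w : ℝ → ℝ}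
    (hw_gt : ∀ y ∈ Set.Ioi (0 : ℝ), 1 < w y)
    (hw_deriv : ∀ y ∈ Set.Ioi (0 : ℝ), HasDerivAt w (-(w y ^ γ - 1)) y) {a b : ℝ}
    (ha : 0 < a) (hb : 0 < b) :
    γ * a + Real.log (w a - 1) - (∫ u in (0 : ℝ)..w a - 1, correctionIntegrand γ u) =
      γ * b + Real.log (w b - 1) - ∫ u in (0 : ℝ)..w b - 1, correctionIntegrand γ u := by
  set H : ℝ → ℝ := fun y => γ * y + Real.log (w y - 1) -
    ∫ u in (0 : ℝ)..w y - 1, correctionIntegrand γ u with hH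
  have hd : ∀ y ∈ Set.Ioi (0 : ℝ), HasDerivAt H 0 y := fun y hy => by
    have hpos : 0 < w y - 1 := sub_pos.2 (hw_gt y hy)
    have hφ := (hw_deriv y hy).sub_const 1
    have hG := (hasDerivAt_integral_correctionIntegrand hγ
      (by linarith : -1 < w y - 1)).comp y hφ
    have hd : HasDerivAt H _ y := (((hasDerivAt_id y).const_mul γ).add (hφ.log hpos.ne')).sub hG
    convert! hd using 1
    have hne := one_add_rpow_sub_one_ne_zero hγ (by linarith : -1 < w y - 1) hpos.ne'
    rw [add_sub_cancel] at hne
    rw [correctionIntegrand, if_neg hpos.ne', add_sub_cancel]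
    have := hpos.ne'
    field_simp
    ring
  exact isOpen_Ioi.is_const_of_deriv_eq_zero isPreconnected_Ioi
    (fun y hy => (hd y hy).differentiableAt.differentiableWithinAt)
    (fun y hy => (hd y hy).deriv) ha hb

/-- A positive bounded solution of `exp (γ y - C) φ(y) = exp (G (φ y))` tends to `0`. -/
theorem tendsto_zero_of_exp_mul_eq {γ C a M : ℝ} (hγ : 0 < γ) {φ G : ℝ → ℝ}
    (hG : ContinuousOn G (Set.Icc 0 M)) (hφ : ∀ y, a ≤ y → φ y ∈ Set.Icc 0 M)
    (h : ∀ y, a ≤ y → Real.exp (γ * y - C) * φ y = Real.exp (G (φ y))) :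
    Tendsto φ atTop (𝓝 0) := by
  obtain ⟨B, hB⟩ := (isCompact_Icc.image_of_continuousOn hG).bddAbove
  have hlim : Tendsto (fun y => Real.exp (-(γ * y - C) + B)) atTop (𝓝 0) := by
    refine Real.tendsto_exp_atBot.comp (tendsto_atBot_add_const_right _ _ ?_)
    refine tendsto_neg_atTop_atBot.comp (tendsto_atTop_add_const_right _ (-C) ?_)
    exact tendsto_id.const_mul_atTop hγ
  refine tendsto_of_tendsto_of_tendsto_of_le_of_le' tendsto_const_nhds hlim ?_ ?_
  · filter_upwards [eventually_ge_atTop a] with y hy using (hφ y hy).1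
  · filter_upwards [eventually_ge_atTop a] with y hy
    have h1 : G (φ y) ≤ B := hB ⟨_, hφ y hy, rfl⟩
    have h2 : φ y = Real.exp (-(γ * y - C)) * Real.exp (G (φ y)) := by
      rw [← h y hy, ← mul_assoc, ← Real.exp_add]
      simp
    rw [h2, Real.exp_add]
    gcongr

/-- Lemma 4.6.  Fix `γ ∈ (1,2]`, let `w` be the unique decreasing
function with `∫_{w(y)}^∞ du/(u^γ − 1) = y` and `w' = −(w^γ − 1)`; set `φ := w − 1`,
`y₀ := ∫_1^∞ du/((u+1)^γ − 1)`, `G` and `C₀` as in the context.  Then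
`e^{γy − C₀} φ(y) = exp(G(φ(y)))` for `y ≥ y₀`, and there are a sequence `(β_n)_{n≥1}`
and `y₁ ≥ y₀` with `Σ |β_n| e^{−γny₁} < ∞`, `φ(y) = Σ_{n≥1} β_n e^{−γny}` for `y ≥ y₁`,
`β₁ = e^{C₀}` and `β₂ = ((γ−1)/2) e^{2C₀}`. -/
theorem stmt13 (γ : ℝ) (hγ1 : 1 < γ) (hγ2 : γ ≤ 2)
    (w : ℝ → ℝ)
    (hw_gt : ∀ y ∈ Set.Ioi (0:ℝ), 1 < w y)
    (hw_int : ∀ y ∈ Set.Ioi (0:ℝ), (∫ u in Set.Ioi (w y), (u ^ γ - 1)⁻¹) = y)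
    (hw_deriv : ∀ y ∈ Set.Ioi (0:ℝ), HasDerivAt w (-(w y ^ γ - 1)) y)
    (G : ℝ → ℝ)
    (hG : ∀ y : ℝ, G y = ∫ u in (0:ℝ)..y,
      (if u = 0 then (γ - 1)/2
        else ((1 + u) ^ γ - 1 - γ * u) / (u * ((1 + u) ^ γ - 1))))
    (y₀ C₀ : ℝ)
    (hy₀ : y₀ = ∫ u in Set.Ioi (1:ℝ), ((u + 1) ^ γ - 1)⁻¹)
    (hC₀ : C₀ = γ * (∫ u in Set.Ioi (1:ℝ), ((u + 1) ^ γ - 1)⁻¹)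
      - ∫ u in (0:ℝ)..1,
          (if u = 0 then (γ - 1)/2
            else ((1 + u) ^ γ - 1 - γ * u) / (u * ((1 + u) ^ γ - 1)))) :
    (∀ y : ℝ, y₀ ≤ y →
      Real.exp (γ * y - C₀) * (w y - 1) = Real.exp (G (w y - 1))) ∧
    ∃ β : ℕ → ℝ, ∃ y₁ : ℝ, y₀ ≤ y₁ ∧
      Summable (fun n : ℕ => |β (n + 1)| * Real.exp (-(γ * ((n:ℝ) + 1) * y₁))) ∧
      (∀ y : ℝ, y₁ ≤ y →
        w y - 1 = ∑' n : ℕ, β (n + 1) * Real.exp (-(γ * ((n:ℝ) + 1) * y))) ∧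
      β 1 = Real.exp C₀ ∧ β 2 = ((γ - 1)/2) * Real.exp (2 * C₀) := by
  have hγ : 0 < γ := by linarith
  have hG' : G = fun y => ∫ u in (0 : ℝ)..y, correctionIntegrand γ u := funext hG
  have hC₀' : C₀ = γ * y₀ - G 1 := by rw [hC₀, hG, hy₀]
  have hy₀_pos : 0 < y₀ := hy₀ ▸ integral_Ioi_one_shift_pos hγ1
  have hw₀ : w y₀ = 2 := by
    refine (strictAntiOn_integral_Ioi_inv_rpow_sub_one hγ1).injOn (hw_gt y₀ hy₀_pos) (by simp) ?_
    rw [hw_int y₀ hy₀_pos, ← integral_Ioi_one_shift, hy₀]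
  have hGd : ∀ y, -1 < y → HasDerivAt G (correctionIntegrand γ y) y := fun y hy => by
    rw [hG']
    exact hasDerivAt_integral_correctionIntegrand hγ hy
  have hφ_pos : ∀ y, y₀ ≤ y → 0 < w y - 1 := fun y hy =>
    sub_pos.2 (hw_gt y (hy₀_pos.trans_le hy))
  have heq : ∀ y, y₀ ≤ y → Real.exp (γ * y - C₀) * (w y - 1) = Real.exp (G (w y - 1)) := by
    intro y hy
    have h := rpow_ode_first_integral_eq hγ hw_gt hw_deriv (hy₀_pos.trans_le hy) hy₀_pos
    have h1 : γ * y + Real.log (w y - 1) - G (w y - 1) = C₀ := by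
      rw [hC₀', hG']
      rw [hw₀] at h
      norm_num at h
      exact h
    have h2 : G (w y - 1) = γ * y - C₀ + Real.log (w y - 1) := by linarith
    rw [h2, Real.exp_add, Real.exp_log (hφ_pos y hy)]
  refine ⟨heq, ?_⟩
  have hanti : AntitoneOn w (Set.Ici y₀) := by
    refine antitoneOn_of_deriv_nonpos (convex_Ici y₀)
      (fun y hy => (hw_deriv y (hy₀_pos.trans_le hy)).continuousAt.continuousWithinAt)
      (fun y hy => ?_) fun y hy => ?_ <;> rw [interior_Ici] at hy
    · exact (hw_deriv y (hy₀_pos.trans hy)).differentiableAt.differentiableWithinAt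
    · rw [(hw_deriv y (hy₀_pos.trans hy)).deriv, neg_nonpos, sub_nonneg]
      exact Real.one_le_rpow (hw_gt y (hy₀_pos.trans hy)).le hγ.le
  have hφ_mem : ∀ y, y₀ ≤ y → w y - 1 ∈ Set.Icc (0 : ℝ) 1 := fun y hy =>
    ⟨(hφ_pos y hy).le, by linarith [hanti Set.self_mem_Ici hy hy]⟩
  have hlim : Tendsto (fun y => w y - 1) atTop (𝓝 0) :=
    tendsto_zero_of_exp_mul_eq hγ
      (fun y hy => (hGd y (by linarith [hy.1])).continuousAt.continuousWithinAt) hφ_mem heq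
  obtain ⟨c, hc1, hc2, hc⟩ := exists_hasSum_inverse_mul_exp_neg (G := G)
    (hG' ▸ (analyticAt_correctionIntegrand hγ).intervalIntegral_zero) (by simp [hG'])
    (hGd 0 (by norm_num))
  obtain ⟨y₁, hy₁⟩ := eventually_atTop.1 ((hlim.eventually hc).and (eventually_ge_atTop y₀))
  have hsum : ∀ y, y₁ ≤ y → HasSum (fun n : ℕ =>
      c (n + 1) * Real.exp C₀ ^ (n + 1) * Real.exp (-(γ * ((n : ℝ) + 1) * y))) (w y - 1) := by
    intro y hy
    obtain ⟨h, hy'⟩ := hy₁ y hy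
    have hz : (w y - 1) * Real.exp (-G (w y - 1)) = Real.exp C₀ * Real.exp (-(γ * y)) := by
      rw [Real.exp_neg, ← heq y hy', ← Real.exp_add, show C₀ + -(γ * y) = -(γ * y - C₀) by ring,
        Real.exp_neg]
      have := (hφ_pos y hy').ne'
      field_simp
    rw [hz] at h
    convert! h using 2 with n
    rw [mul_pow, ← Real.exp_nat_mul (-(γ * y)), mul_assoc]
    push_cast
    ring_nf
  refine ⟨fun n => c n * Real.exp C₀ ^ n, y₁, (hy₁ y₁ le_rfl).2, ?_, fun y hy => ?_, ?_, ?_⟩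
  · simpa only [abs_mul, Real.abs_exp] using (hsum y₁ le_rfl).summable.abs
  · exact (hsum y hy).tsum_eq.symm
  · simp [hc1]
  · simp [hc2, correctionIntegrand, two_mul, Real.exp_add, sq]
end
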